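/- arXiv:2303.14852 — 3 statements merged into one kernel-verified Lean document; each statement's English description precedes it below -/
import Mathlib

section
/- Assume that f ≥ 2 holds, or that both n ≥ 3 and (p,n) ≠ (3,3) hold. Let N be a maximal proper ℤ_p-submodule of sl_1(Δ) (equivalently, a ℤ_p-submodule of additive index p). Then [N,N] = [sl_1(Δ), sl_1(Δ)], where [M,M] denotes the set of finite sums of Lie brackets of elements of M. -/
namespace SlOne

section NormPart

variable {p : ℕ} [Fact (Nat.Prime p)] {E : Type} [Field E] [Algebra ℚ_[p] E]
  [FiniteDimensional ℚ_[p] E] [Algebra ℤ_[p] E] [IsScalarTower ℤ_[p] ℚ_[p] E]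

theorem integral_iff (x : E) :
    x ∈ integralClosure ℤ_[p] E ↔ spectralMulAlgNorm ℚ_[p] E x ≤ 1 := by
  have hx : IsIntegral ℚ_[p] x := Algebra.IsIntegral.isIntegral x
  rw [spectralMulAlgNorm_def, mem_integralClosure_iff, spectralNorm,
    spectralValue_le_one_iff (minpoly.monic hx)]
  constructor
  · intro h n
    have := minpoly.isIntegrallyClosed_eq_field_fractions' ℚ_[p] h
    rw [this, Polynomial.coeff_map]
    exact PadicInt.norm_le_one _
  · intro h
    have hl : minpoly ℚ_[p] x ∈ Polynomial.lifts (algebraMap ℤ_[p] ℚ_[p]) := by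
      rw [Polynomial.lifts_iff_coeff_lifts]
      intro n
      exact ⟨⟨_, h n⟩, rfl⟩
    obtain ⟨q, hq, -, hm⟩ := Polynomial.lifts_and_natDegree_eq_and_monic hl (minpoly.monic hx)
    refine ⟨q, hm, ?_⟩
    have := minpoly.aeval ℚ_[p] x
    rw [← hq, Polynomial.aeval_map_algebraMap] at this
    exact this

theorem unit_of_norm (x : integralClosure ℤ_[p] E)
    (hx : spectralMulAlgNorm ℚ_[p] E (x : E) = 1) : IsUnit x := by
  have h0 : (x : E) ≠ 0 := by
    intro h; rw [h] at hx; simp at hx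
  have : (x : E)⁻¹ ∈ integralClosure ℤ_[p] E := by
    rw [integral_iff]
    have h1 : spectralMulAlgNorm ℚ_[p] E ((x : E) * (x : E)⁻¹) = 1 := by
      rw [mul_inv_cancel₀ h0, map_one]
    rw [map_mul, hx, one_mul] at h1
    exact h1.le
  refine IsUnit.of_mul_eq_one ⟨_, this⟩ ?_
  ext; simp [h0]

theorem norm_of_unit (x : integralClosure ℤ_[p] E) (hx : IsUnit x) :
    spectralMulAlgNorm ℚ_[p] E (x : E) = 1 := by
  obtain ⟨y, hy⟩ := hx.exists_right_inv
  have h1 := (integral_iff (p := p) (x : E)).1 x.2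
  have h2 := (integral_iff (p := p) (y : E)).1 y.2
  have h3 : spectralMulAlgNorm ℚ_[p] E ((x : E) * y) = 1 := by
    have : (x : E) * y = 1 := by exact_mod_cast congrArg Subtype.val hy
    rw [this, map_one]
  rw [map_mul] at h3
  have := apply_nonneg (spectralMulAlgNorm ℚ_[p] E) (x : E)
  nlinarith

theorem unit_or_dvd (π x : integralClosure ℤ_[p] E) (hπ : Irreducible π) :
    IsUnit x ∨ π ∣ x := by
  have h1 := (integral_iff (p := p) (x : E)).1 x.2
  rcases h1.eq_or_lt with h | h
  · exact Or.inl (unit_of_norm x h)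
  right
  have hπ0 : (π : E) ≠ 0 := by
    intro h; exact hπ.ne_zero (Subtype.ext h)
  by_cases hx0 : (x : E) = 0
  · have : x = 0 := Subtype.ext hx0
    simp [this]
  have key : ∀ a b : integralClosure ℤ_[p] E, (a : E) ≠ 0 →
      spectralMulAlgNorm ℚ_[p] E (b : E) ≤ spectralMulAlgNorm ℚ_[p] E (a : E) → a ∣ b := by
    intro a b ha hab
    have : (b : E) / a ∈ integralClosure ℤ_[p] E := by
      rw [integral_iff]
      have hpos : 0 < spectralMulAlgNorm ℚ_[p] E (a : E) := by
        apply lt_of_le_of_ne (apply_nonneg _ _)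
        intro h
        exact ha ((map_eq_zero_iff_eq_zero (spectralMulAlgNorm ℚ_[p] E)).1 h.symm)
      have h3 : spectralMulAlgNorm ℚ_[p] E ((b : E) / a) * spectralMulAlgNorm ℚ_[p] E (a : E)
          = spectralMulAlgNorm ℚ_[p] E (b : E) := by
        rw [← map_mul, div_mul_cancel₀ _ ha]
      nlinarith
    exact ⟨⟨_, this⟩, by ext; simp; field_simp⟩
  rcases le_total (spectralMulAlgNorm ℚ_[p] E (x : E)) (spectralMulAlgNorm ℚ_[p] E (π : E)) with hl | hl
  · exact key _ _ hπ0 hl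
  · obtain ⟨c, hc⟩ := key _ _ hx0 hl
    rcases hπ.isUnit_or_isUnit hc with hu | hu
    · exact absurd (norm_of_unit x hu) h.ne
    · obtain ⟨u, rfl⟩ := hu
      exact ⟨(u⁻¹ : _ˣ), by rw [hc]; simp [mul_assoc]⟩

theorem p_not_unit : ¬ IsUnit (p : integralClosure ℤ_[p] E) := by
  intro h
  have := norm_of_unit _ h
  have h2 : ((p : integralClosure ℤ_[p] E) : E) = algebraMap ℚ_[p] E (p : ℚ_[p]) := by
    simp
  rw [h2, spectralMulAlgNorm_def, spectralNorm_extends, Padic.norm_p] at this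
  have h3 := (Fact.out : p.Prime).one_lt
  have h4 : (1 : ℝ) < p := by exact_mod_cast h3
  rw [inv_eq_one] at this
  linarith

theorem finite_int : Module.Finite ℤ_[p] (integralClosure ℤ_[p] E) :=
  IsIntegralClosure.finite ℤ_[p] ℚ_[p] E (integralClosure ℤ_[p] E)

theorem inter_pow (π x : integralClosure ℤ_[p] E) (hπ : Irreducible π) (h : ∀ s : ℕ, π ^ s ∣ x) :
    x = 0 := by
  have := finite_int (p := p) (E := E)
  have : IsNoetherianRing (integralClosure ℤ_[p] E) := IsNoetherianRing.of_finite ℤ_[p] _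
  have h1 := Ideal.iInf_pow_eq_bot_of_isDomain (Ideal.span {π})
    (by rw [Ne, Ideal.span_singleton_eq_top]; exact hπ.not_isUnit)
  have : x ∈ (⨅ i : ℕ, Ideal.span {π} ^ i) := by
    rw [Ideal.mem_iInf]
    intro i
    rw [Ideal.span_singleton_pow, Ideal.mem_span_singleton]
    exact h i
  rw [h1] at this
  exact this

/-- Frobenius-type congruence: a power `Q` divisible by `p` with `a^Q ≡ a` modulo `π`. -/
theorem exists_pow_congr (π : integralClosure ℤ_[p] E) (hπ : Irreducible π) :
    ∃ Q : ℕ, p ∣ Q ∧ ∀ a : integralClosure ℤ_[p] E, π ∣ a ^ Q - a := by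
  have hmax : (Ideal.span {π}).IsMaximal := by
    rw [Ideal.isMaximal_iff]
    constructor
    · rw [Ideal.mem_span_singleton]; exact fun h => hπ.not_isUnit (isUnit_of_dvd_one h)
    · intro J x hJ hx hxJ
      rw [Ideal.mem_span_singleton] at hx
      have := (unit_or_dvd π x hπ).resolve_right hx
      rw [← Ideal.eq_top_iff_one]
      exact Ideal.eq_top_of_isUnit_mem _ hxJ this
  let := Ideal.Quotient.field (Ideal.span {π})
  have hp : π ∣ (p : integralClosure ℤ_[p] E) := (unit_or_dvd π _ hπ).resolve_left p_not_unit
  have hfin : Module.Finite ℤ_[p] (integralClosure ℤ_[p] E) := finite_int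
  have hfin2 : Module.Finite ℤ_[p] (integralClosure ℤ_[p] E ⧸ Ideal.span {π}) := inferInstance
  have hp0 : (p : integralClosure ℤ_[p] E ⧸ Ideal.span {π}) = 0 := by
    have := (Ideal.Quotient.eq_zero_iff_mem (I := Ideal.span {π})).2 (Ideal.mem_span_singleton.2 hp)
    rw [← this]; simp
  have hF : Finite (integralClosure ℤ_[p] E ⧸ Ideal.span {π}) := by
    let κ := integralClosure ℤ_[p] E ⧸ Ideal.span {π}
    let g : (ℤ_[p] ⧸ (IsLocalRing.maximalIdeal ℤ_[p])) →+* κ := Ideal.Quotient.lift _ (algebraMap ℤ_[p] κ) (by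
      intro a ha
      rw [PadicInt.maximalIdeal_eq_span_p, Ideal.mem_span_singleton] at ha
      obtain ⟨b, rfl⟩ := ha
      rw [map_mul, map_natCast, hp0, zero_mul])
    let := g.toAlgebra
    have : IsScalarTower ℤ_[p] (ℤ_[p] ⧸ (IsLocalRing.maximalIdeal ℤ_[p])) κ := IsScalarTower.of_algebraMap_eq (by
      intro x; rfl)
    have : Module.Finite (ℤ_[p] ⧸ (IsLocalRing.maximalIdeal ℤ_[p])) κ := Module.Finite.of_restrictScalars_finite ℤ_[p] _ _
    have : Finite (ℤ_[p] ⧸ (IsLocalRing.maximalIdeal ℤ_[p])) :=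
      Finite.of_equiv (ZMod p) (PadicInt.residueField (p := p)).symm.toEquiv
    exact Module.finite_of_finite (ℤ_[p] ⧸ (IsLocalRing.maximalIdeal ℤ_[p]))
  have := Fintype.ofFinite (integralClosure ℤ_[p] E ⧸ Ideal.span {π})
  refine ⟨Fintype.card (integralClosure ℤ_[p] E ⧸ Ideal.span {π}), ?_, ?_⟩
  · have : CharP (integralClosure ℤ_[p] E ⧸ Ideal.span {π}) p := (CharP.charP_iff_prime_eq_zero Fact.out).2 hp0
    obtain ⟨n, hn, h⟩ := FiniteField.card (integralClosure ℤ_[p] E ⧸ Ideal.span {π}) p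
    rw [h]
    exact dvd_pow_self _ n.ne_zero
  · intro a
    rw [← Ideal.mem_span_singleton, ← Ideal.Quotient.eq_zero_iff_mem, map_sub, map_pow,
      FiniteField.pow_card, sub_self]

end NormPart

end SlOne
namespace SlOne

section Residue

set_option linter.unusedSectionVars false

variable {R : Type} [CommRing R] [IsDomain R]

theorem rigid (π : R) (p Q : ℕ) (hpQ : p ∣ Q) (hp : π ∣ (p : R)) (hQ : ∀ a : R, π ∣ a ^ Q - a)
    (hinter : ∀ x : R, (∀ s : ℕ, π ^ s ∣ x) → x = 0) (σ : R →+* R) (hσ : σ π = π)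
    (h : ∀ a, π ∣ σ a - a) (a : R) : σ a = a := by
  have hQ' : π ∣ (Q : R) := hp.trans (Nat.cast_dvd_cast hpQ)
  have key : ∀ s : ℕ, ∀ a, π ^ (s + 1) ∣ σ a - a := by
    intro s
    induction s with
    | zero => simpa using h
    | succ s ih =>
      intro a
      obtain ⟨b, hb⟩ := hQ a
      have ha : a = a ^ Q - π * b := by rw [← hb]; ring
      have e : σ a - a = ((σ a) ^ Q - a ^ Q) - π * (σ b - b) := by
        conv_lhs => rw [ha]
        rw [map_sub, map_mul, map_pow, hσ]; ring
      rw [e]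
      apply dvd_sub
      · rw [← geom_sum₂_mul, pow_succ' π]
        apply mul_dvd_mul
        · rw [dvd_geom_sum₂_iff_of_dvd_sub (h a)]
          exact hQ'.mul_right _
        · exact ih a
      · rw [pow_succ' π]
        exact mul_dvd_mul_left _ (ih b)
  have := hinter (σ a - a) (fun s => (pow_dvd_pow π (Nat.le_succ s)).trans (key s a))
  exact sub_eq_zero.1 this

theorem dedekind (π : R) (hπ : Prime π) (θ : R →+* R) (hrefl : ∀ x, π ∣ θ x → π ∣ x)
    (n : ℕ) (hθ : ∀ m, 1 ≤ m → m < n → ∃ a, ¬ π ∣ (θ ^ m) a - a)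
    (u : ℕ → R) (h : ∀ a, π ∣ ∑ i ∈ Finset.range n, u i * (θ ^ i) a) :
    ∀ i, i < n → π ∣ u i := by
  have : (Ideal.span {π}).IsPrime := (Ideal.span_singleton_prime hπ.ne_zero).2 hπ
  let κ := R ⧸ Ideal.span {π}
  have hz : ∀ x : R, Ideal.Quotient.mk (Ideal.span {π}) x = 0 ↔ π ∣ x := by
    intro x; rw [Ideal.Quotient.eq_zero_iff_mem, Ideal.mem_span_singleton]
  have hr : ∀ i x, π ∣ (θ ^ i) x → π ∣ x := by
    intro i
    induction i with
    | zero => intro x hx; simpa using hx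
    | succ i ih => intro x hx; rw [pow_succ'] at hx; exact ih _ (hrefl _ hx)
  let c : Fin n → (R →* κ) := fun i =>
    ((Ideal.Quotient.mk (Ideal.span {π})).comp (θ ^ (i : ℕ)) : R →+* κ)
  have hne : ∀ i j : Fin n, i < j → c i ≠ c j := by
    intro i j hij heq
    obtain ⟨a, ha⟩ := hθ (j - i : ℕ) (by omega) (by omega)
    apply ha
    apply hr i
    rw [← hz, map_sub, map_sub, sub_eq_zero]
    have e : (θ ^ (i : ℕ)) ((θ ^ (j - i : ℕ)) a) = (θ ^ (j : ℕ)) a := by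
      rw [← RingHom.comp_apply, ← RingHom.mul_def, ← pow_add]
      congr 2
      omega
    rw [e]
    exact (DFunLike.congr_fun heq a).symm
  have hinj : Function.Injective c := by
    intro i j hij
    rcases lt_trichotomy i j with h1 | h1 | h1
    · exact absurd hij (hne _ _ h1)
    · exact h1
    · exact absurd hij.symm (hne _ _ h1)
  have hli := (linearIndependent_monoidHom R κ).comp c hinj
  rw [Fintype.linearIndependent_iff] at hli
  intro i hi
  rw [← hz]
  refine hli (fun i => Ideal.Quotient.mk (Ideal.span {π}) (u i)) ?_ ⟨i, hi⟩
  ext a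
  have := (hz _).2 (h a)
  rw [Finset.sum_range, map_sum] at this
  simpa [c] using this

theorem exists_r1 (π : R) (hπ : Prime π) (θ : R →+* R) (hrefl : ∀ x, π ∣ θ x → π ∣ x)
    (n : ℕ) (hθ : ∀ m, 1 ≤ m → m < n → ∃ a, ¬ π ∣ (θ ^ m) a - a) (hθn : ∀ a, (θ ^ n) a = a)
    (hn : 3 ≤ n) (m : ℕ) (hm : 1 ≤ m) (hmn : m < n) :
    ∃ b, ¬ π ∣ (b - θ b) - (θ ^ m) (b - θ b) := by
  by_contra hcon
  push Not at hcon
  have h1 : ¬ π ∣ (1 : R) := fun h => hπ.not_isUnit (isUnit_of_dvd_one h)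
  have hexp : ∀ b, (b - θ b) - (θ ^ m) (b - θ b)
      = (θ ^ 0) b - (θ ^ 1) b - (θ ^ m) b + (θ ^ (m + 1)) b := by
    intro b
    rw [pow_succ θ m, map_sub]; simp; ring
  by_cases hm1 : m + 1 < n
  · have := dedekind π hπ θ hrefl n hθ (fun i => (if i = 0 then 1 else 0) - (if i = 1 then 1 else 0)
        - (if i = m then 1 else 0) + (if i = m + 1 then 1 else 0)) (by
      intro b
      have hb := hcon b
      rw [hexp] at hb
      simp only [add_mul, sub_mul, ite_mul, one_mul, zero_mul, Finset.sum_add_distrib,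
        Finset.sum_sub_distrib, Finset.sum_ite_eq', Finset.mem_range]
      rw [if_pos (by omega), if_pos (by omega), if_pos (by omega), if_pos (by omega)]
      exact hb)
    have h0 := this 0 (by omega)
    rw [if_pos rfl, if_neg (by omega), if_neg (by omega), if_neg (by omega)] at h0
    exact h1 (by simpa using h0)
  · have hmn' : m + 1 = n := by omega
    have := dedekind π hπ θ hrefl n hθ (fun i => (if i = 0 then 2 else 0) - (if i = 1 then 1 else 0)
        - (if i = m then 1 else 0)) (by
      intro b
      have hb := hcon b
      rw [hexp, hmn', hθn] at hb
      simp only [sub_mul, ite_mul, one_mul, zero_mul,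
        Finset.sum_sub_distrib, Finset.sum_ite_eq', Finset.mem_range]
      rw [if_pos (by omega), if_pos (by omega), if_pos (by omega)]
      convert hb using 1
      simp; ring)
    have h0 := this 1 (by omega)
    rw [if_neg (by omega), if_pos (by omega), if_neg (by omega)] at h0
    exact h1 (by simpa using h0)

theorem int_dvd (π : R) (hπ : Prime π)
    (p : ℕ) (hpr : p.Prime) (hp : π ∣ (p : R)) (c : ℤ) (h : π ∣ (c : R)) :
    (p : ℤ) ∣ c := by
  by_contra hc
  have hco : IsCoprime (p : ℤ) c := ((Nat.prime_iff_prime_int.1 hpr).coprime_iff_not_dvd).2 hc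
  obtain ⟨a, b, hab⟩ := hco
  apply hπ.not_isUnit
  apply isUnit_of_dvd_one
  have : (1 : R) = a * p + b * c := by exact_mod_cast congrArg (Int.cast : ℤ → R) hab.symm
  rw [this]
  exact dvd_add (hp.mul_left _) (h.mul_left _)

theorem exists_r2 (π : R) (hπ : Prime π) (θ : R →+* R) (hrefl : ∀ x, π ∣ θ x → π ∣ x)
    (hθπ : θ π = π) (n : ℕ) (hθ : ∀ m, 1 ≤ m → m < n → ∃ a, ¬ π ∣ (θ ^ m) a - a) (hθn : ∀ a, (θ ^ n) a = a)
    (hn : 3 ≤ n) (p : ℕ) (hpr : p.Prime) (hp : π ∣ (p : R))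
    (hp3 : ¬ (p = 3 ∧ n = 3)) :
    ∃ b₁ b₂, ∀ c₁ c₂ : ℤ, π ∣ c₁ * ((b₁ - θ b₁) - θ (b₁ - θ b₁)) + c₂ * ((b₂ - θ b₂) - θ (b₂ - θ b₂)) →
      (p : ℤ) ∣ c₁ ∧ (p : ℤ) ∣ c₂ := by
  obtain ⟨b₁, hb₁⟩ := exists_r1 π hπ θ hrefl n hθ hθn hn 1 le_rfl (by omega)
  rw [pow_one] at hb₁
  by_contra hcon
  push Not at hcon
  have hcast : ∀ c : ℤ, (p : ℤ) ∣ c → π ∣ (c : R) := by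
    intro c hc
    obtain ⟨k, rfl⟩ := hc
    push_cast
    exact hp.mul_right _
  have hpush : ∀ x, π ∣ x → π ∣ θ x := by
    rintro x ⟨y, rfl⟩
    rw [map_mul, hθπ]; exact dvd_mul_right _ _
  set w := (b₁ - θ b₁) - θ (b₁ - θ b₁) with hw
  have key : ∀ b, π ∣ θ w * ((b - θ b) - θ (b - θ b)) - w * θ ((b - θ b) - θ (b - θ b)) := by
    intro b
    obtain ⟨c₁, c₂, hc, hcc⟩ := hcon b₁ b
    rw [← hw] at hc
    set g := (b - θ b) - θ (b - θ b) with hg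
    have hc2 : ¬ (p : ℤ) ∣ c₂ := by
      intro h2
      apply hcc _ h2
      have : π ∣ c₁ * w := by
        have := dvd_sub hc ((hcast _ h2).mul_right g)
        simpa using this
      exact int_dvd π hπ p hpr hp _ ((hπ.dvd_or_dvd this).resolve_right hb₁)
    have h2 := hpush _ hc
    have h3 : π ∣ (c₂ : R) * (θ w * g - w * θ g) := by
      have := dvd_sub (hc.mul_left (θ w)) (h2.mul_left w)
      convert this using 1
      simp only [map_add, map_mul, map_intCast]; ring
    exact (hπ.dvd_or_dvd h3).resolve_left (fun h => hc2 (int_dvd π hπ p hpr hp _ h))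
  have hexp : ∀ b, θ w * ((b - θ b) - θ (b - θ b)) - w * θ ((b - θ b) - θ (b - θ b)) =
      θ w * (θ ^ 0) b + (-2 * θ w - w) * (θ ^ 1) b + (θ w + 2 * w) * (θ ^ 2) b + (- w) * (θ ^ 3) b := by
    intro b
    simp [pow_succ]; ring
  by_cases hn4 : 4 ≤ n
  · have := dedekind π hπ θ hrefl n hθ (fun i => (if i = 0 then θ w else 0)
        + (if i = 1 then (-2 * θ w - w) else 0)
        + (if i = 2 then (θ w + 2 * w) else 0) + (if i = 3 then - w else 0)) (by
      intro b
      have hb := key b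
      rw [hexp] at hb
      simp only [add_mul, ite_mul, zero_mul, Finset.sum_add_distrib,
        Finset.sum_ite_eq', Finset.mem_range]
      rw [if_pos (by omega), if_pos (by omega), if_pos (by omega), if_pos (by omega)]
      rw [← add_mul]
      exact hb)
    have h0 := this 3 (by omega)
    exact hb₁ (by simpa using h0)
  · have hn3 : n = 3 := by omega
    subst hn3
    have := dedekind π hπ θ hrefl 3 hθ (fun i => (if i = 0 then θ w - w else 0)
        + (if i = 1 then (-2 * θ w - w) else 0)
        + (if i = 2 then (θ w + 2 * w) else 0)) (by
      intro b
      have hb := key b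
      rw [hexp, hθn] at hb
      simp only [Finset.sum_range_succ, Finset.sum_range_zero]
      convert hb using 1
      simp; ring)
    have h0 := this 0 (by omega)
    have h1 := this 1 (by omega)
    simp at h0 h1
    have h2 : π ∣ ((3 : ℤ) : R) * w := by
      have := dvd_add (h0.mul_left 2) h1
      rw [← dvd_neg]
      convert this using 1
      push_cast; ring
    have h3 := int_dvd π hπ p hpr hp 3 ((hπ.dvd_or_dvd h2).resolve_right hb₁)
    apply hp3
    refine ⟨?_, rfl⟩
    have : p ∣ 3 := by exact_mod_cast h3
    exact (Nat.prime_dvd_prime_iff_eq hpr Nat.prime_three).1 this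

theorem exists_r3 (π : R) (hπ : Prime π) (θ : R →+* R)
    (hθπ : θ π = π) (n : ℕ) (hθ : ∀ m, 1 ≤ m → m < n → ∃ a, ¬ π ∣ (θ ^ m) a - a)
    (hn : 3 ≤ n) (p : ℕ) (hpr : p.Prime) (hp : π ∣ (p : R)) :
    ∃ a b : R, ∀ c₀ c₁ c₂ : ℤ, π ∣ c₀ + c₁ * a + c₂ * b →
      (p : ℤ) ∣ c₀ ∧ (p : ℤ) ∣ c₁ ∧ (p : ℤ) ∣ c₂ := by
  obtain ⟨a, ha⟩ := hθ 1 le_rfl (by omega)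
  rw [pow_one] at ha
  by_contra hcon
  push Not at hcon
  have hcast : ∀ c : ℤ, (p : ℤ) ∣ c → π ∣ (c : R) := by
    intro c hc
    obtain ⟨k, rfl⟩ := hc
    push_cast
    exact hp.mul_right _
  have hpush : ∀ x, π ∣ x → π ∣ θ x := by
    rintro x ⟨y, rfl⟩
    rw [map_mul, hθπ]; exact dvd_mul_right _ _
  have hunit : ∀ (c : ℤ) (x : R), ¬ (p : ℤ) ∣ c → π ∣ c * x → π ∣ x := fun c x hc h =>
    (hπ.dvd_or_dvd h).resolve_left (fun h' => hc (int_dvd π hπ p hpr hp _ h'))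
  have main : ∀ b, ∃ c₀ c₁ c₂ : ℤ, π ∣ c₀ + c₁ * a + c₂ * b ∧ ¬ (p : ℤ) ∣ c₂ := by
    intro b
    obtain ⟨c₀, c₁, c₂, hc, hcc⟩ := hcon a b
    refine ⟨c₀, c₁, c₂, hc, fun h2 => ?_⟩
    have e1 : π ∣ c₀ + c₁ * a := by
      have := dvd_sub hc ((hcast _ h2).mul_right b)
      simpa using this
    have e2 : π ∣ (c₁ : R) * (θ a - a) := by
      have := dvd_sub (hpush _ e1) e1
      convert this using 1
      simp only [map_add, map_mul, map_intCast]; ring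
    have e3 := int_dvd π hπ p hpr hp _ ((hπ.dvd_or_dvd e2).resolve_right ha)
    have e4 : π ∣ (c₀ : R) := by
      have := dvd_sub e1 ((hcast _ e3).mul_right a)
      simpa using this
    exact hcc (int_dvd π hπ p hpr hp _ e4) e3 h2
  have h2a : π ∣ θ (θ a) - a := by
    obtain ⟨c₀, c₁, c₂, hc, hc2⟩ := main (a * a)
    have e1 : π ∣ (θ a - a) * (c₂ * (θ a + a) + c₁) := by
      have := dvd_sub (hpush _ hc) hc
      convert this using 1
      simp only [map_add, map_mul, map_intCast]; ring
    have e2 := (hπ.dvd_or_dvd e1).resolve_left ha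
    apply hunit c₂ _ hc2
    have := dvd_sub (hpush _ e2) e2
    convert this using 1
    simp only [map_add, map_mul, map_intCast]; ring
  obtain ⟨b, hb⟩ := hθ 2 (by omega) (by omega)
  apply hb
  obtain ⟨c₀, c₁, c₂, hc, hc2⟩ := main b
  apply hunit c₂ _ hc2
  have := dvd_sub (dvd_sub (hpush _ (hpush _ hc)) hc) (h2a.mul_left (c₁ : R))
  convert this using 1
  simp only [map_add, map_mul, map_intCast, pow_two, RingHom.mul_def, RingHom.comp_apply]; ring

end Residue
end SlOne
namespace SlOne

section Core

variable {p : ℕ} [Fact (Nat.Prime p)] {D : Type} [Ring D] [Algebra ℤ_[p] D]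

theorem exists_functional (A B : Submodule ℤ_[p] D) (hAB : A < B)
    (hmax : ∀ A' : Submodule ℤ_[p] D, A < A' → A' ≤ B → A' = B) :
    ∃ φ : D → ZMod p, (∀ x ∈ B, ∀ y ∈ B, φ (x + y) = φ x + φ y) ∧
      ∀ x ∈ B, (φ x = 0 ↔ x ∈ A) := by
  classical
  let A₁ : Submodule ℤ_[p] B := A.comap B.subtype
  have hA₁ : IsCoatom A₁ := by
    constructor
    · intro h
      apply hAB.not_ge
      intro x hx
      have : (⟨x, hx⟩ : B) ∈ A₁ := by rw [h]; trivial
      exact this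
    · intro C hC
      have h1 : A < C.map B.subtype := by
        rw [SetLike.lt_iff_le_and_exists] at hC ⊢
        refine ⟨fun x hx => ⟨⟨x, hAB.le hx⟩, hC.1 hx, rfl⟩, ?_⟩
        obtain ⟨x, hx, hxA⟩ := hC.2
        exact ⟨x, ⟨x, hx, rfl⟩, hxA⟩
      have h2 := hmax _ h1 (Submodule.map_subtype_le _ _)
      rw [eq_top_iff]
      rintro ⟨x, hx⟩ -
      have : x ∈ C.map B.subtype := by rw [h2]; exact hx
      obtain ⟨y, hy, hyx⟩ := this
      have : y = ⟨x, hx⟩ := Subtype.ext hyx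
      rwa [← this]
  have hs : IsSimpleModule ℤ_[p] (B ⧸ A₁) := isSimpleModule_iff_isCoatom.2 hA₁
  obtain ⟨I, hI, ⟨eq⟩⟩ := isSimpleModule_iff_quot_maximal.1 hs
  have hI' : I = IsLocalRing.maximalIdeal ℤ_[p] := IsLocalRing.eq_maximalIdeal hI
  subst hI'
  let g : B →+ ZMod p := ((PadicInt.residueField (p := p)).toRingHom.toAddMonoidHom.comp
    eq.toLinearMap.toAddMonoidHom).comp (A₁.mkQ).toAddMonoidHom
  refine ⟨fun x => if hx : x ∈ B then g ⟨x, hx⟩ else 0, ?_, ?_⟩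
  · intro x hx y hy
    simp only [dif_pos hx, dif_pos hy, dif_pos (B.add_mem hx hy)]
    rw [← map_add]; rfl
  · intro x hx
    simp only [dif_pos hx]
    have : g ⟨x, hx⟩ = PadicInt.residueField (p := p) (eq (A₁.mkQ ⟨x, hx⟩)) := rfl
    rw [this]
    refine (EmbeddingLike.map_eq_zero_iff (f := PadicInt.residueField (p := p))).trans ?_
    refine (EmbeddingLike.map_eq_zero_iff (f := eq)).trans ?_
    rw [Submodule.mkQ_apply, Submodule.Quotient.mk_eq_zero]
    rfl

theorem lin_of_add (M : Submodule ℤ_[p] D) (ψ : D → ZMod p)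
    (hadd : ∀ x ∈ M, ∀ y ∈ M, ψ (x + y) = ψ x + ψ y) :
    ψ 0 = 0 ∧ ∀ (c : ℤ), ∀ x ∈ M, ψ (c • x) = c * ψ x := by
  let g : M →+ ZMod p := AddMonoidHom.mk' (fun x => ψ x) (fun x y => hadd x x.2 y y.2)
  constructor
  · exact g.map_zero
  · intro c x hx
    have := g.map_zsmul c ⟨x, hx⟩
    rw [zsmul_eq_mul] at this
    exact this

theorem span_bracket_fg (L : Submodule ℤ_[p] D) (hfg : L.FG) :
    (Submodule.span ℤ_[p] {z : D | ∃ x ∈ L, ∃ y ∈ L, z = x * y - y * x}).FG := by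
  have := Submodule.FG.map₂ (LinearMap.mul ℤ_[p] D - (LinearMap.mul ℤ_[p] D).flip) hfg hfg
  rw [Submodule.map₂_eq_span_image2] at this
  have e : {z : D | ∃ x ∈ L, ∃ y ∈ L, z = x * y - y * x} = Set.image2 (fun m n =>
      ((LinearMap.mul ℤ_[p] D - (LinearMap.mul ℤ_[p] D).flip) m) n) (L : Set D) (L : Set D) := by
    ext z
    constructor
    · rintro ⟨x, hx, y, hy, rfl⟩; exact ⟨x, hx, y, hy, by simp⟩
    · rintro ⟨x, hx, y, hy, rfl⟩; exact ⟨x, hx, y, hy, by simp⟩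
  rw [e]
  exact this

theorem exists_max (S M : Submodule ℤ_[p] D) (hM : M.FG) (hSM : S < M) :
    ∃ W : Submodule ℤ_[p] D, S ≤ W ∧ W < M ∧
      ∀ A' : Submodule ℤ_[p] D, W < A' → A' ≤ M → A' = M := by
  have : Module.Finite ℤ_[p] M := Module.Finite.iff_fg.2 hM
  have hne : S.comap M.subtype ≠ ⊤ := by
    intro h
    apply hSM.not_ge
    intro x hx
    have : (⟨x, hx⟩ : M) ∈ S.comap M.subtype := by rw [h]; trivial
    exact this
  obtain ⟨C, hC, hSC⟩ := (eq_top_or_exists_le_coatom (S.comap M.subtype)).resolve_left hne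
  refine ⟨C.map M.subtype, fun x hx => ⟨⟨x, hSM.le hx⟩, hSC hx, rfl⟩, ?_, ?_⟩
  · refine lt_of_le_of_ne (Submodule.map_subtype_le _ _) ?_
    intro h
    apply hC.1
    rw [eq_top_iff]
    rintro ⟨x, hx'⟩ -
    have hx := hx'
    rw [← h] at hx
    obtain ⟨y, hy, hyx⟩ := hx
    have : y = ⟨x, hx'⟩ := Subtype.ext hyx
    rw [← this]
    exact hy
  · intro A' hlt hle
    have : C < A'.comap M.subtype := by
      rw [SetLike.lt_iff_le_and_exists] at hlt ⊢
      refine ⟨fun x hx => hlt.1 ⟨x, hx, rfl⟩, ?_⟩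
      obtain ⟨x, hx, hxC⟩ := hlt.2
      exact ⟨⟨x, hle hx⟩, hx, fun h => hxC ⟨_, h, rfl⟩⟩
    have := hC.2 _ this
    refine le_antisymm hle ?_
    intro x hx
    have h2 : (⟨x, hx⟩ : M) ∈ A'.comap M.subtype := by rw [this]; trivial
    exact h2

/-- `c` is central and preserves `L`. -/
def Cen (L : Submodule ℤ_[p] D) (c : D) : Prop := (∀ x, c * x = x * c) ∧ ∀ x ∈ L, c * x ∈ L

theorem Cen.pow {L : Submodule ℤ_[p] D} {c : D} (h : Cen L c) (r : ℕ) : Cen L (c ^ r) := by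
  induction r with
  | zero => exact ⟨by simp, by simp⟩
  | succ r ih =>
    rw [pow_succ]
    refine ⟨fun x => by rw [mul_assoc, h.1, ← mul_assoc, ih.1, mul_assoc, ← h.1], fun x hx => ?_⟩
    rw [mul_assoc]; exact ih.2 _ (h.2 _ hx)

theorem Cen.bracket {L : Submodule ℤ_[p] D} {c : D} (h : Cen L c) (x y : D) :
    c * (x * y - y * x) = (c * x) * y - y * (c * x) := by
  rw [mul_sub, ← mul_assoc, ← mul_assoc, ← mul_assoc, h.1 y]

theorem Cen.bracket' {L : Submodule ℤ_[p] D} {c : D} (h : Cen L c) (x y : D) :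
    c * (x * y - y * x) = x * (c * y) - (c * y) * x := by
  rw [mul_sub, ← mul_assoc, ← mul_assoc, ← mul_assoc, h.1 x]

theorem Cen.mem {L : Submodule ℤ_[p] D} {c : D} (h : Cen L c) (u : D)
    (hu : u ∈ Submodule.span ℤ_[p] {z : D | ∃ x ∈ L, ∃ y ∈ L, z = x * y - y * x}) :
    c * u ∈ Submodule.span ℤ_[p] {z : D | ∃ x ∈ L, ∃ y ∈ L, z = x * y - y * x} := by
  induction hu using Submodule.span_induction with
  | mem z hz =>
    obtain ⟨x, hx, y, hy, rfl⟩ := hz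
    apply Submodule.subset_span
    exact ⟨c * x, h.2 _ hx, y, hy, h.bracket x y⟩
  | zero => simp
  | add a b _ _ ha hb => rw [mul_add]; exact Submodule.add_mem _ ha hb
  | smul a b _ hb => rw [mul_smul_comm]; exact Submodule.smul_mem _ _ hb

theorem core (L N M : Submodule ℤ_[p] D) (hNlt : N < L)
    (hNmax : ∀ N' : Submodule ℤ_[p] D, N < N' → N' ≤ L → N' = L) (hfg : L.FG)
    (hM : M = Submodule.span ℤ_[p] {z : D | ∃ x ∈ L, ∃ y ∈ L, z = x * y - y * x})
    (t w : D) (e : ℕ) (ht : Cen L t) (hw : Cen L w) (hte : t ^ e = w * p)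
    (hne : Submodule.span ℤ_[p] {z : D | ∃ x ∈ N, ∃ y ∈ N, z = x * y - y * x} ≠ M) :
    ∃ ψ : D → ZMod p, (∀ u ∈ M, ∀ v ∈ M, ψ (u + v) = ψ u + ψ v) ∧
      (∀ u ∈ M, ψ (t * u) = 0) ∧ (∃ x ∈ L, ∃ y ∈ L, ψ (x * y - y * x) ≠ 0) ∧
      ∀ x₁ ∈ L, ∀ x₂ ∈ L, ∀ x₃ ∈ L, ∃ c₁ c₂ c₃ : ℤ,
        ¬ ((p : ℤ) ∣ c₁ ∧ (p : ℤ) ∣ c₂ ∧ (p : ℤ) ∣ c₃) ∧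
        ∀ y ∈ L, ψ ((c₁ • x₁ + c₂ • x₂ + c₃ • x₃) * y - y * (c₁ • x₁ + c₂ • x₂ + c₃ • x₃)) = 0 := by
  have hMfg : M.FG := hM ▸ span_bracket_fg L hfg
  have hbr : ∀ x ∈ L, ∀ y ∈ L, x * y - y * x ∈ M := by
    intro x hx y hy
    rw [hM]
    exact Submodule.subset_span ⟨x, hx, y, hy, rfl⟩
  have hle : Submodule.span ℤ_[p] {z : D | ∃ x ∈ N, ∃ y ∈ N, z = x * y - y * x} ≤ M := by
    rw [Submodule.span_le]
    rintro z ⟨x, hx, y, hy, rfl⟩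
    exact hbr x (hNlt.le hx) y (hNlt.le hy)
  obtain ⟨W, hSW, hWM, hWmax⟩ := exists_max _ M hMfg (lt_of_le_of_ne hle hne)
  obtain ⟨φ, hφadd, hφ⟩ := exists_functional N L hNlt hNmax
  obtain ⟨ψ, hψadd, hψ⟩ := exists_functional W M hWM hWmax
  obtain ⟨hψ0, hψz⟩ := lin_of_add M ψ hψadd
  obtain ⟨hφ0, hφz⟩ := lin_of_add L φ hφadd
  have hMc : ∀ c, Cen L c → ∀ u ∈ M, c * u ∈ M := by
    intro c hc u hu
    rw [hM] at hu ⊢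
    exact hc.mem u hu
  -- the three-vector property for ψ
  have hthree : ∀ x₁ ∈ L, ∀ x₂ ∈ L, ∀ x₃ ∈ L, ∃ c₁ c₂ c₃ : ℤ,
        ¬ ((p : ℤ) ∣ c₁ ∧ (p : ℤ) ∣ c₂ ∧ (p : ℤ) ∣ c₃) ∧
        ∀ y ∈ L, ψ ((c₁ • x₁ + c₂ • x₂ + c₃ • x₃) * y - y * (c₁ • x₁ + c₂ • x₂ + c₃ • x₃)) = 0 := by
    intro x₁ h₁ x₂ h₂ x₃ h₃
    obtain ⟨x₀, hx₀, hx₀N⟩ := SetLike.exists_of_lt hNlt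
    let v : Fin 3 → (Fin 2 → ZMod p) := ![![φ x₁, ψ (x₁ * x₀ - x₀ * x₁)],
      ![φ x₂, ψ (x₂ * x₀ - x₀ * x₂)], ![φ x₃, ψ (x₃ * x₀ - x₀ * x₃)]]
    have hv : ¬ LinearIndependent (ZMod p) v := by
      intro h
      have := h.fintype_card_le_finrank
      simp at this
    rw [Fintype.not_linearIndependent_iff] at hv
    obtain ⟨g, hg, i, hi⟩ := hv
    have hlift : ∀ a : ZMod p, ∃ c : ℤ, (c : ZMod p) = a := ZMod.intCast_surjective
    choose c hc using fun i => hlift (g i)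
    have hg0 := congrFun hg 0
    have hg1 := congrFun hg 1
    simp [Fin.sum_univ_three, v] at hg0 hg1
    refine ⟨c 0, c 1, c 2, ?_, ?_⟩
    · rintro ⟨e0, e1, e2⟩
      rw [← ZMod.intCast_zmod_eq_zero_iff_dvd, hc] at e0 e1 e2
      apply hi
      fin_cases i
      · exact e0
      · exact e1
      · exact e2
    · have hxL : c 0 • x₁ + c 1 • x₂ + c 2 • x₃ ∈ L :=
        L.add_mem (L.add_mem (L.toAddSubgroup.zsmul_mem h₁ _) (L.toAddSubgroup.zsmul_mem h₂ _))
          (L.toAddSubgroup.zsmul_mem h₃ _)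
      have hzL : ∀ (k : ℤ) (x : D), x ∈ L → k • x ∈ L := fun k x hx => L.toAddSubgroup.zsmul_mem hx _
      have hzM : ∀ (k : ℤ) (x : D), x ∈ M → k • x ∈ M := fun k x hx => M.toAddSubgroup.zsmul_mem hx _
      have hxN : c 0 • x₁ + c 1 • x₂ + c 2 • x₃ ∈ N := by
        rw [← hφ _ hxL, hφadd _ (L.add_mem (hzL _ _ h₁) (hzL _ _ h₂)) _ (hzL _ _ h₃),
          hφadd _ (hzL _ _ h₁) _ (hzL _ _ h₂), hφz _ _ h₁, hφz _ _ h₂, hφz _ _ h₃, hc, hc, hc]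
        exact hg0
      have hx0 : ψ ((c 0 • x₁ + c 1 • x₂ + c 2 • x₃) * x₀ - x₀ * (c 0 • x₁ + c 1 • x₂ + c 2 • x₃)) = 0 := by
        have e1 : (c 0 • x₁ + c 1 • x₂ + c 2 • x₃) * x₀ - x₀ * (c 0 • x₁ + c 1 • x₂ + c 2 • x₃)
            = c 0 • (x₁ * x₀ - x₀ * x₁) + c 1 • (x₂ * x₀ - x₀ * x₂) + c 2 • (x₃ * x₀ - x₀ * x₃) := by
          simp only [add_mul, mul_add, smul_mul_assoc, mul_smul_comm, smul_sub]; abel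
        have b1 := hbr _ h₁ _ hx₀
        have b2 := hbr _ h₂ _ hx₀
        have b3 := hbr _ h₃ _ hx₀
        rw [e1, hψadd _ (M.add_mem (hzM _ _ b1) (hzM _ _ b2)) _ (hzM _ _ b3),
          hψadd _ (hzM _ _ b1) _ (hzM _ _ b2), hψz _ _ b1, hψz _ _ b2, hψz _ _ b3, hc, hc, hc]
        exact hg1
      intro y hy
      generalize c 0 • x₁ + c 1 • x₂ + c 2 • x₃ = x at *
      have hφ0' : φ x₀ ≠ 0 := fun h => hx₀N ((hφ _ hx₀).1 h)
      obtain ⟨k, hk⟩ := hlift (φ y / φ x₀)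
      have hyN : y + (-k) • x₀ ∈ N := by
        rw [← hφ _ (L.add_mem hy (hzL _ _ hx₀)), hφadd _ hy _ (hzL _ _ hx₀), hφz _ _ hx₀]
        push_cast
        rw [hk]
        field_simp
        ring
      have e2 : x * y - y * x = (x * (y + (-k) • x₀) - (y + (-k) • x₀) * x) + k • (x * x₀ - x₀ * x) := by
        simp only [add_mul, mul_add, smul_mul_assoc, mul_smul_comm, smul_sub, neg_smul, neg_mul, mul_neg]; abel
      have e3 : ψ (x * (y + (-k) • x₀) - (y + (-k) • x₀) * x) = 0 := by
        rw [hψ _ (hbr _ hxL _ (hNlt.le hyN))]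
        apply hSW
        exact Submodule.subset_span ⟨_, hxN, _, hyN, rfl⟩
      rw [e2, hψadd _ (hbr _ hxL _ (hNlt.le hyN)) _ (hzM _ _ (hbr _ hxL _ hx₀)), e3,
        hψz _ _ (hbr _ hxL _ hx₀), hx0]
      simp
  -- minimal r
  have hex : ∃ r : ℕ, ∀ u ∈ M, ψ (t ^ r * u) = 0 := by
    refine ⟨e, fun u hu => ?_⟩
    have : t ^ e * u = (p : ℤ) • (w * u) := by
      rw [hte, zsmul_eq_mul]
      push_cast
      rw [← mul_assoc, (Nat.cast_commute p w).eq]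
    rw [this, hψz _ _ (hMc _ hw _ hu)]
    simp
  classical
  obtain ⟨r, hr⟩ : ∃ r, Nat.find hex = r + 1 := by
    apply Nat.exists_eq_succ_of_ne_zero
    intro h0
    have h1 := Nat.find_spec hex
    rw [h0] at h1
    apply hWM.not_ge
    intro u hu
    rw [← hψ u hu]
    simpa using h1 u hu
  have hr1 := Nat.find_spec hex
  have hr2 := Nat.find_min hex (m := r) (by omega)
  rw [hr] at hr1
  have htr := ht.pow r
  refine ⟨fun u => ψ (t ^ r * u), ?_, ?_, ?_, ?_⟩
  · intro u hu v hv
    simp only [mul_add]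
    exact hψadd _ (hMc _ htr _ hu) _ (hMc _ htr _ hv)
  · intro u hu
    simp only [← mul_assoc, ← pow_succ]
    exact hr1 u hu
  · by_contra hcon
    push Not at hcon
    apply hr2
    intro u hu
    rw [hψ _ (hMc _ htr _ hu)]
    rw [hM] at hu
    induction hu using Submodule.span_induction with
    | mem z hz =>
      obtain ⟨x, hx, y, hy, rfl⟩ := hz
      rw [← hψ _ (hMc _ htr _ (hbr _ hx _ hy))]
      exact hcon x hx y hy
    | zero => simp
    | add a b _ _ ha hb => rw [mul_add]; exact Submodule.add_mem _ ha hb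
    | smul a b _ hb => rw [mul_smul_comm]; exact Submodule.smul_mem _ _ hb
  · intro x₁ h₁ x₂ h₂ x₃ h₃
    obtain ⟨c₁, c₂, c₃, hc, h⟩ := hthree x₁ h₁ x₂ h₂ x₃ h₃
    refine ⟨c₁, c₂, c₃, hc, fun y hy => ?_⟩
    simp only [htr.bracket']
    exact h _ (htr.2 _ hy)

end Core
end SlOne
namespace SlOne

section Inertia

variable {p : ℕ} [Fact (Nat.Prime p)] {E : Type} [Field E] [Algebra ℚ_[p] E]
  [FiniteDimensional ℚ_[p] E] [Algebra ℤ_[p] E] [IsScalarTower ℤ_[p] ℚ_[p] E]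

theorem prime_pi (π : integralClosure ℤ_[p] E) (hπ : Irreducible π) : Prime π := by
  refine ⟨hπ.ne_zero, hπ.not_isUnit, ?_⟩
  intro a b hab
  by_contra hcon
  push Not at hcon
  have ha := (unit_or_dvd π a hπ).resolve_right hcon.1
  have hb := (unit_or_dvd π b hπ).resolve_right hcon.2
  exact hπ.not_isUnit (isUnit_of_dvd_unit hab (ha.mul hb))

theorem p_dvd (π : integralClosure ℤ_[p] E) (hπ : Irreducible π) :
    π ∣ (p : integralClosure ℤ_[p] E) := (unit_or_dvd π _ hπ).resolve_left p_not_unit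

theorem exists_u (e f : ℕ) (π : integralClosure ℤ_[p] E) (hπ : Irreducible π)
    (he : ∃ u : (integralClosure ℤ_[p] E)ˣ, (p : integralClosure ℤ_[p] E) = ↑u * π ^ e)
    (hef : Module.finrank ℚ_[p] E = e * f) (hf : 2 ≤ f) :
    ∃ u : integralClosure ℤ_[p] E, ∀ c₁ c₂ : ℤ,
      π ∣ c₁ + c₂ * u → (p : ℤ) ∣ c₁ ∧ (p : ℤ) ∣ c₂ := by
  have hpr : p.Prime := Fact.out
  have hpd := p_dvd π hπ
  by_contra hcon
  push Not at hcon
  have hcast : ∀ c : ℤ, (p : ℤ) ∣ c → π ∣ (c : integralClosure ℤ_[p] E) := by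
    intro c hc
    obtain ⟨k, rfl⟩ := hc
    push_cast
    exact hpd.mul_right _
  have hres : ∀ u, ∃ a : ℤ, π ∣ u - a := by
    intro u
    obtain ⟨c₁, c₂, h, hc⟩ := hcon u
    have hc2 : ¬ (p : ℤ) ∣ c₂ := by
      intro h2
      refine hc (int_dvd π (prime_pi π hπ) p hpr hpd _ ?_) h2
      have := dvd_sub h ((hcast _ h2).mul_right u)
      simpa using this
    have hco : IsCoprime (p : ℤ) c₂ := ((Nat.prime_iff_prime_int.1 hpr).coprime_iff_not_dvd).2 hc2
    obtain ⟨l, k, hk⟩ := hco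
    refine ⟨-(k * c₁), ?_⟩
    have h1 : (1 : integralClosure ℤ_[p] E) = l * p + k * c₂ := by
      exact_mod_cast congrArg (Int.cast : ℤ → integralClosure ℤ_[p] E) hk.symm
    have : u - ((-(k * c₁) : ℤ) : integralClosure ℤ_[p] E) = k * (c₁ + c₂ * u) + p * (l * u) := by
      push_cast
      linear_combination u * h1
    rw [this]
    exact dvd_add (h.mul_left _) (hpd.mul_right _)
  have hfin : Module.Finite ℤ_[p] (integralClosure ℤ_[p] E) := finite_int
  have happ : ∀ s : ℕ, ∀ u : integralClosure ℤ_[p] E, ∃ v ∈ Submodule.span ℤ_[p]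
      (Set.range (fun i : Fin s => π ^ (i : ℕ))), π ^ s ∣ u - v := by
    intro s
    induction s with
    | zero => intro u; exact ⟨0, Submodule.zero_mem _, by simp⟩
    | succ s ih =>
      intro u
      obtain ⟨v, hv, w, hw⟩ := ih u
      obtain ⟨a, b, hab⟩ := hres w
      refine ⟨v + (a : ℤ_[p]) • π ^ s, ?_, b, ?_⟩
      · refine Submodule.add_mem _ (Submodule.span_mono ?_ hv) ?_
        · rintro _ ⟨i, rfl⟩
          exact ⟨i.castSucc, rfl⟩
        · apply Submodule.smul_mem
          apply Submodule.subset_span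
          exact ⟨Fin.last s, rfl⟩
      · have : ((a : ℤ_[p]) • π ^ s) = (a : integralClosure ℤ_[p] E) * π ^ s := by
          rw [Algebra.smul_def, map_intCast]
        rw [this]
        linear_combination hw + π ^ s * hab
  obtain ⟨u₀, hu₀⟩ := he
  have htop : (⊤ : Submodule ℤ_[p] (integralClosure ℤ_[p] E)) ≤ Submodule.span ℤ_[p]
      (Set.range (fun i : Fin e => π ^ (i : ℕ))) := by
    apply Submodule.le_of_le_smul_of_le_jacobson_bot (I := Ideal.span {(p : ℤ_[p])}) hfin.1
    · rw [← PadicInt.maximalIdeal_eq_span_p, IsLocalRing.jacobson_eq_maximalIdeal _ bot_ne_top]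
    · intro u _
      obtain ⟨v, hv, w, hw⟩ := happ e u
      have : u = v + (p : ℤ_[p]) • (((u₀⁻¹ : (integralClosure ℤ_[p] E)ˣ) : integralClosure ℤ_[p] E) * w) := by
        rw [Algebra.smul_def, map_natCast, hu₀]
        have h1 := u₀.mul_inv
        linear_combination hw - π ^ e * w * h1
      rw [this]
      apply Submodule.add_mem_sup hv
      exact Submodule.smul_mem_smul (Ideal.mem_span_singleton_self _) trivial
  have : Module.IsTorsionFree ℤ_[p] E := .trans_faithfulSMul ℤ_[p] ℚ_[p] E
  have hrank := IsIntegralClosure.rank ℤ_[p] ℚ_[p] E (integralClosure ℤ_[p] E)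
  have h2 := finrank_range_le_card (R := ℤ_[p]) (fun i : Fin e => π ^ (i : ℕ))
  rw [Set.finrank, top_le_iff.1 htop, finrank_top, hrank, hef, Fintype.card_fin] at h2
  have hpos : 0 < Module.finrank ℚ_[p] E := Module.finrank_pos
  rw [hef] at hpos
  have := Nat.pos_of_mul_pos_right hpos
  nlinarith [Nat.pos_of_ne_zero (fun h : e = 0 => by simp [h] at hpos)]

end Inertia
end SlOne
namespace SlOne

section Big

variable {p : ℕ} [Fact (Nat.Prime p)] {D : Type} [Ring D] [Algebra ℤ_[p] D]
  {R : Type} [CommRing R] [IsDomain R]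

/-- The homogeneous element `ι a * ϖ ^ j`. -/
def hom (ι : R →+* D) (ϖ : D) (j : ℕ) (a : R) : D := ι a * ϖ ^ j

theorem big (ι : R →+* D) (ϖ : D) (θ : R →+* R) (hcomm : ∀ a, ϖ * ι a = ι (θ a) * ϖ)
    (n : ℕ) (hn : 3 ≤ n) (π : R) (hπ : Prime π) (hϖ : ϖ ^ n = ι π) (hpπ : π ∣ (p : R))
    (hdich : ∀ x : R, IsUnit x ∨ π ∣ x)
    (hrefl : ∀ x, π ∣ θ x → π ∣ x) (hθπ : θ π = π)
    (hθ : ∀ m, 1 ≤ m → m < n → ∃ a, ¬ π ∣ (θ ^ m) a - a) (hθn : ∀ a, (θ ^ n) a = a)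
    (hp3 : ¬ (p = 3 ∧ n = 3))
    (L M : Submodule ℤ_[p] D)
    (hL1 : ∀ j, 1 ≤ j → j < n → ∀ a, hom ι ϖ j a ∈ L)
    (hL0 : ∀ b, hom ι ϖ 0 (b - θ b) ∈ L)
    (hLgen : ∀ x ∈ L, ∃ a : ℕ → R, x = ∑ j ∈ Finset.range n, hom ι ϖ j (a j) ∧ hom ι ϖ 0 (a 0) ∈ L)
    (hbr : ∀ x ∈ L, ∀ y ∈ L, x * y - y * x ∈ M)
    (ψ : D → ZMod p) (hadd : ∀ u ∈ M, ∀ v ∈ M, ψ (u + v) = ψ u + ψ v)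
    (hψπ : ∀ u ∈ M, ψ (ι π * u) = 0) (hne : ∃ x ∈ L, ∃ y ∈ L, ψ (x * y - y * x) ≠ 0)
    (hthree : ∀ x₁ ∈ L, ∀ x₂ ∈ L, ∀ x₃ ∈ L, ∃ c₁ c₂ c₃ : ℤ,
        ¬ ((p : ℤ) ∣ c₁ ∧ (p : ℤ) ∣ c₂ ∧ (p : ℤ) ∣ c₃) ∧
        ∀ y ∈ L, ψ ((c₁ • x₁ + c₂ • x₂ + c₃ • x₃) * y - y * (c₁ • x₁ + c₂ • x₂ + c₃ • x₃)) = 0) :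
    False := by
  have hpr : p.Prime := Fact.out
  obtain ⟨hψ0, hψz⟩ := lin_of_add M ψ hadd
  have hzM : ∀ (k : ℤ) (x : D), x ∈ M → k • x ∈ M := fun k x hx => M.toAddSubgroup.zsmul_mem hx _
  -- commutation rules
  have hcommp : ∀ j a, ϖ ^ j * ι a = ι ((θ ^ j) a) * ϖ ^ j := by
    intro j
    induction j with
    | zero => intro a; simp
    | succ j ih =>
      intro a
      rw [pow_succ, mul_assoc, hcomm, ← mul_assoc, ih, mul_assoc, ← pow_succ, pow_succ θ,
        RingHom.mul_def, RingHom.comp_apply]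
  have hmul : ∀ j k a b, hom ι ϖ j a * hom ι ϖ k b = hom ι ϖ (j + k) (a * (θ ^ j) b) := by
    intro j k a b
    unfold hom
    rw [mul_assoc, ← mul_assoc (ϖ ^ j), hcommp, map_mul, pow_add]
    simp only [mul_assoc]
  have hhadd : ∀ j a b, hom ι ϖ j (a + b) = hom ι ϖ j a + hom ι ϖ j b := by
    intro j a b; unfold hom; rw [map_add, add_mul]
  have hhsub : ∀ j a b, hom ι ϖ j (a - b) = hom ι ϖ j a - hom ι ϖ j b := by
    intro j a b; unfold hom; rw [map_sub, sub_mul]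
  have hhz : ∀ j (c : ℤ) a, hom ι ϖ j (c * a) = c • hom ι ϖ j a := by
    intro j c a; unfold hom; rw [map_mul, map_intCast, zsmul_eq_mul, mul_assoc]
  have hbrk : ∀ j k a b, hom ι ϖ j a * hom ι ϖ k b - hom ι ϖ k b * hom ι ϖ j a
      = hom ι ϖ (j + k) (a * (θ ^ j) b - b * (θ ^ k) a) := by
    intro j k a b
    rw [hmul, hmul, hhsub, add_comm k j]
  have hshift : ∀ j a, hom ι ϖ (n + j) a = ι π * hom ι ϖ j a := by
    intro j a
    unfold hom
    rw [pow_add, hϖ, ← mul_assoc, ← map_mul, mul_comm a, map_mul, mul_assoc]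
  have hθadd : ∀ i j a, (θ ^ i) ((θ ^ j) a) = (θ ^ (i + j)) a := by
    intro i j a
    rw [pow_add, RingHom.mul_def, RingHom.comp_apply]
  -- degree m ≥ 1 part of M
  have hEM : ∀ m, 1 ≤ m → m < n → ∀ γ, hom ι ϖ m γ ∈ M := by
    intro m h1 h2 γ
    obtain ⟨b, hb⟩ := exists_r1 π hπ θ hrefl n hθ hθn hn m h1 h2
    obtain ⟨δ, hδ⟩ := (hdich _).resolve_right hb
    have := hbr _ (hL0 b) _ (hL1 m h1 h2 (((δ⁻¹ : Rˣ) : R) * γ))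
    rw [hbrk, zero_add] at this
    convert this using 2
    simp only [pow_zero, RingHom.one_def, RingHom.id_apply]
    have h3 := δ.mul_inv
    linear_combination -γ * h3 + (((δ⁻¹ : Rˣ) : R) * γ) * hδ
  have hhigh : ∀ j k, j < n → k < n → n < j + k → ∀ a b,
      ψ (hom ι ϖ j a * hom ι ϖ k b - hom ι ϖ k b * hom ι ϖ j a) = 0 := by
    intro j k hj hk hjk a b
    rw [hbrk]
    obtain ⟨i, hi⟩ := Nat.exists_eq_add_of_lt hjk
    rw [hi, add_assoc, hshift]
    exact hψπ _ (hEM _ (by omega) (by omega) _)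
  have hexp : ∀ x₁ ∈ L, ∀ x₂ ∈ L, ∀ x₃ ∈ L, ∀ y ∈ L, ∀ c₁ c₂ c₃ : ℤ,
      ψ ((c₁ • x₁ + c₂ • x₂ + c₃ • x₃) * y - y * (c₁ • x₁ + c₂ • x₂ + c₃ • x₃)) =
      c₁ * ψ (x₁ * y - y * x₁) + c₂ * ψ (x₂ * y - y * x₂) + c₃ * ψ (x₃ * y - y * x₃) := by
    intro x₁ h₁ x₂ h₂ x₃ h₃ y hy c₁ c₂ c₃
    have e1 : (c₁ • x₁ + c₂ • x₂ + c₃ • x₃) * y - y * (c₁ • x₁ + c₂ • x₂ + c₃ • x₃)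
        = c₁ • (x₁ * y - y * x₁) + c₂ • (x₂ * y - y * x₂) + c₃ • (x₃ * y - y * x₃) := by
      simp only [add_mul, mul_add, smul_mul_assoc, mul_smul_comm, smul_sub]; abel
    have b1 := hbr _ h₁ _ hy
    have b2 := hbr _ h₂ _ hy
    have b3 := hbr _ h₃ _ hy
    rw [e1, hadd _ (M.add_mem (hzM _ _ b1) (hzM _ _ b2)) _ (hzM _ _ b3),
      hadd _ (hzM _ _ b1) _ (hzM _ _ b2), hψz _ _ b1, hψz _ _ b2, hψz _ _ b3]
  have hskew : ∀ x ∈ L, ∀ y ∈ L, ψ (y * x - x * y) = - ψ (x * y - y * x) := by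
    intro x hx y hy
    have := hψz (-1) _ (hbr _ hx _ hy)
    rw [neg_one_zsmul, neg_sub] at this
    rw [this]; simp
  have hzero : ∀ (c : ℤ) (z : ZMod p), z ≠ 0 → (c : ZMod p) * z = 0 → (p : ℤ) ∣ c := by
    intro c z hz h
    rw [← ZMod.intCast_zmod_eq_zero_iff_dvd]
    exact (mul_eq_zero.1 h).resolve_right hz
  have hdvd : ∀ c : ℤ, (p : ℤ) ∣ c → (c : ZMod p) = 0 := by
    intro c h; rwa [ZMod.intCast_zmod_eq_zero_iff_dvd]
  by_cases hA : ∃ j, 1 ≤ j ∧ j < n ∧ ∃ γ, ψ (hom ι ϖ j γ * hom ι ϖ (n - j) 1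
      - hom ι ϖ (n - j) 1 * hom ι ϖ j γ) ≠ 0
  · obtain ⟨j, hj1, hjn, γ, hγ⟩ := hA
    obtain ⟨a, b, hab⟩ := exists_r3 π hπ θ hθπ n hθ hn p hpr hpπ
    obtain ⟨c₁, c₂, c₃, hc, hrad⟩ := hthree _ (hL1 j hj1 hjn 1) _ (hL1 j hj1 hjn a) _
      (hL1 j hj1 hjn b)
    have hcomb : c₁ • hom ι ϖ j 1 + c₂ • hom ι ϖ j a + c₃ • hom ι ϖ j b
        = hom ι ϖ j (c₁ + c₂ * a + c₃ * b) := by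
      rw [hhadd, hhadd, hhz, hhz, ← hhz, mul_one]
    rw [hcomb] at hrad
    obtain ⟨α, hα⟩ := (hdich (c₁ + c₂ * a + c₃ * b)).resolve_right (fun h => hc (hab _ _ _ h))
    rw [← hα] at hrad
    apply hγ
    rw [← hrad _ (hL1 (n - j) (by omega) (by omega) ((θ ^ (n - j)) (((α⁻¹ : Rˣ) : R) * γ)))]
    rw [hbrk, hbrk]
    congr 2
    rw [hθadd, Nat.add_sub_cancel' hjn.le, hθn, one_mul, map_one, mul_one, ← mul_assoc,
      α.mul_inv, one_mul, ← map_mul]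
    congr 2
    rw [mul_comm, ← mul_assoc, α.mul_inv, one_mul]
  push Not at hA
  have hmid : ∀ j k, j < n → k < n → j + k = n → ∀ a b,
      ψ (hom ι ϖ j a * hom ι ϖ k b - hom ι ϖ k b * hom ι ϖ j a) = 0 := by
    intro j k hj hk hjk a b
    rw [← hA j (by omega) hj (a * (θ ^ j) b)]
    have hk' : k = n - j := by omega
    rw [← hk', hbrk, hbrk]
    congr 2
    rw [map_one, mul_one, one_mul, map_mul, hθadd, add_comm k j, hjk, hθn, mul_comm b]
  have hB : ∃ m, (1 ≤ m ∧ m < n) ∧ ∃ γ, ψ (hom ι ϖ m γ) ≠ 0 := by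
    by_contra hcon
    push Not at hcon
    obtain ⟨x, hx, y, hy, hxy⟩ := hne
    apply hxy
    let Z : AddSubgroup D :=
      { carrier := {u | u ∈ M ∧ ψ u = 0}
        zero_mem' := ⟨M.zero_mem, hψ0⟩
        add_mem' := by
          rintro u v ⟨hu, hu'⟩ ⟨hv, hv'⟩
          exact ⟨M.add_mem hu hv, by rw [hadd _ hu _ hv, hu', hv', add_zero]⟩
        neg_mem' := by
          rintro u ⟨hu, hu'⟩
          refine ⟨M.neg_mem hu, ?_⟩
          have := hψz (-1) u hu
          rw [neg_one_zsmul, hu', mul_zero] at this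
          exact this }
    suffices x * y - y * x ∈ Z from this.2
    obtain ⟨a, ha, ha0⟩ := hLgen x hx
    obtain ⟨b, hb, hb0⟩ := hLgen y hy
    have hmemL : ∀ (a : ℕ → R), hom ι ϖ 0 (a 0) ∈ L → ∀ j, j < n → hom ι ϖ j (a j) ∈ L := by
      intro a h0 j hj
      rcases Nat.eq_zero_or_pos j with rfl | hj0
      · exact h0
      · exact hL1 j hj0 hj _
    have : x * y - y * x = ∑ j ∈ Finset.range n, ∑ k ∈ Finset.range n,
        (hom ι ϖ j (a j) * hom ι ϖ k (b k) - hom ι ϖ k (b k) * hom ι ϖ j (a j)) := by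
      rw [ha, hb, Finset.sum_mul_sum, Finset.sum_mul_sum]
      rw [Finset.sum_comm (f := fun i j => hom ι ϖ i (b i) * hom ι ϖ j (a j))]
      rw [← Finset.sum_sub_distrib]
      refine Finset.sum_congr rfl fun j _ => ?_
      rw [← Finset.sum_sub_distrib]
    rw [this]
    refine sum_mem fun j hj => sum_mem fun k hk => ?_
    rw [Finset.mem_range] at hj hk
    refine ⟨hbr _ (hmemL a ha0 j hj) _ (hmemL b hb0 k hk), ?_⟩
    rcases lt_trichotomy (j + k) n with h | h | h
    · rcases Nat.eq_zero_or_pos (j + k) with h0 | h0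
      · have hj0 : j = 0 := by omega
        have hk0 : k = 0 := by omega
        subst hj0; subst hk0
        rw [hbrk]
        simp only [pow_zero, RingHom.one_def, RingHom.id_apply]
        rw [mul_comm, sub_self]
        simpa [hom] using hψ0
      · rw [hbrk]
        exact hcon _ ⟨h0, h⟩ _
    · exact hmid j k hj hk h _ _
    · exact hhigh j k hj hk h _ _
  -- the largest such m
  obtain ⟨m, ⟨hm1, hmn⟩, ⟨γ₀, hγ₀⟩, hmax⟩ : ∃ m, (1 ≤ m ∧ m < n) ∧ (∃ γ, ψ (hom ι ϖ m γ) ≠ 0) ∧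
      ∀ m', m < m' → m' < n → ∀ γ, ψ (hom ι ϖ m' γ) = 0 := by
    classical
    obtain ⟨m₀, hm₀, hm₀'⟩ := hB
    let P : ℕ → Prop := fun m => (1 ≤ m ∧ m < n) ∧ ∃ γ, ψ (hom ι ϖ m γ) ≠ 0
    have hs := Nat.findGreatest_spec (P := P) (n := n) hm₀.2.le ⟨hm₀, hm₀'⟩
    refine ⟨Nat.findGreatest P n, hs.1, hs.2, ?_⟩
    intro m' h1 h2 γ
    have := Nat.findGreatest_is_greatest h1 h2.le
    by_contra hcon
    exact this ⟨⟨by omega, h2⟩, γ, hcon⟩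
  have hvan : ∀ j k, j < n → k < n → m < j + k → ∀ a b,
      ψ (hom ι ϖ j a * hom ι ϖ k b - hom ι ϖ k b * hom ι ϖ j a) = 0 := by
    intro j k hj hk hjk a b
    rcases lt_trichotomy (j + k) n with h | h | h
    · rw [hbrk]; exact hmax _ hjk h _
    · exact hmid j k hj hk h _ _
    · exact hhigh j k hj hk h _ _
  obtain ⟨b, hb⟩ := exists_r1 π hπ θ hrefl n hθ hθn hn m hm1 hmn
  obtain ⟨δ, hδ⟩ := (hdich _).resolve_right hb
  set ym : D := hom ι ϖ m (((δ⁻¹ : Rˣ) : R) * γ₀) with hym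
  set x0 : D := hom ι ϖ 0 (b - θ b) with hx0
  have hymL : ym ∈ L := hL1 m hm1 hmn _
  have hx0L : x0 ∈ L := hL0 b
  have hpair : ψ (x0 * ym - ym * x0) ≠ 0 := by
    rw [hx0, hym, hbrk, zero_add]
    convert hγ₀ using 3
    simp only [pow_zero, RingHom.one_def, RingHom.id_apply]
    have h3 := δ.mul_inv
    linear_combination γ₀ * h3 - (((δ⁻¹ : Rˣ) : R) * γ₀) * hδ
  have hpair' : ψ (ym * x0 - x0 * ym) ≠ 0 := by
    rw [hskew _ hx0L _ hymL]; exact neg_ne_zero.2 hpair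
  have hself : ψ (ym * ym - ym * ym) = 0 := by rw [sub_self, hψ0]
  by_cases hm2 : 2 ≤ m
  · -- a nonzero pairing in degrees (1, m-1)
    obtain ⟨α, β, hαβ⟩ : ∃ α β, ψ (hom ι ϖ 1 α * hom ι ϖ (m - 1) β
        - hom ι ϖ (m - 1) β * hom ι ϖ 1 α) ≠ 0 := by
      by_contra hcon
      push Not at hcon
      simp only [hbrk, Nat.add_sub_cancel' hm1, pow_one] at hcon
      have hsubψ : ∀ u v, ψ (hom ι ϖ m (u - v)) = 0 → ψ (hom ι ϖ m u) = ψ (hom ι ϖ m v) := by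
        intro u v h
        have := hadd _ (hEM m hm1 hmn (u - v)) _ (hEM m hm1 hmn v)
        rw [← hhadd, sub_add_cancel, h, zero_add] at this
        exact this
      have hinv : ∀ β, ψ (hom ι ϖ m (θ β)) = ψ (hom ι ϖ m β) := by
        intro β
        apply hsubψ
        have := hcon 1 β
        rwa [map_one, one_mul, mul_one] at this
      obtain ⟨a', ha'⟩ := hθ m hm1 hmn
      obtain ⟨ε, hε⟩ := (hdich _).resolve_right ha'
      have hθθ : θ ((θ ^ (n - 1)) (θ a')) = θ a' := by
        have h1 : (θ ^ (n - 1)) (θ a') = a' := by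
          have := hθadd (n - 1) 1 a'
          rw [pow_one, Nat.sub_add_cancel (by omega), hθn] at this
          exact this
        rw [h1]
      have hm' : (θ ^ (m - 1)) (θ a') = (θ ^ m) a' := by
        have := hθadd (m - 1) 1 a'
        rwa [pow_one, Nat.sub_add_cancel hm1] at this
      have hfin : ∀ β, ψ (hom ι ϖ m (β * (θ ^ m) a')) = ψ (hom ι ϖ m (β * a')) := by
        intro β
        have h1 := hsubψ _ _ (hcon (θ a') β)
        rw [hm', ← map_mul, hinv, mul_comm a'] at h1
        exact h1.symm
      apply hγ₀
      have h2 := hadd _ (hEM m hm1 hmn γ₀) _ (hEM m hm1 hmn ((((ε⁻¹ : Rˣ) : R) * γ₀) * a'))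
      rw [← hhadd] at h2
      have h3 : γ₀ + (((ε⁻¹ : Rˣ) : R) * γ₀) * a' = (((ε⁻¹ : Rˣ) : R) * γ₀) * (θ ^ m) a' := by
        have h4 := ε.mul_inv
        linear_combination -γ₀ * h4 + (((ε⁻¹ : Rˣ) : R) * γ₀) * hε
      rw [h3, hfin] at h2
      simpa using h2
    have hy1L := hL1 1 le_rfl (by omega) α
    have hyL := hL1 (m - 1) (by omega) (by omega) β
    obtain ⟨c₁, c₂, c₃, hc, hrad⟩ := hthree x0 hx0L _ hy1L ym hymL
    apply hc
    have r1 := hrad ym hymL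
    have r2 := hrad _ hyL
    have r3 := hrad x0 hx0L
    rw [hexp _ hx0L _ hy1L _ hymL _ hymL, hself, hym, hvan 1 m (by omega) hmn (by omega), ← hym,
      mul_zero, mul_zero, add_zero, add_zero] at r1
    have d1 := hzero _ _ hpair r1
    rw [hexp _ hx0L _ hy1L _ hymL _ hyL, hdvd _ d1, hym,
      hvan m (m - 1) hmn (by omega) (by omega), mul_zero, zero_mul, zero_add, add_zero] at r2
    have d2 := hzero _ _ hαβ r2
    rw [hexp _ hx0L _ hy1L _ hymL _ hx0L, hdvd _ d1, hdvd _ d2, zero_mul, zero_mul, zero_add,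
      zero_add] at r3
    exact ⟨d1, d2, hzero _ _ hpair' r3⟩
  · have hm1' : m = 1 := by omega
    subst hm1'
    obtain ⟨b₁, b₂, hbb⟩ := exists_r2 π hπ θ hrefl hθπ n hθ hθn hn p hpr hpπ hp3
    obtain ⟨c₁, c₂, c₃, hc, hrad⟩ := hthree _ (hL0 b₁) _ (hL0 b₂) ym hymL
    have d12 : (p : ℤ) ∣ c₁ ∧ (p : ℤ) ∣ c₂ := by
      by_contra hcon
      obtain ⟨ε, hε⟩ := (hdich _).resolve_right (fun h => hcon (hbb c₁ c₂ h))
      have hyL := hL1 1 le_rfl hmn (((ε⁻¹ : Rˣ) : R) * γ₀)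
      have r := hrad _ hyL
      rw [hexp _ (hL0 b₁) _ (hL0 b₂) _ hymL _ hyL, hym, hvan 1 1 hmn hmn (by omega), mul_zero,
        add_zero, hbrk, hbrk, zero_add] at r
      apply hγ₀
      rw [← hψz _ _ (hEM 1 le_rfl hmn _), ← hψz _ _ (hEM 1 le_rfl hmn _), ← hhz, ← hhz,
        ← hadd _ (hEM 1 le_rfl hmn _) _ (hEM 1 le_rfl hmn _), ← hhadd] at r
      rw [← r]
      congr 2
      simp only [pow_zero, pow_one, RingHom.one_def, RingHom.id_apply]
      have h4 := ε.mul_inv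
      linear_combination -γ₀ * h4 + (((ε⁻¹ : Rˣ) : R) * γ₀) * hε
    apply hc
    refine ⟨d12.1, d12.2, ?_⟩
    have r3 := hrad x0 hx0L
    rw [hexp _ (hL0 b₁) _ (hL0 b₂) _ hymL _ hx0L, hdvd _ d12.1, hdvd _ d12.2, zero_mul, zero_mul,
      zero_add, zero_add] at r3
    exact hzero _ _ hpair' r3

end Big
end SlOne
namespace SlOne

section Small

variable {p : ℕ} [Fact (Nat.Prime p)] {D : Type} [Ring D] [Algebra ℤ_[p] D]

theorem small (L M : Submodule ℤ_[p] D) (hbr : ∀ x ∈ L, ∀ y ∈ L, x * y - y * x ∈ M)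
    (ψ : D → ZMod p) (hadd : ∀ u ∈ M, ∀ v ∈ M, ψ (u + v) = ψ u + ψ v)
    (hne : ∃ x ∈ L, ∃ y ∈ L, ψ (x * y - y * x) ≠ 0)
    (hthree : ∀ x₁ ∈ L, ∀ x₂ ∈ L, ∀ x₃ ∈ L, ∃ c₁ c₂ c₃ : ℤ,
        ¬ ((p : ℤ) ∣ c₁ ∧ (p : ℤ) ∣ c₂ ∧ (p : ℤ) ∣ c₃) ∧
        ∀ y ∈ L, ψ ((c₁ • x₁ + c₂ • x₂ + c₃ • x₃) * y - y * (c₁ • x₁ + c₂ • x₂ + c₃ • x₃)) = 0)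
    (U : D) (hU : Cen L U)
    (hinv : ∀ c₁ c₂ : ℤ, ¬ ((p : ℤ) ∣ c₁ ∧ (p : ℤ) ∣ c₂) →
      ∃ v : D, Cen L v ∧ ((c₁ : D) + c₂ * U) * v = 1) : False := by
  obtain ⟨x, hx, y, hy, hxy⟩ := hne
  obtain ⟨hψ0, hψz⟩ := lin_of_add M ψ hadd
  obtain ⟨c₁, c₂, c₃, hc, h⟩ := hthree x hx (U * x) (hU.2 _ hx) y hy
  have hUx : U * x * x = x * (U * x) := by rw [hU.1 x, mul_assoc]; rw [hU.1 x]
  have h3 : (p : ℤ) ∣ c₃ := by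
    have h1 := h x hx
    have e : (c₁ • x + c₂ • (U * x) + c₃ • y) * x - x * (c₁ • x + c₂ • (U * x) + c₃ • y)
        = (-c₃) • (x * y - y * x) := by
      simp only [add_mul, mul_add, smul_mul_assoc, mul_smul_comm, hUx]
      module
    rw [e, hψz _ _ (hbr x hx y hy)] at h1
    have h2 := (mul_eq_zero.1 h1).resolve_right hxy
    rw [ZMod.intCast_zmod_eq_zero_iff_dvd] at h2
    simpa using h2
  obtain ⟨v, hv, hWv⟩ := hinv c₁ c₂ (fun hh => hc ⟨hh.1, hh.2, h3⟩)
  have h1 := h (v * y) (hv.2 _ hy)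
  have e : (c₁ • x + c₂ • (U * x) + c₃ • y) * (v * y) - (v * y) * (c₁ • x + c₂ • (U * x) + c₃ • y)
      = x * y - y * x := by
    have e0 : c₁ • x + c₂ • (U * x) = ((c₁ : D) + c₂ * U) * x := by
      rw [add_mul, zsmul_eq_mul, zsmul_eq_mul, mul_assoc]
    have hW : ∀ z, ((c₁ : D) + c₂ * U) * z = z * ((c₁ : D) + c₂ * U) := by
      intro z
      rw [add_mul, mul_add, (Int.cast_commute c₁ z).eq, mul_assoc, hU.1 z, ← mul_assoc,
        (Int.cast_commute c₂ z).eq, mul_assoc]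
    rw [e0, ← hv.bracket']
    generalize ((c₁ : D) + c₂ * U) = W at hWv hW ⊢
    have e1 : (W * x + c₃ • y) * y - y * (W * x + c₃ • y) = W * (x * y - y * x) := by
      simp only [add_mul, mul_add, smul_mul_assoc, mul_smul_comm, mul_sub]
      rw [← mul_assoc y W x, ← hW y]
      simp only [mul_assoc]
      abel
    rw [e1, ← mul_assoc, hv.1, hWv, one_mul]
  rw [e] at h1
  exact hxy h1

end Small

end SlOne
/-- Let `K` be a finite extension of `ℚ_p` of degree `d`, ramification index
`e` and inertia degree `f`, with ring of integers `𝒪_K = integralClosure ℤ_[p] K` and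
uniformizer `π`.  Let `F/K` be the unramified (cyclic Galois) extension of degree `n` with
Galois group generated by `θ`, and let `D = ⊕_{0 ≤ j < n} ι(F)·ϖ^j` be the cyclic division
algebra with `ϖ^n = π` and `ϖ·ι(α) = ι(θ α)·ϖ`.  Let `L = sl₁(Δ)` be the `ℤ_p`-submodule of
elements `∑ ι(a_j) ϖ^j` with `a_j ∈ 𝒪_F` and `T_{F/K}(a_0) = 0`.
If `f ≥ 2`, or `n ≥ 3` and `(p,n) ≠ (3,3)`, then for every maximal proper `ℤ_p`-submodule `N`
of `L` one has `[N,N] = [L,L]` (spans of commutator brackets). -/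
theorem stmt_0 (p : ℕ) [Fact (Nat.Prime p)]
    (K : Type) [Field K] [Algebra ℚ_[p] K] [FiniteDimensional ℚ_[p] K]
    [Algebra ℤ_[p] K] [IsScalarTower ℤ_[p] ℚ_[p] K]
    (d e f n : ℕ) [NeZero n]
    (hd : Module.finrank ℚ_[p] K = d)
    (π : K) (hπ : π ∈ integralClosure ℤ_[p] K)
    (hπirr : Irreducible (⟨π, hπ⟩ : integralClosure ℤ_[p] K))
    (he : ∃ u : (integralClosure ℤ_[p] K)ˣ,
      (p : integralClosure ℤ_[p] K) = ↑u * (⟨π, hπ⟩ : integralClosure ℤ_[p] K) ^ e)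
    (hef : d = e * f)
    (F : Type) [Field F] [Algebra K F]
    [Algebra ℚ_[p] F] [IsScalarTower ℚ_[p] K F]
    [Algebra ℤ_[p] F] [IsScalarTower ℤ_[p] ℚ_[p] F]
    [FiniteDimensional K F] [IsGalois K F]
    (hn : Module.finrank K F = n)
    (hπF : algebraMap K F π ∈ integralClosure ℤ_[p] F)
    (hFunram : Irreducible (⟨algebraMap K F π, hπF⟩ : integralClosure ℤ_[p] F))
    (θ : F ≃ₐ[K] F) (hθ : ∀ σ : F ≃ₐ[K] F, σ ∈ Subgroup.zpowers θ)
    (D : Type) [DivisionRing D] [Algebra K D]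
    [Algebra ℤ_[p] D] [IsScalarTower ℤ_[p] K D]
    (ϖ : D) (ι : F →ₐ[K] D)
    (hϖpow : ϖ ^ n = algebraMap K D π)
    (hϖcomm : ∀ α : F, ϖ * ι α = ι (θ α) * ϖ)
    (hbasis : ∀ x : D, ∃! a : Fin n → F, x = ∑ j : Fin n, ι (a j) * ϖ ^ (j : ℕ))
    -- `L = sl₁(Δ)`
    (L : Submodule ℤ_[p] D)
    (hL : (L : Set D) = {x : D | ∃ a : Fin n → F,
      (∀ j, a j ∈ integralClosure ℤ_[p] F) ∧ Algebra.trace K F (a 0) = 0 ∧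
      x = ∑ j : Fin n, ι (a j) * ϖ ^ (j : ℕ)})
    -- the hypothesis on `(p, n, f)`
    (hcond : 2 ≤ f ∨ (3 ≤ n ∧ ¬(p = 3 ∧ n = 3)))
    -- `N` a maximal proper `ℤ_p`-submodule of `L`
    (N : Submodule ℤ_[p] D) (hNlt : N < L)
    (hNmax : ∀ N' : Submodule ℤ_[p] D, N < N' → N' ≤ L → N' = L) :
    Submodule.span ℤ_[p] {z : D | ∃ x ∈ N, ∃ y ∈ N, z = x * y - y * x} =
      Submodule.span ℤ_[p] {z : D | ∃ x ∈ L, ∃ y ∈ L, z = x * y - y * x} := by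
  have hRK : ∀ c : ℤ_[p], algebraMap ℤ_[p] F c = algebraMap K F (algebraMap ℤ_[p] K c) := by
    intro c
    rw [IsScalarTower.algebraMap_apply ℤ_[p] ℚ_[p] F, IsScalarTower.algebraMap_apply ℤ_[p] ℚ_[p] K,
      ← IsScalarTower.algebraMap_apply ℚ_[p] K F]
  have : IsScalarTower ℤ_[p] K F := IsScalarTower.of_algebraMap_eq hRK
  have : FiniteDimensional ℚ_[p] F := FiniteDimensional.trans ℚ_[p] K F
  have hn0 : 0 < n := Nat.pos_of_ne_zero (NeZero.ne n)
  have hιK : ∀ c : K, ι (algebraMap K F c) = algebraMap K D c := fun c => ι.commutes c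
  have hmemL : ∀ x : D, x ∈ L ↔ ∃ a : Fin n → F,
      (∀ j, a j ∈ integralClosure ℤ_[p] F) ∧ Algebra.trace K F (a 0) = 0 ∧
      x = ∑ j : Fin n, ι (a j) * ϖ ^ (j : ℕ) := by
    intro x
    rw [← SetLike.mem_coe, hL]; rfl
  -- integral elements of `K` are central and preserve `L`
  have hintKF : ∀ c : K, c ∈ integralClosure ℤ_[p] K →
      algebraMap K F c ∈ integralClosure ℤ_[p] F := by
    intro c hc
    exact IsIntegral.map (IsScalarTower.toAlgHom ℤ_[p] K F) hc
  have hcen : ∀ c : K, c ∈ integralClosure ℤ_[p] K → SlOne.Cen L (algebraMap K D c) := by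
    intro c hc
    refine ⟨fun x => Algebra.commutes c x, fun x hx => ?_⟩
    obtain ⟨a, ha, hT, rfl⟩ := (hmemL x).1 hx
    refine (hmemL _).2 ⟨fun j => algebraMap K F c * a j,
      fun j => mul_mem (hintKF c hc) (ha j), ?_, ?_⟩
    · dsimp only
      rw [← Algebra.smul_def, map_smul, hT, smul_zero]
    · rw [Finset.mul_sum]
      refine Finset.sum_congr rfl fun j _ => ?_
      rw [map_mul, hιK, mul_assoc]
  have hsingle : ∀ (j : ℕ), j < n → ∀ a ∈ integralClosure ℤ_[p] F,
      (j = 0 → Algebra.trace K F a = 0) → ι a * ϖ ^ j ∈ L := by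
    intro j hjn a ha hT
    refine (hmemL _).2 ⟨fun i => if (i : ℕ) = j then a else 0, ?_, ?_, ?_⟩
    · intro i
      dsimp only
      split_ifs
      · exact ha
      · exact zero_mem _
    · dsimp only
      split_ifs with h
      · exact hT (by simpa using h.symm)
      · exact map_zero _
    · rw [Finset.sum_eq_single ⟨j, hjn⟩]
      · simp
      · intro i _ hi
        dsimp only
        rw [if_neg (fun h => hi (Fin.ext h)), map_zero, zero_mul]
      · simp
  -- `L` is finitely generated
  have hfg : L.FG := by
    have : Module.Finite ℤ_[p] (integralClosure ℤ_[p] F) := SlOne.finite_int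
    let g : (Fin n → integralClosure ℤ_[p] F) →ₗ[ℤ_[p]] D :=
      { toFun := fun a => ∑ j : Fin n, ι (a j : F) * ϖ ^ (j : ℕ)
        map_add' := by
          intro a b
          simp [add_mul, Finset.sum_add_distrib]
        map_smul' := by
          intro c a
          simp only [Pi.smul_apply, RingHom.id_apply, Finset.smul_sum]
          refine Finset.sum_congr rfl fun j _ => ?_
          rw [← smul_mul_assoc]
          congr 1
          change ι (c • (a j : F)) = _
          rw [Algebra.smul_def, map_mul, hRK, hιK, ← IsScalarTower.algebraMap_apply ℤ_[p] K D,
            ← Algebra.smul_def] }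
    have hle : L ≤ LinearMap.range g := by
      intro x hx
      obtain ⟨a, ha, -, rfl⟩ := (hmemL x).1 hx
      exact ⟨fun j => ⟨a j, ha j⟩, rfl⟩
    have : IsNoetherian ℤ_[p] (LinearMap.range g) := isNoetherian_of_isNoetherianRing_of_finite _ _
    exact Submodule.FG.of_le (Module.Finite.iff_fg.1 inferInstance) hle
  by_contra hne
  obtain ⟨u, hu⟩ := he
  have hu' : (p : K) = ((u : integralClosure ℤ_[p] K) : K) * π ^ e := by
    have := congrArg (Subtype.val) hu
    simpa using this
  have huu : ((u : integralClosure ℤ_[p] K) : K) * ((u⁻¹ : (integralClosure ℤ_[p] K)ˣ) :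
      integralClosure ℤ_[p] K) = 1 := by
    exact congrArg (Subtype.val) (u.mul_inv)
  have hte : (algebraMap K D π) ^ e = algebraMap K D
      (((u⁻¹ : (integralClosure ℤ_[p] K)ˣ) : integralClosure ℤ_[p] K) : K) * (p : D) := by
    rw [← map_natCast (algebraMap K D) p, ← map_mul, ← map_pow]
    congr 1
    rw [hu', ← mul_assoc, mul_comm _ ((u : integralClosure ℤ_[p] K) : K), huu, one_mul]
  obtain ⟨ψ, hadd, hψt, hψne, hthree⟩ := SlOne.core L N _ hNlt hNmax hfg rfl (algebraMap K D π) _ e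
    (hcen π hπ) (hcen _ (Subtype.prop _)) hte hne
  have hbr : ∀ x ∈ L, ∀ y ∈ L, x * y - y * x ∈
      Submodule.span ℤ_[p] {z : D | ∃ x ∈ L, ∃ y ∈ L, z = x * y - y * x} :=
    fun x hx y hy => Submodule.subset_span ⟨x, hx, y, hy, rfl⟩
  rcases hcond with hf | ⟨hn3, hp3⟩
  · obtain ⟨U, hU⟩ := SlOne.exists_u e f _ hπirr ⟨u, hu⟩ (hd.trans hef) hf
    refine SlOne.small L _ hbr ψ hadd hψne hthree (algebraMap K D (U : K)) (hcen _ U.2) ?_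
    intro c₁ c₂ hc
    have hunit := (SlOne.unit_or_dvd _ ((c₁ : integralClosure ℤ_[p] K) +
      (c₂ : integralClosure ℤ_[p] K) * U) hπirr).resolve_right
      (fun h => hc (hU c₁ c₂ h))
    obtain ⟨v, hv⟩ := hunit.exists_right_inv
    refine ⟨algebraMap K D (v : K), hcen _ v.2, ?_⟩
    have := congrArg (fun z : integralClosure ℤ_[p] K => algebraMap K D (z : K)) hv
    simpa using this
  · -- the ring of integers of `F` and the restriction of `θ`
    have hθint : ∀ σ : F ≃ₐ[K] F, ∀ x ∈ integralClosure ℤ_[p] F,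
        σ x ∈ integralClosure ℤ_[p] F := by
      intro σ x hx
      exact IsIntegral.map ((σ : F →ₐ[K] F).restrictScalars ℤ_[p]) hx
    let res : (F ≃ₐ[K] F) → (integralClosure ℤ_[p] F →+* integralClosure ℤ_[p] F) := fun σ =>
      ((σ : F →+* F).comp (integralClosure ℤ_[p] F).toSubring.subtype).codRestrict
        (integralClosure ℤ_[p] F).toSubring (fun x => hθint σ x x.2)
    have hres : ∀ σ x, ((res σ x : integralClosure ℤ_[p] F) : F) = σ x := fun σ x => rfl
    have hrespow : ∀ m x, (((res θ ^ m) x : integralClosure ℤ_[p] F) : F) = (θ ^ m) x := by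
      intro m
      induction m with
      | zero => intro x; rfl
      | succ m ih =>
        intro x
        rw [pow_succ', pow_succ', RingHom.mul_def, RingHom.comp_apply, hres, ih]
        rfl
    have hord : orderOf θ = n := by
      rw [orderOf_eq_card_of_forall_mem_zpowers hθ, IsGalois.card_aut_eq_finrank, hn]
    have hθpi : ∀ σ : F ≃ₐ[K] F, res σ ⟨algebraMap K F π, hπF⟩ = ⟨algebraMap K F π, hπF⟩ := by
      intro σ
      apply Subtype.ext
      rw [hres]
      exact σ.commutes π
    refine SlOne.big ((ι : F →+* D).comp (integralClosure ℤ_[p] F).toSubring.subtype) ϖ (res θ)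
      (fun a => hϖcomm a) n hn3 ⟨algebraMap K F π, hπF⟩ (SlOne.prime_pi _ hFunram) ?_
      (SlOne.p_dvd _ hFunram) (fun x => SlOne.unit_or_dvd _ x hFunram) ?_ (hθpi θ) ?_ ?_ hp3 L _
      ?_ ?_ ?_ hbr ψ hadd ?_ hψne hthree
    · rw [hϖpow]; exact (hιK π).symm
    · rintro x ⟨y, hy⟩
      refine ⟨res θ.symm y, ?_⟩
      have h1 := congrArg (res θ.symm) hy
      rw [map_mul, hθpi] at h1
      rw [← h1]
      apply Subtype.ext
      rw [hres, hres]
      simp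
    · intro m hm hmn
      by_contra hcon
      push Not at hcon
      obtain ⟨Q, hpQ, hQ⟩ := SlOne.exists_pow_congr _ hFunram
      have hrig := SlOne.rigid _ p Q hpQ (SlOne.p_dvd _ hFunram) hQ
        (fun x hx => SlOne.inter_pow _ x hFunram hx) (res θ ^ m)
        (by
          apply Subtype.ext
          rw [hrespow]
          exact (θ ^ m).commutes π) hcon
      have h1 : θ ^ m = 1 := by
        apply AlgEquiv.ext
        intro x
        have : IsFractionRing (integralClosure ℤ_[p] F) F :=
          integralClosure.isFractionRing_of_finite_extension ℚ_[p] F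
        obtain ⟨a, b, hb, rfl⟩ := IsFractionRing.div_surjective (A := integralClosure ℤ_[p] F) x
        have hfix : ∀ z : integralClosure ℤ_[p] F, (θ ^ m) (z : F) = z := by
          intro z
          rw [← hrespow, hrig]
        rw [map_div₀]
        change (θ ^ m) (a : F) / (θ ^ m) (b : F) = (a : F) / b
        rw [hfix, hfix]
      have := orderOf_dvd_of_pow_eq_one h1
      rw [hord] at this
      exact absurd (Nat.le_of_dvd hm this) (by omega)
    · intro a
      apply Subtype.ext
      rw [hrespow, ← hord, pow_orderOf_eq_one]
      rfl
    · intro j hj1 hjn a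
      exact hsingle j hjn a a.2 (fun h => absurd h (by omega))
    · intro b
      refine hsingle 0 hn0 ((b - res θ b : integralClosure ℤ_[p] F) : F) (Subtype.prop _) (fun _ => ?_)
      change Algebra.trace K F ((b : F) - θ b) = 0
      rw [map_sub, Algebra.trace_eq_of_algEquiv, sub_self]
    · intro x hx
      obtain ⟨a, ha, hT, rfl⟩ := (hmemL x).1 hx
      refine ⟨fun j => if h : j < n then ⟨a ⟨j, h⟩, ha _⟩ else 0, ?_, ?_⟩
      · rw [Finset.sum_range]
        refine Finset.sum_congr rfl fun j _ => ?_
        dsimp only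
        rw [dif_pos j.2]
        rfl
      · dsimp only
        rw [dif_pos hn0]
        exact hsingle 0 hn0 (a 0) (ha 0) (fun _ => hT)
    · intro v hv
      rw [← hψt v hv]
      congr 2
      exact hιK π
end

section
/- Assume that n ≥ 3 and (p,n) ≠ (3,3). Let M be a maximal proper 𝒪_K-submodule of sl_1(Δ). Then [M,M] = [sl_1(Δ), sl_1(Δ)], where [M,M] denotes the set of finite sums of Lie brackets of elements of M. -/
section VR
variable (p : ℕ) [Fact (Nat.Prime p)]
    (K : Type) [Field K] [Algebra ℚ_[p] K] [FiniteDimensional ℚ_[p] K]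
    [Algebra ℤ_[p] K] [IsScalarTower ℤ_[p] ℚ_[p] K]

lemma isIntegral_of_spectralNorm_le (x : K) (h : spectralNorm ℚ_[p] K x ≤ 1) :
    IsIntegral ℤ_[p] x := by
  have hx : IsIntegral ℚ_[p] x := Algebra.IsIntegral.isIntegral x
  have hm := minpoly.monic hx
  have h1 := (spectralValue_le_one_iff hm).1 h
  have hl : minpoly ℚ_[p] x ∈ Polynomial.lifts (algebraMap ℤ_[p] ℚ_[p]) := by
    rw [Polynomial.lifts_iff_coeff_lifts]
    intro i
    exact ⟨⟨(minpoly ℚ_[p] x).coeff i, h1 i⟩, rfl⟩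
  obtain ⟨q, hq, -, hqm⟩ := Polynomial.lifts_and_degree_eq_and_monic hl hm
  refine ⟨q, hqm, ?_⟩
  have : Polynomial.aeval x (minpoly ℚ_[p] x) = 0 := minpoly.aeval _ _
  rw [← hq, Polynomial.aeval_map_algebraMap] at this
  exact this

lemma valuationRing_integralClosure : ValuationRing (integralClosure ℤ_[p] K) := by
  have : IsFractionRing (integralClosure ℤ_[p] K) K :=
    integralClosure.isFractionRing_of_finite_extension ℚ_[p] K
  rw [ValuationRing.iff_isInteger_or_isInteger (integralClosure ℤ_[p] K) K]
  intro x
  have key : ∀ y : K, spectralNorm ℚ_[p] K y ≤ 1 →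
      IsLocalization.IsInteger (integralClosure ℤ_[p] K) y := fun y hy =>
    ⟨⟨y, isIntegral_of_spectralNorm_le p K y hy⟩, rfl⟩
  by_cases hx : spectralNorm ℚ_[p] K x ≤ 1
  · exact Or.inl (key x hx)
  · right
    apply key
    have hmul : spectralNorm ℚ_[p] K (x * x⁻¹) = spectralNorm ℚ_[p] K x * spectralNorm ℚ_[p] K x⁻¹ :=
      map_mul (spectralMulAlgNorm ℚ_[p] K) x x⁻¹
    have hx0 : x ≠ 0 := by
      rintro rfl
      apply hx
      rw [spectralNorm_zero]; exact zero_le_one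
    rw [mul_inv_cancel₀ hx0, spectralNorm_one] at hmul
    push Not at hx
    nlinarith [spectralNorm_nonneg (K := ℚ_[p]) x⁻¹]

lemma dvr_integralClosure (π : integralClosure ℤ_[p] K) (hπ : Irreducible π) :
    IsDiscreteValuationRing (integralClosure ℤ_[p] K) := by
  have := valuationRing_integralClosure p K
  have : IsNoetherianRing (integralClosure ℤ_[p] K) :=
    IsIntegralClosure.isNoetherianRing ℤ_[p] ℚ_[p] K (integralClosure ℤ_[p] K)
  have : IsPrincipalIdealRing (integralClosure ℤ_[p] K) := inferInstance
  exact { not_a_field' := by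
            intro h
            have := (IsLocalRing.mem_maximalIdeal π).2 hπ.1
            rw [h] at this
            exact hπ.ne_zero this }
end VR

section Fin
lemma finite_residue_ic (p : ℕ) [Fact (Nat.Prime p)]
    (K : Type) [Field K] [Algebra ℚ_[p] K] [FiniteDimensional ℚ_[p] K]
    [Algebra ℤ_[p] K] [IsScalarTower ℤ_[p] ℚ_[p] K] [IsLocalRing (integralClosure ℤ_[p] K)] :
    Finite ((integralClosure ℤ_[p] K) ⧸ IsLocalRing.maximalIdeal (integralClosure ℤ_[p] K)) := by
  have hfin : Module.Finite ℤ_[p] (integralClosure ℤ_[p] K) :=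
    IsIntegralClosure.finite ℤ_[p] ℚ_[p] K (integralClosure ℤ_[p] K)
  have hinj : Function.Injective (algebraMap ℤ_[p] (integralClosure ℤ_[p] K)) := by
    have h1 : Function.Injective (algebraMap ℤ_[p] K) := by
      rw [IsScalarTower.algebraMap_eq ℤ_[p] ℚ_[p] K]
      exact (algebraMap ℚ_[p] K).injective.comp (IsFractionRing.injective ℤ_[p] ℚ_[p])
    rw [IsScalarTower.algebraMap_eq ℤ_[p] (integralClosure ℤ_[p] K) K, RingHom.coe_comp] at h1
    exact Function.Injective.of_comp h1
  have hloc : IsLocalHom (algebraMap ℤ_[p] (integralClosure ℤ_[p] K)) :=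
    RingHom.IsIntegral.isLocalHom (algebraMap_isIntegral_iff.2 inferInstance) hinj
  have : Finite (IsLocalRing.ResidueField ℤ_[p]) :=
    Finite.of_equiv _ (PadicInt.residueField (p := p)).toEquiv.symm
  exact IsLocalRing.ResidueField.finite_of_finite
    (R := ℤ_[p]) (S := integralClosure ℤ_[p] K) this

lemma span_eq_span_of_closed {R A D : Type} [Semiring R] [Semiring A] [AddCommMonoid D] [Module R D]
    [Module A D] (S : Set D) (hR : ∀ (r : R), ∀ x ∈ S, r • x ∈ S) (hA : ∀ (r : A), ∀ x ∈ S, r • x ∈ S) :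
    ∀ x, x ∈ Submodule.span R S ↔ x ∈ Submodule.span A S := by
  have key : ∀ {R : Type} [Semiring R] [Module R D], (∀ (r : R), ∀ x ∈ S, r • x ∈ S) →
      ∀ x, x ∈ Submodule.span R S ↔ x ∈ AddSubmonoid.closure S := by
    intro R _ _ h x
    constructor
    · intro hx
      rw [← Submodule.mem_toAddSubmonoid, Submodule.span_eq_closure] at hx
      refine AddSubmonoid.closure_mono ?_ hx
      rintro _ ⟨r, -, y, hy, rfl⟩
      exact h r y hy
    · intro hx
      exact Submodule.closure_subset_span hx
  intro x
  rw [key hR, key hA]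
end Fin

section Pure
open Module
variable {k E : Type*} [Field k] [Field E] [Algebra k E] [FiniteDimensional k E] [IsGalois k E]

lemma finrank_kerTrace : finrank k (LinearMap.ker (Algebra.trace k E)) + 1 = finrank k E := by
  have h := LinearMap.finrank_range_add_finrank_ker (Algebra.trace k E)
  rw [LinearMap.range_eq_top.mpr (Algebra.trace_surjective k E), finrank_top, finrank_self] at h
  omega

/-- `1 - θ^m` -/
noncomputable def cmap (θ : E ≃ₐ[k] E) (m : ℕ) : E →ₗ[k] E :=
  LinearMap.id - (θ ^ m).toLinearMap

lemma cmap_apply (θ : E ≃ₐ[k] E) (m : ℕ) (x : E) : cmap θ m x = x - (θ ^ m) x := rfl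

lemma finrank_ker_cmap (θ : E ≃ₐ[k] E) (m : ℕ) :
    finrank k (LinearMap.ker (cmap θ m)) * orderOf (θ ^ m) = finrank k E := by
  have h1 : LinearMap.ker (cmap θ m) = Subalgebra.toSubmodule
      (IntermediateField.fixedField (Subgroup.zpowers (θ ^ m))).toSubalgebra := by
    ext x
    have : x ∈ IntermediateField.fixedField (Subgroup.zpowers (θ ^ m)) ↔ (θ ^ m) x = x := by
      rw [IntermediateField.mem_fixedField_iff]
      constructor
      · intro h; exact h _ (Subgroup.mem_zpowers _)
      · intro h f hf
        have h2 : Subgroup.zpowers (θ ^ m) ≤ MulAction.stabilizer (E ≃ₐ[k] E) x := by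
          rw [Subgroup.zpowers_le]
          exact h
        exact h2 hf
    simp only [LinearMap.mem_ker, cmap_apply, sub_eq_zero, Subalgebra.mem_toSubmodule,
      IntermediateField.mem_toSubalgebra, this]
    exact eq_comm
  have h2 := IntermediateField.finrank_fixedField_eq_card (Subgroup.zpowers (θ ^ m))
  rw [Nat.card_zpowers] at h2
  rw [h1, ← h2]
  exact finrank_mul_finrank k (IntermediateField.fixedField (Subgroup.zpowers (θ ^ m))) E


lemma orderOf_gen (θ : E ≃ₐ[k] E) (hθ : ∀ σ : E ≃ₐ[k] E, σ ∈ Subgroup.zpowers θ) : orderOf θ = finrank k E := by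
  rw [orderOf_eq_card_of_forall_mem_zpowers hθ, IsGalois.card_aut_eq_finrank]

lemma hilbert90_add (θ : E ≃ₐ[k] E) (hθ : ∀ σ : E ≃ₐ[k] E, σ ∈ Subgroup.zpowers θ) (x : E) (hx : Algebra.trace k E x = 0) : ∃ y, x = y - θ y := by
  have h1 := finrank_ker_cmap θ 1
  rw [pow_one, orderOf_gen θ hθ] at h1
  have h0 : 0 < finrank k E := finrank_pos
  have h2 : finrank k (LinearMap.ker (cmap θ 1)) = 1 := by
    have : finrank k (LinearMap.ker (cmap θ 1)) * finrank k E = 1 * finrank k E := by rw [h1, one_mul]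
    exact Nat.eq_of_mul_eq_mul_right h0 this
  have h3 := LinearMap.finrank_range_add_finrank_ker (cmap θ 1)
  have h4 := finrank_kerTrace (k := k) (E := E)
  have h5 : LinearMap.range (cmap θ 1) ≤ LinearMap.ker (Algebra.trace k E) := by
    rintro _ ⟨y, rfl⟩
    rw [LinearMap.mem_ker, cmap_apply, map_sub, Algebra.trace_eq_of_algEquiv, sub_self]
  have h6 := Submodule.eq_of_le_of_finrank_eq h5 (by omega)
  have : x ∈ LinearMap.range (cmap θ 1) := by rw [h6]; exact hx
  obtain ⟨y, rfl⟩ := this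
  exact ⟨y, by rw [cmap_apply, pow_one]⟩


lemma finrank_fix_le (θ : E ≃ₐ[k] E) (hθ : ∀ σ : E ≃ₐ[k] E, σ ∈ Subgroup.zpowers θ)
    {n : ℕ} (hn : finrank k E = n) (h3 : 3 ≤ n) {m : ℕ} (hm : 1 ≤ m) (hmn : m < n) :
    2 * finrank k (LinearMap.ker (cmap θ m)) ≤ n := by
  have h1 := finrank_ker_cmap θ m
  rw [hn] at h1
  have h2 : orderOf (θ ^ m) ≠ 1 := by
    intro h
    rw [orderOf_eq_one_iff] at h
    have := orderOf_dvd_of_pow_eq_one h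
    rw [orderOf_gen θ hθ, hn] at this
    exact absurd (Nat.le_of_dvd hm this) (by omega)
  have h3 : orderOf (θ ^ m) ≠ 0 := by
    intro h; rw [h] at h1; omega
  have h4 : 2 ≤ orderOf (θ ^ m) := by omega
  nlinarith

lemma finrank_fix_inf_lt (θ : E ≃ₐ[k] E) (hθ : ∀ σ : E ≃ₐ[k] E, σ ∈ Subgroup.zpowers θ)
    {n : ℕ} (hn : finrank k E = n) (h3 : 3 ≤ n) (h33 : n = 3 → (3 : k) ≠ 0) {m : ℕ} (hm : 1 ≤ m) (hmn : m < n) (hm2 : ¬ (n = 4 ∧ m = 2)) :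
    finrank k (LinearMap.ker (Algebra.trace k E) ⊓ LinearMap.ker (cmap θ m) : Submodule k E) + 2 < n := by
  have h1 := finrank_fix_le θ hθ hn h3 hm hmn
  have h2 : finrank k (LinearMap.ker (Algebra.trace k E) ⊓ LinearMap.ker (cmap θ m) : Submodule k E) ≤
    finrank k (LinearMap.ker (cmap θ m)) := Submodule.finrank_mono inf_le_right
  have ho := finrank_ker_cmap θ m
  by_cases h5 : 5 ≤ n
  · omega
  by_cases h4 : n = 4
  · have : orderOf (θ ^ m) = 4 := by
      rw [Nat.Coprime.orderOf_pow, orderOf_gen θ hθ, hn, h4]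
      rw [orderOf_gen θ hθ, hn, h4]
      have : m = 1 ∨ m = 3 := by omega
      rcases this with rfl | rfl <;> decide
    rw [this, hn] at ho
    omega
  have hn3 : n = 3 := by omega
  have hθ3 : θ ^ 3 = 1 := by rw [← hn3, ← hn, ← orderOf_gen θ hθ, pow_orderOf_eq_one]
  have : (LinearMap.ker (Algebra.trace k E) ⊓ LinearMap.ker (cmap θ m) : Submodule k E) = ⊥ := by
    rw [eq_bot_iff]
    rintro x ⟨hx1, hx2⟩
    have hfix : θ x = x := by
      have h0 : x - (θ ^ m) x = 0 := hx2
      rw [sub_eq_zero] at h0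
      have hm12 : m = 1 ∨ m = 2 := by omega
      rcases hm12 with rfl | rfl
      · rw [pow_one] at h0
        exact h0.symm
      · have h5 : (θ ^ 3) x = x := by rw [hθ3]; rfl
        rw [pow_succ', AlgEquiv.mul_apply, ← h0] at h5
        exact h5
    have hb : x ∈ (⊥ : IntermediateField k E) := by
      rw [IsGalois.mem_bot_iff_fixed]
      intro f
      have h2 : Subgroup.zpowers θ ≤ MulAction.stabilizer (E ≃ₐ[k] E) x := by
        rw [Subgroup.zpowers_le]
        exact hfix
      exact h2 (hθ f)
    obtain ⟨c, rfl⟩ := IntermediateField.mem_bot.1 hb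
    have : Algebra.trace k E (algebraMap k E c) = 0 := hx1
    rw [Algebra.trace_algebraMap, hn, hn3, nsmul_eq_mul] at this
    have h3' := h33 hn3
    have : c = 0 := by
      rcases mul_eq_zero.1 this with h | h
      · exact absurd (by exact_mod_cast h) h3'
      · exact h
    simp [this]
  rw [this, finrank_bot]
  omega

section CharP
variable (p : ℕ) [Fact p.Prime] [Algebra (ZMod p) E] [Finite E]

lemma card_mul_card_le (C W : AddSubgroup E) (y : E) (hy : y ≠ 0)
    (h : ∀ c ∈ C, ∀ w ∈ W, Algebra.trace (ZMod p) E (y * (c * w)) = 0) :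
    Nat.card C * Nat.card W ≤ Nat.card E := by
  have : FiniteDimensional (ZMod p) E := inferInstance
  set C' := AddSubgroup.toZModSubmodule p C
  set W' := AddSubgroup.toZModSubmodule p W
  have hf := LinearMap.BilinForm.finrank_orthogonal (traceForm_nondegenerate (ZMod p) E) W'
  have hle : C'.map (LinearMap.mulLeft (ZMod p) y) ≤
      (Algebra.traceForm (ZMod p) E).orthogonal W' := by
    rintro _ ⟨c, hc, rfl⟩ w hw
    have := h c hc w hw
    rw [Algebra.traceForm_apply, LinearMap.mulLeft_apply]
    rw [← this]
    congr 1
    ring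
  have hinj : Function.Injective (LinearMap.mulLeft (ZMod p) y) := fun a b hab => by
    simpa [hy] using hab
  have h1 := Submodule.finrank_mono hle
  rw [← LinearEquiv.finrank_eq (Submodule.equivMapOfInjective _ hinj C'), hf] at h1
  have h2 := Submodule.finrank_le W'
  have e1 : Nat.card C = Nat.card (ZMod p) ^ finrank (ZMod p) C' :=
    Module.natCard_eq_pow_finrank (K := ZMod p) (V := C')
  have e2 : Nat.card W = Nat.card (ZMod p) ^ finrank (ZMod p) W' :=
    Module.natCard_eq_pow_finrank (K := ZMod p) (V := W')
  rw [e1, e2, Module.natCard_eq_pow_finrank (K := ZMod p) (V := E), ← pow_add]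
  exact Nat.pow_le_pow_right Nat.card_pos (by omega)

lemma exists_dual (S : AddSubgroup E) (hS : S ≠ ⊤) :
    ∃ y, y ≠ 0 ∧ ∀ s ∈ S, Algebra.trace (ZMod p) E (y * s) = 0 := by
  set S' := AddSubgroup.toZModSubmodule p S
  have hf := LinearMap.BilinForm.finrank_orthogonal (traceForm_nondegenerate (ZMod p) E) S'
  have hlt : S' < ⊤ := by
    refine lt_top_iff_ne_top.2 fun h => hS ?_
    rw [AddSubgroup.eq_top_iff']
    intro x
    have : x ∈ S' := by rw [h]; trivial
    exact this
  have h1 := Submodule.finrank_lt hlt.ne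
  have hne : (Algebra.traceForm (ZMod p) E).orthogonal S' ≠ ⊥ := by
    intro h
    rw [h, finrank_bot] at hf
    omega
  obtain ⟨y, hy, hy0⟩ := Submodule.exists_mem_ne_zero_of_ne_bot hne
  refine ⟨y, hy0, fun s hs => ?_⟩
  have := hy s hs
  rw [Algebra.traceForm_apply] at this
  rwa [mul_comm]

lemma trace_gal (θ : E ≃ₐ[k] E) (x : E) :
    Algebra.trace (ZMod p) E (θ x) = Algebra.trace (ZMod p) E x := by
  let θ' : E ≃ₐ[ZMod p] E := AlgEquiv.ofRingEquiv (f := (θ : E ≃+* E)) (fun r => by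
    exact (RingHom.congr_fun (Subsingleton.elim
      (((θ : E ≃+* E) : E →+* E).comp (algebraMap (ZMod p) E)) (algebraMap (ZMod p) E)) r))
  exact Algebra.trace_eq_of_algEquiv θ' x

end CharP

lemma add_deg_two (p : ℕ) [Fact p.Prime] [Algebra (ZMod p) E] [Finite E] (θ : E ≃ₐ[k] E) (hθ2 : θ ^ 2 ≠ 1) (S : AddSubgroup E)
    (hS : ∀ a b : E, a * θ b - b * θ a ∈ S) : S = ⊤ := by
  by_contra hne
  obtain ⟨y, hy, hyS⟩ := exists_dual p S hne
  have key : ∀ a, y * a = θ y * θ (θ a) := by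
    intro a
    rw [← sub_eq_zero]
    by_contra h0
    have hz : ∀ c : E, Algebra.trace (ZMod p) E ((y * a - θ y * θ (θ a)) * c) = 0 := by
      intro c
      obtain ⟨b, rfl⟩ := θ.surjective c
      have h1 := hyS _ (hS a b)
      have h2 := trace_gal p θ (y * (b * θ a))
      rw [mul_sub, map_sub, ← h2, ← map_sub] at h1
      rw [← h1]
      congr 1
      rw [map_mul, map_mul]
      ring
    have h3 := card_mul_card_le p (⊤ : AddSubgroup E) ⊤ _ h0 (fun c _ w _ => hz _)
    rw [AddSubgroup.card_top] at h3
    have h4 : 1 < Nat.card E := Finite.one_lt_card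
    nlinarith
  have h1 := key 1
  rw [mul_one, map_one, map_one, mul_one] at h1
  apply hθ2
  ext a
  have h2 := key a
  rw [← h1] at h2
  rw [pow_two, AlgEquiv.mul_apply, AlgEquiv.one_apply]
  exact (mul_left_cancel₀ hy h2).symm


lemma natCard_map_ker_le {G G' : Type*} [AddCommGroup G] [AddCommGroup G'] [Finite G] (f : G →+ G')
    (U : AddSubgroup G) : Nat.card U ≤ Nat.card (U.map f) * Nat.card (U ⊓ f.ker : AddSubgroup G) := by
  have h1 := AddSubgroup.relIndex_ker (K := U) f
  have h2 := AddSubgroup.relIndex_mul_relIndex (⊥ : AddSubgroup G) (U ⊓ f.ker) U bot_le inf_le_left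
  rw [AddSubgroup.relIndex_bot_left, AddSubgroup.relIndex_bot_left, AddSubgroup.inf_relIndex_left, h1] at h2
  rw [← h2, mul_comm]

lemma add_mid_deg (p : ℕ) [Fact p.Prime] [Algebra (ZMod p) E] [Finite E]
    (θ : E ≃ₐ[k] E) (hθ : ∀ σ : E ≃ₐ[k] E, σ ∈ Subgroup.zpowers θ)
    {n : ℕ} (hn : finrank k E = n) (h3 : 3 ≤ n) (h33 : n = 3 → (3 : k) ≠ 0)
    {m : ℕ} (hm : 1 ≤ m) (hmn : m < n) (U W S : AddSubgroup E)
    (hU : ∀ u ∈ U, Algebra.trace k E u = 0)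
    (hcard : Nat.card k ^ (2 * n - 1) ≤ Nat.card k * (Nat.card U * Nat.card W))
    (hS : ∀ a ∈ U, ∀ b ∈ W, cmap θ m a * b ∈ S) :
    S = ⊤ ∨ (n = 4 ∧ m = 2 ∧ Nat.card k * (Nat.card U * Nat.card W) ≤ Nat.card k ^ (2 * n - 1)) := by
  by_contra! hcon
  obtain ⟨hne, hcon⟩ := hcon
  obtain ⟨y, hy, hyS⟩ := exists_dual p S hne
  have : Finite k := Finite.of_injective _ (algebraMap k E).injective
  have hq : 1 < Nat.card k := Finite.one_lt_card
  have h1 := card_mul_card_le p (U.map (cmap θ m).toAddMonoidHom) W y hy (by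
    rintro _ ⟨u, hu, rfl⟩ w hw
    exact hyS _ (hS u hu w hw))
  have h2 := natCard_map_ker_le (cmap θ m).toAddMonoidHom U
  set Z : Submodule k E := LinearMap.ker (Algebra.trace k E) ⊓ LinearMap.ker (cmap θ m) with hZ
  have h4 : Nat.card (U ⊓ (cmap θ m).toAddMonoidHom.ker : AddSubgroup E) ≤
      Nat.card k ^ finrank k Z := by
    rw [← Module.natCard_eq_pow_finrank (K := k) (V := Z)]
    refine Nat.card_le_card_of_injective
      (fun x => (⟨x.1, hU _ x.2.1, x.2.2⟩ : Z)) ?_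
    intro a b hab
    exact Subtype.ext (congrArg (fun z : Z => (z : E)) hab)
  rw [Module.natCard_eq_pow_finrank (K := k) (V := E), hn] at h1
  set c := Nat.card (U.map (cmap θ m).toAddMonoidHom)
  set z := Nat.card (U ⊓ (cmap θ m).toAddMonoidHom.ker : AddSubgroup E)
  set q := Nat.card k
  have h5 : Nat.card U * Nat.card W ≤ q ^ (finrank k Z + n) := by
    calc Nat.card U * Nat.card W ≤ c * z * Nat.card W := Nat.mul_le_mul_right _ h2
      _ = z * (c * Nat.card W) := by ring
      _ ≤ q ^ finrank k Z * q ^ n := Nat.mul_le_mul h4 h1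
      _ = _ := by rw [pow_add]
  have h6 : q * (Nat.card U * Nat.card W) ≤ q ^ (finrank k Z + n + 1) := by
    rw [pow_succ']
    exact Nat.mul_le_mul_left _ h5
  by_cases hb : n = 4 ∧ m = 2
  · refine absurd h6 (not_le.2 (lt_of_le_of_lt ?_ (hcon hb.1 hb.2)))
    apply Nat.pow_le_pow_right (by omega)
    have h7 : finrank k Z ≤ finrank k (LinearMap.ker (cmap θ m)) := Submodule.finrank_mono inf_le_right
    have h8 := finrank_fix_le θ hθ hn h3 hm hmn
    omega
  · have h7 := finrank_fix_inf_lt θ hθ hn h3 h33 hm hmn hb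
    have h8 := (Nat.pow_le_pow_iff_right hq).1 (hcard.trans h6)
    rw [← hZ] at h7
    omega

lemma add_top_deg (p : ℕ) [Fact p.Prime] [Algebra (ZMod p) E] [Finite E]
    (θ : E ≃ₐ[k] E) (hθ : ∀ σ : E ≃ₐ[k] E, σ ∈ Subgroup.zpowers θ)
    {n : ℕ} (hn : finrank k E = n) (h3 : 3 ≤ n) (s : ℕ) (hs : θ ^ s * θ = 1)
    (U W S : AddSubgroup E)
    (hcard : Nat.card k ^ (2 * n) ≤ Nat.card k * (Nat.card U * Nat.card W))
    (hS : ∀ a ∈ U, ∀ b ∈ W, a * θ b - b * (θ ^ s) a ∈ S) :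
    ∀ x, Algebra.trace k E x = 0 → x ∈ S := by
  have : Finite k := Finite.of_injective _ (algebraMap k E).injective
  have hq : 1 < Nat.card k := Finite.one_lt_card
  have hs' : ∀ x, (θ ^ s) (θ x) = x := fun x => by
    rw [← AlgEquiv.mul_apply, hs, AlgEquiv.one_apply]
  let S' : AddSubgroup E := S.comap (cmap θ s).toAddMonoidHom
  have hS' : S' = ⊤ := by
    by_contra hne
    obtain ⟨y, hy, hyS⟩ := exists_dual p S' hne
    have h1 := card_mul_card_le p U (W.map θ.toLinearMap.toAddMonoidHom) y hy (by
      rintro u hu _ ⟨w, hw, rfl⟩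
      apply hyS
      have := hS u hu w hw
      change cmap θ s (u * θ w) ∈ S
      rw [cmap_apply, map_mul, hs', mul_comm ((θ ^ s) u)]
      exact this)
    have h2 : Nat.card (W.map θ.toLinearMap.toAddMonoidHom) = Nat.card W :=
      Nat.card_congr (AddSubgroup.equivMapOfInjective W _ θ.injective).toEquiv.symm
    rw [h2, Module.natCard_eq_pow_finrank (K := k) (V := E), hn] at h1
    have h4 := hcard.trans (Nat.mul_le_mul_left _ h1)
    rw [← pow_succ', Nat.pow_le_pow_iff_right hq] at h4
    omega
  intro x hx
  obtain ⟨y, rfl⟩ := hilbert90_add θ hθ x hx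
  have h1 : θ y ∈ S' := by rw [hS']; trivial
  have h2 : θ y - (θ ^ s) (θ y) ∈ S := h1
  rw [hs'] at h2
  have := S.neg_mem h2
  rwa [neg_sub] at this
end Pure

section Graded
variable {A B D k E : Type*} [CommRing A] [CommRing B] [Algebra A B] [Ring D] [Module A D]
  [Field k] [Field E] [Algebra k E]

/-- The data of a cyclic order together with its reduction. -/
structure CycData (j : B →+* D) (ϖ : D) (τ : B ≃ₐ[A] B) (π : A) (n : ℕ)
    (red : B →+* E) (redA : A →+* k) (θ : E ≃ₐ[k] E) : Prop where
  comm : ∀ b, ϖ * j b = j (τ b) * ϖ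
  pow : ϖ ^ n = j (algebraMap A B π)
  smul : ∀ (a : A) (x : D), a • x = j (algebraMap A B a) * x
  central : ∀ (a : A) (x : D), x * j (algebraMap A B a) = j (algebraMap A B a) * x
  npos : 3 ≤ n
  taun : τ ^ n = 1
  redsurj : Function.Surjective red
  redAsurj : Function.Surjective redA
  redker : ∀ b, red b = 0 → ∃ c, b = algebraMap A B π * c
  redalg : ∀ a, red (algebraMap A B a) = algebraMap k E (redA a)
  redtau : ∀ b, red (τ b) = θ (red b)

/-- The filtration by powers of `ϖ`. -/
def Dl (A : Type*) {B D : Type*} [CommRing A] [CommRing B] [Ring D] [Module A D]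
    (j : B →+* D) (ϖ : D) (m : ℕ) : Submodule A D :=
  Submodule.span A {x | ∃ (b : B) (i : ℕ), m ≤ i ∧ x = j b * ϖ ^ i}

/-- `x` has leading coefficient `e` in degree `m`. -/
def Lead (A : Type*) {B D E : Type*} [CommRing A] [CommRing B] [Ring D] [Module A D] [Field E]
    (j : B →+* D) (ϖ : D) (red : B →+* E) (m : ℕ) (x : D) (e : E) : Prop :=
  ∃ b, red b = e ∧ x - j b * ϖ ^ m ∈ Dl A j ϖ (m + 1)

namespace CycData
variable {j : B →+* D} {ϖ : D} {τ : B ≃ₐ[A] B} {π : A} {n : ℕ}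
    {red : B →+* E} {redA : A →+* k} {θ : E ≃ₐ[k] E}

lemma mono_mem (b : B) {m i : ℕ} (h : m ≤ i) : j b * ϖ ^ i ∈ Dl A j ϖ m :=
  Submodule.subset_span ⟨b, i, h, rfl⟩

lemma anti {m i : ℕ} (h : m ≤ i) : Dl A j ϖ i ≤ Dl A j ϖ m := by
  apply Submodule.span_mono
  rintro _ ⟨b, l, hl, rfl⟩
  exact ⟨b, l, h.trans hl, rfl⟩

lemma pow_comm (H : CycData j ϖ τ π n red redA θ) (i : ℕ) (b : B) :
    ϖ ^ i * j b = j ((τ ^ i) b) * ϖ ^ i := by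
  induction i generalizing b with
  | zero => simp
  | succ i ih => rw [pow_succ, mul_assoc, H.comm, ← mul_assoc, ih, mul_assoc, pow_succ τ]; rfl

lemma mono_mul (H : CycData j ϖ τ π n red redA θ) (a b : B) (i l : ℕ) :
    (j a * ϖ ^ i) * (j b * ϖ ^ l) = j (a * (τ ^ i) b) * ϖ ^ (i + l) := by
  rw [mul_assoc, ← mul_assoc (ϖ ^ i), H.pow_comm, map_mul, pow_add]
  simp only [mul_assoc]

lemma smul_mul' (H : CycData j ϖ τ π n red redA θ) (a : A) (x y : D) : (a • x) * y = a • (x * y) := by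
  rw [H.smul, H.smul, mul_assoc]

lemma mul_smul' (H : CycData j ϖ τ π n red redA θ) (a : A) (x y : D) : x * (a • y) = a • (x * y) := by
  rw [H.smul, H.smul, ← mul_assoc, H.central, mul_assoc]

lemma mul_mem (H : CycData j ϖ τ π n red redA θ) {i l : ℕ} {x y : D}
    (hx : x ∈ Dl A j ϖ i) (hy : y ∈ Dl A j ϖ l) : x * y ∈ Dl A j ϖ (i + l) := by
  induction hx using Submodule.span_induction with
  | zero => rw [zero_mul]; exact zero_mem _
  | add x x' _ _ hx hx' => rw [add_mul]; exact add_mem hx hx'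
  | smul a x _ hx => rw [H.smul_mul']; exact Submodule.smul_mem _ _ hx
  | mem x hx =>
    obtain ⟨a, r, hr, rfl⟩ := hx
    induction hy using Submodule.span_induction with
    | zero => rw [mul_zero]; exact zero_mem _
    | add x x' _ _ hx hx' => rw [mul_add]; exact add_mem hx hx'
    | smul a x _ hx => rw [H.mul_smul']; exact Submodule.smul_mem _ _ hx
    | mem y hy =>
      obtain ⟨b, s, hs, rfl⟩ := hy
      rw [H.mono_mul]
      exact mono_mem _ (by omega)

lemma exists_lead_b {m : ℕ} {x : D} (hx : x ∈ Dl A j ϖ m) (H : CycData j ϖ τ π n red redA θ) :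
    ∃ b, x - j b * ϖ ^ m ∈ Dl A j ϖ (m + 1) := by
  induction hx using Submodule.span_induction with
  | zero => exact ⟨0, by simp⟩
  | add x x' _ _ hx hx' =>
    obtain ⟨b, hb⟩ := hx
    obtain ⟨b', hb'⟩ := hx'
    refine ⟨b + b', ?_⟩
    have := add_mem hb hb'
    convert this using 1
    rw [map_add, add_mul]; abel
  | smul a x _ hx =>
    obtain ⟨b, hb⟩ := hx
    refine ⟨algebraMap A B a * b, ?_⟩
    have := Submodule.smul_mem _ a hb
    rw [smul_sub, H.smul a (j b * _), ← mul_assoc, ← map_mul] at this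
    exact this
  | mem x hx =>
    obtain ⟨b, i, hi, rfl⟩ := hx
    rcases hi.eq_or_lt with rfl | hi
    · exact ⟨b, by simp⟩
    · exact ⟨0, by simpa using mono_mem b hi⟩

lemma exists_lead {m : ℕ} {x : D} (hx : x ∈ Dl A j ϖ m) (H : CycData j ϖ τ π n red redA θ) :
    ∃ e, Lead A j ϖ red m x e := by
  obtain ⟨b, hb⟩ := exists_lead_b hx H
  exact ⟨_, b, rfl, hb⟩

lemma lead_mem {m : ℕ} {x : D} {e : E} (h : Lead A j ϖ red m x e) : x ∈ Dl A j ϖ m := by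
  obtain ⟨b, -, hb⟩ := h
  have := add_mem (anti (Nat.le_succ m) hb) (mono_mem (A := A) (j := j) (ϖ := ϖ) b (le_refl m))
  simpa using this

lemma lead_add {m : ℕ} {x y : D} {e g : E} (h : Lead A j ϖ red m x e) (h' : Lead A j ϖ red m y g) :
    Lead A j ϖ red m (x + y) (e + g) := by
  obtain ⟨b, rfl, hb⟩ := h
  obtain ⟨c, rfl, hc⟩ := h'
  refine ⟨b + c, map_add _ _ _, ?_⟩
  convert add_mem hb hc using 1
  rw [map_add, add_mul]; abel

lemma lead_sub {m : ℕ} {x y : D} {e g : E} (h : Lead A j ϖ red m x e) (h' : Lead A j ϖ red m y g) :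
    Lead A j ϖ red m (x - y) (e - g) := by
  obtain ⟨b, rfl, hb⟩ := h
  obtain ⟨c, rfl, hc⟩ := h'
  refine ⟨b - c, map_sub _ _ _, ?_⟩
  convert sub_mem hb hc using 1
  rw [map_sub, sub_mul]; abel

lemma lead_smul (H : CycData j ϖ τ π n red redA θ) {m : ℕ} {x : D} {e : E} (a : A)
    (h : Lead A j ϖ red m x e) : Lead A j ϖ red m (a • x) (redA a • e) := by
  obtain ⟨b, rfl, hb⟩ := h
  refine ⟨algebraMap A B a * b, by rw [map_mul, H.redalg, Algebra.smul_def], ?_⟩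
  have := Submodule.smul_mem _ a hb
  rw [smul_sub, H.smul a (j b * _), ← mul_assoc, ← map_mul] at this
  exact this

lemma lead_zero_of_mem {m : ℕ} {x : D} (h : x ∈ Dl A j ϖ (m + 1)) : Lead A j ϖ red m x 0 :=
  ⟨0, map_zero _, by simpa using h⟩

lemma pi_mono (H : CycData j ϖ τ π n red redA θ) (c : B) (m : ℕ) :
    j (algebraMap A B π * c) * ϖ ^ m = j c * ϖ ^ (m + n) := by
  rw [mul_comm (algebraMap A B π), map_mul, ← H.pow, mul_assoc, ← pow_add, add_comm n]

lemma lead_zero (H : CycData j ϖ τ π n red redA θ) {m : ℕ} {x : D}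
    (h : Lead A j ϖ red m x 0) : x ∈ Dl A j ϖ (m + 1) := by
  obtain ⟨b, hb0, hb⟩ := h
  obtain ⟨c, rfl⟩ := H.redker b hb0
  have h3 := H.npos
  rw [H.pi_mono] at hb
  have := add_mem hb (mono_mem (A := A) (j := j) (ϖ := ϖ) c (show m + 1 ≤ m + n by omega))
  simpa using this

lemma redtau_pow (H : CycData j ϖ τ π n red redA θ) (i : ℕ) (b : B) :
    red ((τ ^ i) b) = (θ ^ i) (red b) := by
  induction i generalizing b with
  | zero => simp
  | succ i ih => rw [pow_succ, pow_succ, AlgEquiv.mul_apply, AlgEquiv.mul_apply, ih, H.redtau]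

lemma lead_mul (H : CycData j ϖ τ π n red redA θ) {i l : ℕ} {x y : D} {e g : E}
    (h : Lead A j ϖ red i x e) (h' : Lead A j ϖ red l y g) :
    Lead A j ϖ red (i + l) (x * y) (e * (θ ^ i) g) := by
  have hy := lead_mem h'
  obtain ⟨a, rfl, ha⟩ := h
  obtain ⟨b, rfl, hb⟩ := h'
  refine ⟨a * (τ ^ i) b, by rw [map_mul, H.redtau_pow], ?_⟩
  rw [← H.mono_mul]
  have h1 := H.mul_mem ha hy
  have h2 := H.mul_mem (mono_mem (A := A) (j := j) (ϖ := ϖ) a (le_refl i)) hb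
  rw [show i + 1 + l = i + l + 1 by omega] at h1
  rw [show i + (l + 1) = i + l + 1 by omega] at h2
  convert add_mem h1 h2 using 1
  simp only [sub_mul, mul_sub]
  abel

lemma lead_bracket (H : CycData j ϖ τ π n red redA θ) {i l : ℕ} {x y : D} {e g : E}
    (h : Lead A j ϖ red i x e) (h' : Lead A j ϖ red l y g) :
    Lead A j ϖ red (i + l) (x * y - y * x) (e * (θ ^ i) g - g * (θ ^ l) e) := by
  have h1 := H.lead_mul h' h
  rw [add_comm l i] at h1
  exact lead_sub (H.lead_mul h h') h1

lemma pi_smul (H : CycData j ϖ τ π n red redA θ) (x : D) : π • x = x * ϖ ^ n := by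
  rw [H.smul, H.pow, H.central]

lemma exists_pi_smul (H : CycData j ϖ τ π n red redA θ) {m : ℕ} {x : D}
    (hx : x ∈ Dl A j ϖ (m + n)) : ∃ y ∈ Dl A j ϖ m, x = π • y := by
  induction hx using Submodule.span_induction with
  | zero => exact ⟨0, zero_mem _, by simp⟩
  | add x x' _ _ hx hx' =>
    obtain ⟨y, hy, rfl⟩ := hx
    obtain ⟨y', hy', rfl⟩ := hx'
    exact ⟨y + y', add_mem hy hy', by rw [smul_add]⟩
  | smul a x _ hx =>
    obtain ⟨y, hy, rfl⟩ := hx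
    exact ⟨a • y, Submodule.smul_mem _ _ hy, smul_comm _ _ _⟩
  | mem x hx =>
    obtain ⟨b, i, hi, rfl⟩ := hx
    refine ⟨j b * ϖ ^ (i - n), mono_mem b (by omega), ?_⟩
    rw [H.pi_smul, mul_assoc, ← pow_add, Nat.sub_add_cancel (by omega)]

/-- The graded piece of `M` in degree `m`. -/
def gr (A : Type*) {B D E : Type*} [CommRing A] [CommRing B] [Ring D] [Module A D] [Field E]
    (j : B →+* D) (ϖ : D) (red : B →+* E) (M : AddSubgroup D) (m : ℕ) : AddSubgroup E where
  carrier := {e | ∃ x ∈ M, Lead A j ϖ red m x e}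
  zero_mem' := ⟨0, zero_mem _, 0, map_zero _, by simp⟩
  add_mem' := by
    rintro e g ⟨x, hx, b, rfl, hb⟩ ⟨y, hy, c, rfl, hc⟩
    refine ⟨x + y, add_mem hx hy, b + c, map_add _ _ _, ?_⟩
    convert add_mem hb hc using 1
    rw [map_add, add_mul]; abel
  neg_mem' := by
    rintro e ⟨x, hx, b, rfl, hb⟩
    refine ⟨-x, neg_mem hx, -b, map_neg _ _, ?_⟩
    convert neg_mem hb using 1
    rw [map_neg, neg_mul]; abel

/-- `M` plus the part of `L` in degrees at least `m`. -/
def stepN (A : Type*) {B D : Type*} [CommRing A] [CommRing B] [Ring D] [Module A D]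
    (j : B →+* D) (ϖ : D) (M L : AddSubgroup D) (m : ℕ) : AddSubgroup D :=
  M ⊔ (L ⊓ (Dl A j ϖ m).toAddSubgroup)

lemma stepN_anti (M L : AddSubgroup D) {i l : ℕ} (h : i ≤ l) :
    stepN A j ϖ M L l ≤ stepN A j ϖ M L i :=
  sup_le_sup le_rfl (inf_le_inf le_rfl (fun _ hx => anti h hx))

lemma card_step (H : CycData j ϖ τ π n red redA θ) [Finite E] (M L : AddSubgroup D) (m : ℕ)
    (G : AddSubgroup E) (hG : G ≤ gr A j ϖ red L m)
    (hfin : (stepN A j ϖ M L (m + 1)).relIndex (stepN A j ϖ M L m) ≠ 0) :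
    Nat.card G ≤ (stepN A j ϖ M L (m + 1)).relIndex (stepN A j ϖ M L m) *
      Nat.card (gr A j ϖ red M m ⊓ G : AddSubgroup E) := by
  have hG' : ∀ e : G, ∃ x ∈ L, Lead A j ϖ red m x e := fun e => hG e.2
  choose s hsL hs using hG'
  set N := stepN A j ϖ M L (m + 1) with hN
  let φ : G →+ D ⧸ N := AddMonoidHom.mk' (fun e => QuotientAddGroup.mk' N (s e)) (by
    intro a b
    rw [← map_add]
    rw [QuotientAddGroup.mk'_eq_mk']
    refine ⟨(s a + s b) - s (a + b), ?_, by abel⟩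
    apply AddSubgroup.mem_sup_right
    refine AddSubgroup.mem_inf.2 ⟨L.sub_mem (L.add_mem (hsL a) (hsL b)) (hsL _), ?_⟩
    apply H.lead_zero
    have := lead_sub (lead_add (hs a) (hs b)) (hs (a + b))
    simpa using this)
  have h1 := natCard_map_ker_le φ ⊤
  have h2 := AddSubgroup.relIndex_ker (K := stepN A j ϖ M L m) (QuotientAddGroup.mk' N)
  rw [QuotientAddGroup.ker_mk'] at h2
  rw [h2] at hfin ⊢
  have : Finite ((stepN A j ϖ M L m).map (QuotientAddGroup.mk' N)) := Nat.finite_of_card_ne_zero hfin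
  rw [AddSubgroup.card_top] at h1
  refine h1.trans (Nat.mul_le_mul ?_ ?_)
  · refine Nat.card_le_card_of_injective (fun x => ⟨x.1, ?_⟩) (fun a b hab => ?_)
    · obtain ⟨e, -, he⟩ := x.2
      rw [← he]
      exact ⟨s e, AddSubgroup.mem_sup_right ⟨hsL e, lead_mem (hs e)⟩, rfl⟩
    · exact Subtype.ext (Subtype.mk.inj hab)
  · refine Nat.card_le_card_of_injective (fun x => ⟨x.1.1, ?_, x.1.2⟩) (fun a b hab => ?_)
    · have h3 : QuotientAddGroup.mk' N (s x.1) = 0 := x.2.2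
      rw [QuotientAddGroup.mk'_apply, QuotientAddGroup.eq_zero_iff] at h3
      obtain ⟨y, hy, z, hz, hyz⟩ := AddSubgroup.mem_sup.1 h3
      refine ⟨y, hy, ?_⟩
      have := lead_sub (hs x.1) (lead_zero_of_mem hz.2)
      rw [← hyz, sub_zero] at this
      simpa using this
    · exact Subtype.ext (Subtype.ext (Subtype.mk.inj hab))

lemma card_triple (H : CycData j ϖ τ π n red redA θ) [Finite E] (M L : AddSubgroup D) (hML : M ≤ L)
    (h0 : M.relIndex L ≠ 0) (G : ℕ → AddSubgroup E) (hG : ∀ m, G m ≤ gr A j ϖ red L m)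
    {a b c : ℕ} (hab : a < b) (hbc : b < c) :
    Nat.card (G a) * Nat.card (G b) * Nat.card (G c) ≤ M.relIndex L *
      (Nat.card (gr A j ϖ red M a ⊓ G a : AddSubgroup E) *
        Nat.card (gr A j ϖ red M b ⊓ G b : AddSubgroup E) *
        Nat.card (gr A j ϖ red M c ⊓ G c : AddSubgroup E)) := by
  have hle : ∀ i, M ≤ stepN A j ϖ M L i := fun i => le_sup_left
  have hleL : ∀ i, stepN A j ϖ M L i ≤ L := fun i => sup_le hML inf_le_left
  have hρL : ∀ i, M.relIndex (stepN A j ϖ M L i) * (stepN A j ϖ M L i).relIndex L = M.relIndex L :=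
    fun i => AddSubgroup.relIndex_mul_relIndex _ _ _ (hle i) (hleL i)
  have hρ0 : ∀ i, M.relIndex (stepN A j ϖ M L i) ≠ 0 := by
    intro i h
    apply h0
    rw [← hρL i, h, zero_mul]
  have hρle : ∀ i, M.relIndex (stepN A j ϖ M L i) ≤ M.relIndex L := fun i =>
    Nat.le_of_dvd (Nat.pos_of_ne_zero h0) ⟨_, (hρL i).symm⟩
  have hst : ∀ i l, i ≤ l → M.relIndex (stepN A j ϖ M L l) *
      (stepN A j ϖ M L l).relIndex (stepN A j ϖ M L i) = M.relIndex (stepN A j ϖ M L i) :=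
    fun i l h => AddSubgroup.relIndex_mul_relIndex _ _ _ (hle l) (stepN_anti M L h)
  have hmono : ∀ i l, i ≤ l → M.relIndex (stepN A j ϖ M L l) ≤ M.relIndex (stepN A j ϖ M L i) :=
    fun i l h => Nat.le_of_dvd (Nat.pos_of_ne_zero (hρ0 i)) ⟨_, (hst i l h).symm⟩
  have hr0 : ∀ i, (stepN A j ϖ M L (i + 1)).relIndex (stepN A j ϖ M L i) ≠ 0 := by
    intro i h
    apply hρ0 i
    rw [← hst i (i + 1) (by omega), h, mul_zero]
  have ha := H.card_step M L a (G a) (hG a) (hr0 a)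
  have hb := H.card_step M L b (G b) (hG b) (hr0 b)
  have hc := H.card_step M L c (G c) (hG c) (hr0 c)
  have ea := hst a (a + 1) (by omega)
  have eb := hst b (b + 1) (by omega)
  have ec := hst c (c + 1) (by omega)
  have mab := hmono (a + 1) b hab
  have mbc := hmono (b + 1) c hbc
  have m1 := Nat.pos_of_ne_zero (hρ0 (c + 1))
  have mL := hρle a
  set ra := (stepN A j ϖ M L (a + 1)).relIndex (stepN A j ϖ M L a)
  set rb := (stepN A j ϖ M L (b + 1)).relIndex (stepN A j ϖ M L b)
  set rc := (stepN A j ϖ M L (c + 1)).relIndex (stepN A j ϖ M L c)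
  have hr : ra * rb * rc ≤ M.relIndex L := by
    calc ra * rb * rc = (1 * rc) * rb * ra := by ring
      _ ≤ (M.relIndex (stepN A j ϖ M L (c + 1)) * rc) * rb * ra := by gcongr; exact m1
      _ = M.relIndex (stepN A j ϖ M L c) * rb * ra := by rw [ec]
      _ ≤ M.relIndex (stepN A j ϖ M L (b + 1)) * rb * ra := by gcongr
      _ = M.relIndex (stepN A j ϖ M L b) * ra := by rw [eb]
      _ ≤ M.relIndex (stepN A j ϖ M L (a + 1)) * ra := by gcongr
      _ = M.relIndex (stepN A j ϖ M L a) := ea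
      _ ≤ _ := mL
  calc _ ≤ (ra * Nat.card (gr A j ϖ red M a ⊓ G a : AddSubgroup E)) *
        (rb * Nat.card (gr A j ϖ red M b ⊓ G b : AddSubgroup E)) *
        (rc * Nat.card (gr A j ϖ red M c ⊓ G c : AddSubgroup E)) := by gcongr
    _ = (ra * rb * rc) * (Nat.card (gr A j ϖ red M a ⊓ G a : AddSubgroup E) *
        Nat.card (gr A j ϖ red M b ⊓ G b : AddSubgroup E) *
        Nat.card (gr A j ϖ red M c ⊓ G c : AddSubgroup E)) := by ring
    _ ≤ _ := by gcongr

lemma lead_pi (H : CycData j ϖ τ π n red redA θ) {m : ℕ} {x : D} {e : E}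
    (h : Lead A j ϖ red m x e) : Lead A j ϖ red (m + n) (π • x) e := by
  obtain ⟨b, rfl, hb⟩ := h
  refine ⟨b, rfl, ?_⟩
  have h1 := H.mul_mem hb (mono_mem (A := A) (j := j) (ϖ := ϖ) 1 (le_refl n))
  rw [map_one, one_mul, sub_mul, ← H.pi_smul, mul_assoc, ← pow_add] at h1
  rwa [show m + 1 + n = m + n + 1 by omega] at h1

/-- Expansions exist. -/
lemma exists_expansion (H : CycData j ϖ τ π n red redA θ) {x : D} (hx : x ∈ Dl A j ϖ 0) :
    ∃ a : Fin n → B, x = ∑ i : Fin n, j (a i) * ϖ ^ (i : ℕ) := by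
  have h3 := H.npos
  induction hx using Submodule.span_induction with
  | zero => exact ⟨0, by simp⟩
  | add x x' _ _ hx hx' =>
    obtain ⟨a, rfl⟩ := hx
    obtain ⟨a', rfl⟩ := hx'
    exact ⟨a + a', by simp [add_mul, Finset.sum_add_distrib]⟩
  | smul c x _ hx =>
    obtain ⟨a, rfl⟩ := hx
    refine ⟨fun i => algebraMap A B c * a i, ?_⟩
    rw [H.smul, Finset.mul_sum]
    simp only [map_mul, mul_assoc]
  | mem x hx =>
    obtain ⟨b, i, hi, rfl⟩ := hx
    clear hi
    induction i using Nat.strong_induction_on generalizing b with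
    | _ i ih =>
      by_cases hin : i < n
      · refine ⟨Pi.single ⟨i, hin⟩ b, ?_⟩
        rw [Fintype.sum_eq_single ⟨i, hin⟩]
        · simp
        · intro l hl
          simp [Pi.single_eq_of_ne hl]
      · obtain ⟨a, ha⟩ := ih (i - n) (by omega) (algebraMap A B π * b)
        refine ⟨a, ?_⟩
        rw [← ha, H.pi_mono, Nat.sub_add_cancel (by omega)]

end CycData

/-- The trace zero lattice. -/
structure TrData {C : Type*} [AddCommGroup C] {n : ℕ} [NeZero n] (j : B →+* D) (ϖ : D) (τ : B ≃ₐ[A] B) (π : A)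
    (red : B →+* E) (k : Type*) [Field k] [Algebra k E] (T : B →+ C) (L : Submodule A D) : Prop where
  memL : ∀ x, x ∈ L ↔ ∃ a : Fin n → B, T (a 0) = 0 ∧ x = ∑ i : Fin n, j (a i) * ϖ ^ (i : ℕ)
  uniq : ∀ a b : Fin n → B, ∑ i : Fin n, j (a i) * ϖ ^ (i : ℕ) = ∑ i : Fin n, j (b i) * ϖ ^ (i : ℕ) → a = b
  Ttau : ∀ b, T (τ b) = T b
  Tpi : ∀ b, T (algebraMap A B π * b) = 0 → T b = 0
  Tred : ∀ b, T b = 0 → Algebra.trace k E (red b) = 0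

namespace TrData
open CycData
variable {C : Type*} [AddCommGroup C] {n : ℕ} [NeZero n] {j : B →+* D} {ϖ : D} {τ : B ≃ₐ[A] B} {π : A}
    {red : B →+* E} {redA : A →+* k} {θ : E ≃ₐ[k] E} {T : B →+ C} {L : Submodule A D}

lemma le_Dl (HL : TrData (n := n) j ϖ τ π red k T L) : L ≤ Dl A j ϖ 0 := by
  intro x hx
  obtain ⟨a, -, rfl⟩ := (HL.memL x).1 hx
  exact Submodule.sum_mem _ fun i _ => mono_mem _ (Nat.zero_le _)

lemma mono_memL (HL : TrData (n := n) j ϖ τ π red k T L) (b : B) {m : ℕ} (hm : 1 ≤ m) (hmn : m < n) :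
    j b * ϖ ^ m ∈ L := by
  rw [HL.memL]
  refine ⟨Pi.single ⟨m, hmn⟩ b, ?_, ?_⟩
  · rw [Pi.single_eq_of_ne, map_zero]
    intro h
    have := congrArg Fin.val h
    simp at this
    omega
  · rw [Fintype.sum_eq_single ⟨m, hmn⟩]
    · simp
    · intro l hl
      simp [Pi.single_eq_of_ne hl]

lemma zero_memL (HL : TrData (n := n) j ϖ τ π red k T L) (b : B) (hb : T b = 0) : j b ∈ L := by
  rw [HL.memL]
  refine ⟨Pi.single 0 b, by simpa using hb, ?_⟩
  rw [Fintype.sum_eq_single 0]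
  · simp
  · intro l hl
    simp [Pi.single_eq_of_ne hl]

lemma lead_zeroL (HL : TrData (n := n) j ϖ τ π red k T L) {x : D} (hx : x ∈ L) :
    ∃ e, Algebra.trace k E e = 0 ∧ Lead A j ϖ red 0 x e := by
  obtain ⟨a, ha, rfl⟩ := (HL.memL x).1 hx
  refine ⟨_, HL.Tred _ ha, a 0, rfl, ?_⟩
  rw [← Finset.add_sum_erase _ _ (Finset.mem_univ (0 : Fin n)), Fin.val_zero, add_sub_cancel_left]
  refine Submodule.sum_mem _ fun i hi => mono_mem _ ?_
  have : i ≠ 0 := Finset.ne_of_mem_erase hi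
  have : (i : ℕ) ≠ 0 := fun h => this (Fin.ext (by simpa using h))
  omega

lemma of_pi_smul (HL : TrData (n := n) j ϖ τ π red k T L) (H : CycData j ϖ τ π n red redA θ)
    {x : D} (hx : x ∈ Dl A j ϖ 0) (h : π • x ∈ L) : x ∈ L := by
  obtain ⟨a, rfl⟩ := H.exists_expansion hx
  obtain ⟨b, hb, hb'⟩ := (HL.memL _).1 h
  rw [HL.memL]
  refine ⟨a, ?_, rfl⟩
  apply HL.Tpi
  have : (fun i => algebraMap A B π * a i) = b := by
    apply HL.uniq
    rw [← hb', H.smul, Finset.mul_sum]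
    simp only [map_mul, mul_assoc]
  rw [← this] at hb
  exact hb

lemma shift_memL (H : CycData j ϖ τ π n red redA θ) (q r : ℕ) (c : B) (h : j c * ϖ ^ r ∈ L) :
    j c * ϖ ^ (r + n * q) ∈ L := by
  induction q with
  | zero => simpa using h
  | succ q ih =>
    rw [show r + n * (q + 1) = r + n * q + n by ring, pow_add _ _ n, ← mul_assoc, ← H.pi_smul]
    exact Submodule.smul_mem _ _ ih

lemma lead_topL (HL : TrData (n := n) j ϖ τ π red k T L) (H : CycData j ϖ τ π n red redA θ) (q : ℕ)
    {x : D} (hx : x ∈ L) (hxm : x ∈ Dl A j ϖ (n * q)) :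
    ∃ e, Algebra.trace k E e = 0 ∧ Lead A j ϖ red (n * q) x e := by
  induction q generalizing x with
  | zero => exact HL.lead_zeroL hx
  | succ q ih =>
    obtain ⟨y, hy, rfl⟩ := H.exists_pi_smul (m := n * q) (by rwa [mul_add, mul_one] at hxm)
    obtain ⟨e, he, h⟩ := ih (HL.of_pi_smul H (anti (Nat.zero_le _) hy) hx) hy
    exact ⟨e, he, H.lead_pi h⟩

lemma exists_pi_pow (HL : TrData (n := n) j ϖ τ π red k T L) (H : CycData j ϖ τ π n red redA θ)
    (q : ℕ) {x : D} (hx : x ∈ L) (hxm : x ∈ Dl A j ϖ (n * q + 1)) :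
    ∃ y ∈ L ⊓ Dl A j ϖ 1, x = π ^ q • y := by
  induction q generalizing x with
  | zero => exact ⟨x, ⟨hx, by simpa using hxm⟩, by simp⟩
  | succ q ih =>
    obtain ⟨y, hy, rfl⟩ := H.exists_pi_smul (m := n * q + 1)
      (by rwa [show n * (q + 1) + 1 = n * q + 1 + n by ring] at hxm)
    obtain ⟨z, hz, rfl⟩ := ih (HL.of_pi_smul H (anti (Nat.zero_le _) hy) hx) hy
    exact ⟨z, hz, by rw [pow_succ', mul_smul]⟩

lemma mono_bracket (HL : TrData (n := n) j ϖ τ π red k T L) (H : CycData j ϖ τ π n red redA θ)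
    (a b : B) (i l : ℕ) : (j a * ϖ ^ i) * (j b * ϖ ^ l) - (j b * ϖ ^ l) * (j a * ϖ ^ i) ∈ L := by
  have h3 := H.npos
  have hred : ∀ (q r : ℕ) (c : B), j c * ϖ ^ r ∈ L → j c * ϖ ^ (r + n * q) ∈ L := by
    intro q
    induction q with
    | zero => intro r c h; simpa using h
    | succ q ih =>
      intro r c h
      rw [show r + n * (q + 1) = r + n * q + n by ring, pow_add _ _ n, ← mul_assoc, ← H.pi_smul]
      exact Submodule.smul_mem _ _ (ih r c h)
  rw [H.mono_mul, H.mono_mul, add_comm l i, ← sub_mul, ← map_sub]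
  set c := a * (τ ^ i) b - b * (τ ^ l) a with hc
  rw [← Nat.mod_add_div (i + l) n]
  apply hred
  by_cases hr : (i + l) % n = 0
  · rw [hr, pow_zero, mul_one]
    apply HL.zero_memL
    have hpowtau : ∀ (s : ℕ) (x : B), T ((τ ^ s) x) = T x := by
      intro s
      induction s with
      | zero => intro x; rfl
      | succ s ih => intro x; rw [pow_succ, AlgEquiv.mul_apply, ih, HL.Ttau]
    have h1 : (τ ^ l) (a * (τ ^ i) b) = b * (τ ^ l) a := by
      rw [map_mul, ← AlgEquiv.mul_apply, ← pow_add, add_comm l i, ← Nat.mod_add_div (i + l) n, hr,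
        zero_add, pow_mul, H.taun, one_pow, AlgEquiv.one_apply, mul_comm]
    rw [hc, ← h1, map_sub, hpowtau, sub_self]
  · exact HL.mono_memL c (by omega) (Nat.mod_lt _ (by omega))

lemma bracket_memL (HL : TrData (n := n) j ϖ τ π red k T L) (H : CycData j ϖ τ π n red redA θ)
    {x y : D} (hx : x ∈ Dl A j ϖ 0) (hy : y ∈ Dl A j ϖ 0) : x * y - y * x ∈ L := by
  induction hx using Submodule.span_induction with
  | zero => simp
  | add x x' _ _ hx hx' => convert add_mem hx hx' using 1; rw [add_mul, mul_add]; abel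
  | smul a x _ hx =>
    rw [H.smul_mul', H.mul_smul', ← smul_sub]; exact Submodule.smul_mem _ _ hx
  | mem x hx =>
    obtain ⟨a, r, hr, rfl⟩ := hx
    induction hy using Submodule.span_induction with
    | zero => simp
    | add x x' _ _ hx hx' => convert add_mem hx hx' using 1; rw [add_mul, mul_add]; abel
    | smul a x _ hx =>
      rw [H.smul_mul', H.mul_smul', ← smul_sub]; exact Submodule.smul_mem _ _ hx
    | mem y hy =>
      obtain ⟨b, s, hs, rfl⟩ := hy
      exact HL.mono_bracket H a b r s

lemma bracket_memDl (HL : TrData (n := n) j ϖ τ π red k T L) (H : CycData j ϖ τ π n red redA θ)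
    {x y : D} (hx : x ∈ L) (hy : y ∈ L) : x * y - y * x ∈ Dl A j ϖ 1 := by
  obtain ⟨e, -, he⟩ := HL.lead_zeroL hx
  obtain ⟨g, -, hg⟩ := HL.lead_zeroL hy
  have := H.lead_bracket he hg
  simp only [pow_zero, AlgEquiv.one_apply, mul_comm g e, sub_self, add_zero] at this
  exact H.lead_zero this

lemma fgL (HL : TrData (n := n) j ϖ τ π red k T L) (H : CycData j ϖ τ π n red redA θ)
    [IsNoetherianRing A] [Module.Finite A B] (N : Submodule A D) (hN : N ≤ L) : N.FG := by
  let lin : (Fin n → B) →ₗ[A] D :=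
    { toFun := fun a => ∑ i : Fin n, j (a i) * ϖ ^ (i : ℕ)
      map_add' := fun a b => by simp [add_mul, Finset.sum_add_distrib]
      map_smul' := fun c a => by
        simp only [Pi.smul_apply, Algebra.smul_def, map_mul, RingHom.id_apply]
        rw [H.smul, Finset.mul_sum]
        simp only [mul_assoc] }
  have h1 : N ≤ LinearMap.range lin := by
    intro x hx
    obtain ⟨a, -, rfl⟩ := (HL.memL x).1 (hN hx)
    exact ⟨a, rfl⟩
  have : IsNoetherian A (LinearMap.range lin) := inferInstance
  have h2 := isNoetherian_of_le h1
  exact Module.Finite.iff_fg.1 inferInstance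
end TrData


open CycData in
theorem core {C : Type*} [AddCommGroup C] {n : ℕ} [NeZero n] {j : B →+* D} {ϖ : D} {τ : B ≃ₐ[A] B} {π : A}
    {red : B →+* E} {redA : A →+* k} {θ : E ≃ₐ[k] E} {T : B →+ C} {L : Submodule A D}
    [FiniteDimensional k E] [IsGalois k E] [IsNoetherianRing A] [Module.Finite A B] [Finite E]
    {R : Type*} [CommRing R] [Algebra R A] [Module R D] [IsScalarTower R A D]
    [IsNoetherianRing R] [Module.Finite R A]
    (H : CycData j ϖ τ π n red redA θ) (HL : TrData (n := n) j ϖ τ π red k T L)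
    (hθ : ∀ σ : E ≃ₐ[k] E, σ ∈ Subgroup.zpowers θ) (hn : Module.finrank k E = n)
    (h33 : n = 3 → (3 : k) ≠ 0)
    (p0 : R) (e0 : ℕ) (u : Aˣ) (hp0 : algebraMap R A p0 = u * π ^ e0)
    (hjac : p0 ∈ Ideal.jacobson (⊥ : Ideal R))
    (M : AddSubgroup D) (hML : M ≤ L.toAddSubgroup)
    (hidx : M.relIndex L.toAddSubgroup = Nat.card k) :
    Submodule.span R {z : D | ∃ x ∈ M, ∃ y ∈ M, z = x * y - y * x} =
      Submodule.span R {z : D | ∃ x ∈ L, ∃ y ∈ L, z = x * y - y * x} := by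
  have h3 := H.npos
  have hfk : Finite k := Finite.of_injective _ (algebraMap k E).injective
  have hq : 1 < Nat.card k := Finite.one_lt_card
  obtain ⟨p, hchar⟩ := CharP.exists E
  have hpp : Fact p.Prime := ⟨(CharP.char_is_prime_or_zero E p).resolve_right
    (CharP.char_ne_zero_of_finite E p)⟩
  letI : Algebra (ZMod p) E := ZMod.algebra E p
  apply le_antisymm
  · apply Submodule.span_mono
    rintro _ ⟨x, hx, y, hy, rfl⟩
    exact ⟨x, hML hx, y, hML hy, rfl⟩
  -- graded pieces of `L`
  let G : ℕ → AddSubgroup E := fun m =>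
    if m = 0 then (LinearMap.ker (Algebra.trace k E)).toAddSubgroup else
      if m % n = 0 then ⊥ else ⊤
  have hG : ∀ m, G m ≤ gr A j ϖ red L.toAddSubgroup m := by
    intro m e he
    simp only [G] at he
    split_ifs at he with h0 hmod
    · subst h0
      obtain ⟨y, rfl⟩ := hilbert90_add θ hθ e he
      obtain ⟨c, rfl⟩ := H.redsurj y
      refine ⟨j (c - τ c), HL.zero_memL _ (by rw [map_sub, HL.Ttau, sub_self]), c - τ c, ?_, ?_⟩
      · rw [map_sub, H.redtau]
      · simp
    · rw [AddSubgroup.mem_bot] at he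
      rw [he]
      exact zero_mem _
    · obtain ⟨c, rfl⟩ := H.redsurj e
      refine ⟨j c * ϖ ^ m, ?_, c, rfl, by simp⟩
      have := TrData.shift_memL (L := L) H (m / n) (m % n) c
        (HL.mono_memL c (by omega) (Nat.mod_lt _ (by omega)))
      rwa [Nat.mod_add_div] at this
  have hG0 : G 0 = (LinearMap.ker (Algebra.trace k E)).toAddSubgroup := by simp [G]
  have hGm : ∀ m, m % n ≠ 0 → G m = ⊤ := by
    intro m hm
    have : m ≠ 0 := by rintro rfl; simp at hm
    simp [G, hm, this]
  have hc0 : Nat.card (G 0) = Nat.card k ^ (n - 1) := by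
    rw [hG0]
    have h1 := finrank_kerTrace (k := k) (E := E)
    have h2 : Nat.card (LinearMap.ker (Algebra.trace k E)) = _ :=
      Module.natCard_eq_pow_finrank (K := k)
    rw [show n - 1 = Module.finrank k (LinearMap.ker (Algebra.trace k E)) by omega]
    exact h2
  have hcE : Nat.card E = Nat.card k ^ n := by
    rw [Module.natCard_eq_pow_finrank (K := k) (V := E), hn]
  have hcm : ∀ m, m % n ≠ 0 → Nat.card (G m) = Nat.card k ^ n := by
    intro m hm
    rw [hGm m hm, AddSubgroup.card_top, hcE]
  let U : ℕ → AddSubgroup E := fun m => gr A j ϖ red M m ⊓ G m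
  have hUG : ∀ m, Nat.card (U m) ≤ Nat.card (G m) := fun m =>
    AddSubgroup.card_le_of_le inf_le_right
  have hUpos : ∀ m, 0 < Nat.card (U m) := fun m => Nat.card_pos
  have htri : ∀ a b c, a < b → b < c → Nat.card (G a) * Nat.card (G b) * Nat.card (G c) ≤
      Nat.card k * (Nat.card (U a) * Nat.card (U b) * Nat.card (U c)) := by
    intro a b c hab hbc
    rw [← hidx]
    exact H.card_triple M L.toAddSubgroup hML (by rw [hidx]; omega) G hG hab hbc
  have hpair : ∀ a b, a < b → Nat.card (G a) * Nat.card (G b) ≤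
      Nat.card k * (Nat.card (U a) * Nat.card (U b)) := by
    intro a b hab
    have h1 := htri a b (b + 1) hab (by omega)
    have h2 := hUG (b + 1)
    have h4 : 0 < Nat.card (G (b + 1)) := Nat.card_pos
    refine Nat.le_of_mul_le_mul_right (h1.trans ?_) h4
    rw [← mul_assoc (Nat.card k)]
    exact Nat.mul_le_mul_left _ h2
  set P := Submodule.span R {z : D | ∃ x ∈ M, ∃ y ∈ M, z = x * y - y * x} with hP
  have hbr : ∀ i l, ∀ a ∈ U i, ∀ b ∈ U l,
      a * (θ ^ i) b - b * (θ ^ l) a ∈ gr A j ϖ red P.toAddSubgroup (i + l) := by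
    rintro i l a ⟨⟨x, hx, hxa⟩, -⟩ b ⟨⟨y, hy, hyb⟩, -⟩
    exact ⟨_, Submodule.subset_span ⟨x, hx, y, hy, rfl⟩, H.lead_bracket hxa hyb⟩
  let LR : ℕ → Submodule R D := fun m => (L ⊓ Dl A j ϖ m).restrictScalars R
  have hPL : ∀ x ∈ P, x ∈ L := by
    have : P ≤ L.restrictScalars R := by
      rw [hP, Submodule.span_le]
      rintro _ ⟨x, hx, y, hy, rfl⟩
      exact HL.bracket_memL H (HL.le_Dl (hML hx)) (HL.le_Dl (hML hy))
    exact fun x hx => this hx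
  have hθn : θ ^ n = 1 := by rw [← hn, ← orderOf_gen θ hθ, pow_orderOf_eq_one]
  have hθmod : ∀ m, θ ^ m = θ ^ (m % n) := by
    intro m
    conv_lhs => rw [← Nat.mod_add_div m n, pow_add, pow_mul, hθn, one_pow, mul_one]
  have hmid : ∀ m, m % n ≠ 0 → gr A j ϖ red P.toAddSubgroup m = ⊤ := by
    intro m hm
    have hm0 : 0 < m := Nat.pos_of_ne_zero (by rintro rfl; simp at hm)
    have hcard : Nat.card k ^ (2 * n - 1) ≤ Nat.card k * (Nat.card (U 0) * Nat.card (U m)) := by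
      have := hpair 0 m hm0
      rwa [hc0, hcm m hm, ← pow_add, show n - 1 + n = 2 * n - 1 by omega] at this
    have hU0 : ∀ u ∈ U 0, Algebra.trace k E u = 0 := by
      rintro u ⟨-, hu⟩
      rw [hG0] at hu
      exact hu
    rcases add_mid_deg p θ hθ hn h3 h33 (m := m % n) (by omega) (Nat.mod_lt _ (by omega))
      (U 0) (U m) (gr A j ϖ red P.toAddSubgroup m) hU0 hcard (by
        intro a ha b hb
        have := hbr 0 m a ha b hb
        rw [zero_add, pow_zero, AlgEquiv.one_apply, hθmod] at this
        rw [cmap_apply, sub_mul, mul_comm _ b, mul_comm _ b]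
        rwa [mul_comm a b] at this) with h | ⟨h4, h2, hle⟩
    · exact h
    · have hfull : ∀ b, 0 < b → b < m → b % n ≠ 0 → gr A j ϖ red M b = ⊤ := by
        intro b hb0 hbm hbn
        have h1 := htri 0 b m hb0 hbm
        rw [hc0, hcm m hm, hcm b hbn] at h1
        have h5 : Nat.card k ^ (2 * n - 1) * Nat.card k ^ n ≤
            Nat.card k ^ (2 * n - 1) * Nat.card (U b) := by
          calc _ = Nat.card k ^ (n - 1) * Nat.card k ^ n * Nat.card k ^ n := by
                rw [← pow_add _ (n - 1), show n - 1 + n = 2 * n - 1 by omega]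
            _ ≤ _ := h1
            _ = Nat.card k * (Nat.card (U 0) * Nat.card (U m)) * Nat.card (U b) := by ring
            _ ≤ _ := Nat.mul_le_mul_right _ hle
        have h6 := Nat.le_of_mul_le_mul_left h5 (Nat.pow_pos (by omega))
        rw [← hcE] at h6
        have h7 : U b = ⊤ := AddSubgroup.eq_top_of_le_card _ h6
        rw [eq_top_iff, ← h7]
        exact inf_le_left
      have hf1 : gr A j ϖ red M 1 = ⊤ := hfull 1 one_pos
        (by have := Nat.mod_le m n; omega) (by rw [Nat.mod_eq_of_lt (by omega)]; omega)
      have hm1 : (m - 1) % n = 1 := by subst h4; omega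
      have hf2 : gr A j ϖ red M (m - 1) = ⊤ := hfull (m - 1)
        (by have := Nat.mod_le m n; omega) (by omega) (by rw [hm1]; omega)
      refine add_deg_two p θ ?_ _ ?_
      · intro h
        have := orderOf_dvd_of_pow_eq_one h
        rw [orderOf_gen θ hθ, hn] at this
        have := Nat.le_of_dvd (by omega) this
        omega
      · intro a b
        have := hbr 1 (m - 1) a (by
          refine ⟨by rw [hf1]; trivial, ?_⟩
          rw [hGm 1 (by rw [Nat.mod_eq_of_lt (by omega)]; omega)]; trivial) b (by
          refine ⟨by rw [hf2]; trivial, ?_⟩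
          rw [hGm (m - 1) (by rw [hm1]; omega)]; trivial)
        rwa [hθmod (m - 1), hm1, pow_one, show 1 + (m - 1) = m by omega] at this
  have htop : ∀ q, 0 < q → ∀ x, Algebra.trace k E x = 0 →
      x ∈ gr A j ϖ red P.toAddSubgroup (n * q) := by
    intro q hq0
    have hnq : n ≤ n * q := Nat.le_mul_of_pos_right n hq0
    have hmod1 : 1 % n ≠ 0 := by rw [Nat.mod_eq_of_lt (by omega)]; omega
    have hmod2 : (n * q - 1) % n ≠ 0 := by
      intro h
      have h1 : n ∣ n * q - 1 := Nat.dvd_of_mod_eq_zero h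
      have h2 : n ∣ 1 := by
        have := (Nat.dvd_sub (dvd_mul_right n q) h1)
        rwa [Nat.sub_sub_self (by omega)] at this
      have := Nat.le_of_dvd one_pos h2
      omega
    refine add_top_deg p θ hθ hn h3 (n * q - 1) ?_ (U 1) (U (n * q - 1)) _ ?_ ?_
    · rw [← pow_succ, Nat.sub_add_cancel (by omega), pow_mul, hθn, one_pow]
    · have := hpair 1 (n * q - 1) (by omega)
      rwa [hcm 1 hmod1, hcm _ hmod2, ← pow_add, ← two_mul] at this
    · intro a ha b hb
      have := hbr 1 (n * q - 1) a ha b hb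
      rwa [pow_one, show 1 + (n * q - 1) = n * q by omega] at this
  have hstep : ∀ m, 1 ≤ m → LR m ≤ P ⊔ LR (m + 1) := by
    rintro m hm z ⟨hzL, hz⟩
    obtain ⟨e, he, hze⟩ : ∃ e, e ∈ gr A j ϖ red P.toAddSubgroup m ∧ Lead A j ϖ red m z e := by
      by_cases hmn : m % n = 0
      · obtain ⟨q, rfl⟩ := Nat.dvd_of_mod_eq_zero hmn
        obtain ⟨e, he, h⟩ := HL.lead_topL H q hzL hz
        exact ⟨e, htop q (Nat.pos_of_ne_zero (by rintro rfl; simp at hm)) e he, h⟩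
      · obtain ⟨e, he⟩ := exists_lead hz H
        exact ⟨e, by rw [hmid m hmn]; trivial, he⟩
    obtain ⟨w, hw, hwe⟩ := he
    rw [Submodule.mem_sup]
    refine ⟨w, hw, z - w, ⟨sub_mem hzL (hPL w hw), ?_⟩, add_sub_cancel _ _⟩
    apply H.lead_zero
    simpa using lead_sub hze hwe
  have hchain : ∀ m, LR 1 ≤ P ⊔ LR (m + 1) := by
    intro m
    induction m with
    | zero => exact le_sup_right
    | succ m ih => exact ih.trans (sup_le le_sup_left (hstep (m + 1) (by omega)))
  have hfg : (LR 1).FG := by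
    have h1 : Module.Finite A (L ⊓ Dl A j ϖ 1 : Submodule A D) :=
      Module.Finite.iff_fg.2 (HL.fgL H _ inf_le_left)
    have h2 : Module.Finite R (L ⊓ Dl A j ϖ 1 : Submodule A D) := Module.Finite.trans A _
    exact Module.Finite.iff_fg.1 h2
  have hN : LR 1 ≤ P := by
    refine Submodule.le_of_le_smul_of_le_jacobson_bot (I := Ideal.span {p0}) hfg ?_ ?_
    · rwa [Ideal.span_singleton_le_iff_mem]
    · refine (hchain (n * e0)).trans (sup_le_sup le_rfl ?_)
      rintro z ⟨hzL, hz⟩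
      obtain ⟨y, hy, rfl⟩ := HL.exists_pi_pow H e0 hzL hz
      have h1 : π ^ e0 • y = p0 • ((↑u⁻¹ : A) • y) := by
        rw [← IsScalarTower.algebraMap_smul A p0, hp0, smul_smul, mul_comm (u : A), mul_assoc,
          Units.mul_inv, mul_one]
      rw [h1]
      exact Submodule.smul_mem_smul (Ideal.mem_span_singleton_self _)
        (Submodule.smul_mem (L ⊓ Dl A j ϖ 1) _ hy)
  rw [Submodule.span_le]
  rintro _ ⟨x, hx, y, hy, rfl⟩
  exact hN ⟨HL.bracket_memL H (HL.le_Dl hx) (HL.le_Dl hy), HL.bracket_memDl H hx hy⟩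
end Graded

section Mid
open IsLocalRing
open scoped Pointwise
attribute [local instance] Ideal.Quotient.field

theorem mid {A B K F D : Type} [CommRing A] [IsDomain A] [IsDiscreteValuationRing A]
    [CommRing B] [IsDomain B] [IsDiscreteValuationRing B] [Field K] [Field F]
    [Algebra A K] [IsFractionRing A K] [Algebra B F] [IsFractionRing B F] [Algebra A B] [Algebra K F]
    [Algebra A F] [IsScalarTower A B F] [IsScalarTower A K F] [IsIntegralClosure B A F]
    [Module.Finite A B] [FiniteDimensional K F] [IsGalois K F] [Finite (A ⧸ maximalIdeal A)]
    [Ring D] {R : Type} [CommRing R] [IsNoetherianRing R] [Algebra R A] [Module.Finite R A] [Module R D]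
    (n : ℕ) [NeZero n] (h3 : 3 ≤ n) (hn : Module.finrank K F = n)
    (π : A) (hπ : Irreducible π) (hπB : Irreducible (algebraMap A B π))
    (h33 : n = 3 → IsUnit (3 : A))
    (θ : F ≃ₐ[K] F) (hθ : ∀ σ : F ≃ₐ[K] F, σ ∈ Subgroup.zpowers θ)
    (j : B →+* D) (ϖ : D)
    (hpow : ϖ ^ n = j (algebraMap A B π))
    (hcomm : ∀ b : B, ϖ * j b = j (galRestrict A K F B θ b) * ϖ)
    (hRsmul : ∀ (r : R) (x : D), r • x = j (algebraMap A B (algebraMap R A r)) * x)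
    (p0 : R) (e0 : ℕ) (u : Aˣ) (hp0 : algebraMap R A p0 = u * π ^ e0)
    (hjac : p0 ∈ Ideal.jacobson (⊥ : Ideal R))
    (hcentral : ∀ (a : A) (x : D), x * j (algebraMap A B a) = j (algebraMap A B a) * x)
    (huniq : ∀ a b : Fin n → B,
      ∑ i : Fin n, j (a i) * ϖ ^ (i : ℕ) = ∑ i : Fin n, j (b i) * ϖ ^ (i : ℕ) → a = b)
    (L : AddSubgroup D)
    (hL : ∀ x, x ∈ L ↔ ∃ a : Fin n → B, Algebra.trace K F (algebraMap B F (a 0)) = 0 ∧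
      x = ∑ i : Fin n, j (a i) * ϖ ^ (i : ℕ))
    (M : AddSubgroup D) (hML : M ≤ L)
    (hidx : M.relIndex L = Nat.card (A ⧸ maximalIdeal A)) :
    Submodule.span R {z : D | ∃ x ∈ M, ∃ y ∈ M, z = x * y - y * x} =
      Submodule.span R {z : D | ∃ x ∈ L, ∃ y ∈ L, z = x * y - y * x} := by
  set τ : B ≃ₐ[A] B := galRestrict A K F B θ with hτ
  set P := maximalIdeal A with hP
  set Q : Ideal B := Ideal.map (algebraMap A B) P with hQ
  have hPs : P = Ideal.span {π} := hπ.maximalIdeal_eq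
  have hQs : Q = Ideal.span {algebraMap A B π} := by
    rw [hQ, hPs, Ideal.map_span, Set.image_singleton]
  have hQm : Q = maximalIdeal B := by rw [hQs, hπB.maximalIdeal_eq]
  have : Q.IsMaximal := by rw [hQm]; infer_instance
  have : FaithfulSMul A B := by
    rw [faithfulSMul_iff_algebraMap_injective]
    have h1 : Function.Injective (algebraMap A F) := by
      rw [IsScalarTower.algebraMap_eq A K F]
      exact (algebraMap K F).injective.comp (IsFractionRing.injective A K)
    rw [IsScalarTower.algebraMap_eq A B F] at h1
    exact Function.Injective.of_comp h1
  have hover : Q.LiesOver P := by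
    constructor
    refine (IsLocalRing.eq_maximalIdeal ?_).symm
    exact Ideal.isMaximal_comap_of_isIntegral_of_isMaximal Q
  have : Module.IsTorsionFree A B := inferInstance
  have : Module.Free A B := inferInstance
  have : IsGalois K F := inferInstance
  have hinv : Algebra.IsInvariant A B (B ≃ₐ[A] B) := Algebra.isInvariant_of_isGalois' A K F B
  have hfinG : Finite (B ≃ₐ[A] B) := Finite.of_equiv _ (galRestrict A K F B).toEquiv
  have hstab : ∀ g : B ≃ₐ[A] B, g ∈ MulAction.stabilizer (B ≃ₐ[A] B) Q := by
    intro g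
    rw [MulAction.mem_stabilizer_iff]
    change Ideal.map _ Q = Q
    rw [hQs, Ideal.map_span, Set.image_singleton]
    congr 2
    exact g.commutes π
  let st : (B ≃ₐ[A] B) → MulAction.stabilizer (B ≃ₐ[A] B) Q := fun g => ⟨g, hstab g⟩
  let θb : (B ⧸ Q) ≃ₐ[A ⧸ P] (B ⧸ Q) := Ideal.Quotient.stabilizerHom Q P (B ≃ₐ[A] B) (st τ)
  have hθb : ∀ σ : (B ⧸ Q) ≃ₐ[A ⧸ P] (B ⧸ Q), σ ∈ Subgroup.zpowers θb := by
    intro σ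
    obtain ⟨⟨g, hg⟩, rfl⟩ := Ideal.Quotient.stabilizerHom_surjective (B ≃ₐ[A] B) P Q σ
    obtain ⟨s, rfl⟩ := (galRestrict A K F B).surjective g
    obtain ⟨z, rfl⟩ := hθ s
    refine ⟨z, ?_⟩
    change (Ideal.Quotient.stabilizerHom Q P (B ≃ₐ[A] B) (st τ)) ^ z = _
    rw [← map_zpow]
    congr 1
    apply Subtype.ext
    simp [st, hτ]
  have hfinE : Module.Finite (A ⧸ P) (B ⧸ Q) := Module.Finite.of_restrictScalars_finite A _ _
  have hfE : Finite (B ⧸ Q) := Module.finite_of_finite (A ⧸ P)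
  have hgal : IsGalois (A ⧸ P) (B ⧸ Q) := inferInstance
  have hrank : Module.finrank (A ⧸ P) (B ⧸ Q) = n := by
    rw [IsLocalRing.finrank_quotient_map, ← hn]
    exact (IsFractionRing.finrank_eq A K B F).symm
  have htr : ∀ b : B, Algebra.trace K F (algebraMap B F b) = algebraMap A K (Algebra.trace A B b) := by
    intro b
    have := IsIntegralClosure.isLocalization A K F B
    exact Algebra.trace_localization A (nonZeroDivisors A) b
  let T : B →+ K := (Algebra.trace K F).toAddMonoidHom.comp (algebraMap B F).toAddMonoidHom
  have hTapp : ∀ b, T b = Algebra.trace K F (algebraMap B F b) := fun b => rfl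
  have hθn : θ ^ n = 1 := by rw [← hn, ← orderOf_gen θ hθ, pow_orderOf_eq_one]
  letI modAD : Module A D := Module.compHom D (j.comp (algebraMap A B))
  have hsmul : ∀ (a : A) (x : D), a • x = j (algebraMap A B a) * x := fun a x => rfl
  have htow : IsScalarTower R A D := ⟨fun r a x => by
    rw [hRsmul, hsmul, hsmul, Algebra.smul_def, map_mul, map_mul, mul_assoc]⟩
  let L' : Submodule A D :=
    { L with
      smul_mem' := by
        intro a x hx
        obtain ⟨c, hc, rfl⟩ := (hL x).1 hx
        refine (hL _).2 ⟨fun i => algebraMap A B a * c i, ?_, ?_⟩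
        · rw [map_mul, ← IsScalarTower.algebraMap_apply, IsScalarTower.algebraMap_apply A K F,
            ← Algebra.smul_def, map_smul, hc, smul_zero]
        · rw [hsmul, Finset.mul_sum]
          refine Finset.sum_congr rfl fun i _ => ?_
          rw [map_mul, mul_assoc] }
  have hL'L : L'.toAddSubgroup = L := rfl
  have H : CycData j ϖ τ π n (Ideal.Quotient.mk Q) (Ideal.Quotient.mk P) θb :=
    { comm := hcomm
      pow := hpow
      smul := hsmul
      central := hcentral
      npos := h3
      taun := by rw [hτ, ← map_pow, hθn, map_one]
      redsurj := Ideal.Quotient.mk_surjective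
      redAsurj := Ideal.Quotient.mk_surjective
      redker := by
        intro b hb
        rw [Ideal.Quotient.eq_zero_iff_mem, hQs, Ideal.mem_span_singleton] at hb
        exact hb
      redalg := fun a => rfl
      redtau := fun b => rfl }
  have HL : TrData (n := n) j ϖ τ π (Ideal.Quotient.mk Q) (A ⧸ P) T L' :=
    { memL := hL
      uniq := huniq
      Ttau := by
        intro b
        rw [hTapp, hTapp, hτ, algebraMap_galRestrict_apply, Algebra.trace_eq_of_algEquiv]
      Tpi := by
        intro b hb
        rw [hTapp, map_mul, ← IsScalarTower.algebraMap_apply, IsScalarTower.algebraMap_apply A K F,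
          ← Algebra.smul_def, map_smul, smul_eq_mul, mul_eq_zero] at hb
        rcases hb with h | h
        · exact absurd ((IsFractionRing.injective A K) (by rw [h, map_zero])) hπ.ne_zero
        · exact h
      Tred := by
        intro b hb
        rw [hTapp, htr] at hb
        have h0 : Algebra.trace A B b = 0 := IsFractionRing.injective A K (by rw [hb, map_zero])
        have := Algebra.trace_quotient_mk (R := A) (S := B) b
        rw [h0, map_zero] at this
        exact this }
  refine core H HL hθb hrank ?_ p0 e0 u hp0 hjac M hML hidx
  · intro h
    have := (h33 h).map (Ideal.Quotient.mk P)
    rw [map_ofNat] at this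
    exact this.ne_zero
end Mid

lemma relIndex_of_maximal {A D : Type*} [CommRing A] [IsLocalRing A] [AddCommGroup D] [Module A D]
    (L M : Submodule A D) (hMlt : M < L)
    (hMmax : ∀ M' : Submodule A D, M < M' → M' ≤ L → M' = L) :
    M.toAddSubgroup.relIndex L.toAddSubgroup = Nat.card (A ⧸ IsLocalRing.maximalIdeal A) := by
  let N : Submodule A L := M.comap L.subtype
  have hco : IsCoatom N := by
    constructor
    · intro h
      refine absurd hMlt (not_lt_of_ge fun x hx => ?_)
      have : (⟨x, hx⟩ : L) ∈ N := by rw [h]; trivial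
      exact this
    · intro N' hN'
      have hmap : N.map L.subtype = M := by
        rw [Submodule.map_comap_subtype]; exact inf_eq_right.2 hMlt.le
      have h1 : N'.map L.subtype = L := by
        refine hMmax _ ?_ (Submodule.map_subtype_le _ _)
        rw [← hmap]
        exact Submodule.map_strictMono_of_injective L.subtype_injective hN'
      rw [eq_top_iff]
      rintro ⟨x, hx⟩ -
      have hx' := hx
      rw [← h1] at hx'
      obtain ⟨y, hy, hyx⟩ := hx'
      have : y = ⟨x, hx⟩ := Subtype.ext hyx
      rwa [← this]
  have hs : IsSimpleModule A (L ⧸ N) := isSimpleModule_iff_isCoatom.2 hco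
  obtain ⟨I, hI, ⟨e⟩⟩ := isSimpleModule_iff_quot_maximal.1 hs
  obtain rfl := IsLocalRing.eq_maximalIdeal hI
  rw [← Nat.card_congr e.toEquiv]
  rfl



/-- With `K, F, D, Δ` as in Statement 0 (cyclic division algebra of index `n`
over the `p`-adic field `K`, with `𝒪_K = integralClosure ℤ_[p] K`), assume `n ≥ 3` and
`(p,n) ≠ (3,3)`.  Then for every maximal proper `𝒪_K`-submodule `M` of `sl₁(Δ)` one has
`[M,M] = [sl₁(Δ), sl₁(Δ)]` (sets of finite sums of commutator brackets, i.e. spans of the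
bracket sets). -/
theorem stmt_8 (p : ℕ) [Fact (Nat.Prime p)]
    (K : Type) [Field K] [Algebra ℚ_[p] K] [FiniteDimensional ℚ_[p] K]
    [Algebra ℤ_[p] K] [IsScalarTower ℤ_[p] ℚ_[p] K]
    (d e f n : ℕ) [NeZero n]
    (hd : Module.finrank ℚ_[p] K = d)
    (π : K) (hπ : π ∈ integralClosure ℤ_[p] K)
    (hπirr : Irreducible (⟨π, hπ⟩ : integralClosure ℤ_[p] K))
    (he : ∃ u : (integralClosure ℤ_[p] K)ˣ,
      (p : integralClosure ℤ_[p] K) = ↑u * (⟨π, hπ⟩ : integralClosure ℤ_[p] K) ^ e)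
    (hef : d = e * f)
    (F : Type) [Field F] [Algebra K F]
    [Algebra ℚ_[p] F] [IsScalarTower ℚ_[p] K F]
    [Algebra ℤ_[p] F] [IsScalarTower ℤ_[p] ℚ_[p] F]
    [FiniteDimensional K F] [IsGalois K F]
    (hn : Module.finrank K F = n)
    (hπF : algebraMap K F π ∈ integralClosure ℤ_[p] F)
    (hFunram : Irreducible (⟨algebraMap K F π, hπF⟩ : integralClosure ℤ_[p] F))
    (θ : F ≃ₐ[K] F) (hθ : ∀ σ : F ≃ₐ[K] F, σ ∈ Subgroup.zpowers θ)
    (D : Type) [DivisionRing D] [Algebra K D]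
    [Algebra ℤ_[p] D] [IsScalarTower ℤ_[p] K D]
    (ϖ : D) (ι : F →ₐ[K] D)
    (hϖpow : ϖ ^ n = algebraMap K D π)
    (hϖcomm : ∀ α : F, ϖ * ι α = ι (θ α) * ϖ)
    (hbasis : ∀ x : D, ∃! a : Fin n → F, x = ∑ j : Fin n, ι (a j) * ϖ ^ (j : ℕ))
    -- the `𝒪_K`-module structure on `D` (restriction of the `K`-module structure)
    [Module (integralClosure ℤ_[p] K) D] [IsScalarTower (integralClosure ℤ_[p] K) K D]
    -- `L = sl₁(Δ)` as an `𝒪_K`-submodule of `D`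
    (L : Submodule (integralClosure ℤ_[p] K) D)
    (hL : (L : Set D) = {x : D | ∃ a : Fin n → F,
      (∀ j, a j ∈ integralClosure ℤ_[p] F) ∧ Algebra.trace K F (a 0) = 0 ∧
      x = ∑ j : Fin n, ι (a j) * ϖ ^ (j : ℕ)})
    (hcond : 3 ≤ n ∧ ¬(p = 3 ∧ n = 3))
    -- `M` a maximal proper `𝒪_K`-submodule of `L`
    (M : Submodule (integralClosure ℤ_[p] K) D) (hMlt : M < L)
    (hMmax : ∀ M' : Submodule (integralClosure ℤ_[p] K) D, M < M' → M' ≤ L → M' = L) :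
    Submodule.span ℤ_[p] {z : D | ∃ x ∈ M, ∃ y ∈ M, z = x * y - y * x} =
      Submodule.span ℤ_[p] {z : D | ∃ x ∈ L, ∃ y ∈ L, z = x * y - y * x} := by
  have hKF : IsScalarTower ℤ_[p] K F := by
    refine IsScalarTower.of_algebraMap_eq fun x => ?_
    rw [IsScalarTower.algebraMap_apply ℤ_[p] ℚ_[p] F, IsScalarTower.algebraMap_apply ℚ_[p] K F,
      IsScalarTower.algebraMap_apply ℤ_[p] ℚ_[p] K]
  have hfdF : FiniteDimensional ℚ_[p] F := FiniteDimensional.trans ℚ_[p] K F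
  have hdvrA : IsDiscreteValuationRing (integralClosure ℤ_[p] K) := dvr_integralClosure p K _ hπirr
  have hdvrB : IsDiscreteValuationRing (integralClosure ℤ_[p] F) := dvr_integralClosure p F _ hFunram
  have hfrA : IsFractionRing (integralClosure ℤ_[p] K) K :=
    integralClosure.isFractionRing_of_finite_extension ℚ_[p] K
  have hfrB : IsFractionRing (integralClosure ℤ_[p] F) F :=
    integralClosure.isFractionRing_of_finite_extension ℚ_[p] F
  have hmapint : ∀ x : integralClosure ℤ_[p] K, algebraMap K F x ∈ integralClosure ℤ_[p] F :=
    fun x => IsIntegral.algebraMap x.2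
  let φ : integralClosure ℤ_[p] K →+* integralClosure ℤ_[p] F :=
    RingHom.codRestrict ((algebraMap K F).comp (algebraMap (integralClosure ℤ_[p] K) K))
      (integralClosure ℤ_[p] F) hmapint
  letI algAB : Algebra (integralClosure ℤ_[p] K) (integralClosure ℤ_[p] F) := φ.toAlgebra
  have hABF : IsScalarTower (integralClosure ℤ_[p] K) (integralClosure ℤ_[p] F) F :=
    IsScalarTower.of_algebraMap_eq fun x => rfl
  have hZAB : IsScalarTower ℤ_[p] (integralClosure ℤ_[p] K) (integralClosure ℤ_[p] F) := by
    refine IsScalarTower.of_algebraMap_eq fun x => Subtype.ext ?_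
    exact IsScalarTower.algebraMap_apply ℤ_[p] K F x
  have hfinB : Module.Finite ℤ_[p] (integralClosure ℤ_[p] F) :=
    IsIntegralClosure.finite ℤ_[p] ℚ_[p] F (integralClosure ℤ_[p] F)
  have hfinAB : Module.Finite (integralClosure ℤ_[p] K) (integralClosure ℤ_[p] F) :=
    Module.Finite.of_restrictScalars_finite ℤ_[p] _ _
  have hABint : Algebra.IsIntegral (integralClosure ℤ_[p] K) (integralClosure ℤ_[p] F) := inferInstance
  have hicl : IsIntegralClosure (integralClosure ℤ_[p] F) (integralClosure ℤ_[p] K) F := by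
    refine ⟨Subtype.val_injective, fun {x} => ⟨fun hx => ?_, ?_⟩⟩
    · exact ⟨⟨x, isIntegral_trans (R := ℤ_[p]) (A := integralClosure ℤ_[p] K) x hx⟩, rfl⟩
    · rintro ⟨y, rfl⟩
      exact (hABint.isIntegral y).algebraMap
  have hfinres := finite_residue_ic p K
  let j : integralClosure ℤ_[p] F →+* D :=
    (ι : F →+* D).comp (algebraMap (integralClosure ℤ_[p] F) F)
  have hj : ∀ b : integralClosure ℤ_[p] F, j b = ι (b : F) := fun b => rfl
  have hjA : ∀ a : integralClosure ℤ_[p] K,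
      j (algebraMap (integralClosure ℤ_[p] K) (integralClosure ℤ_[p] F) a) = algebraMap K D (a : K) :=
    fun a => ι.commutes (a : K)
  have hRsmul : ∀ (r : ℤ_[p]) (x : D), r • x =
      j (algebraMap (integralClosure ℤ_[p] K) (integralClosure ℤ_[p] F)
        (algebraMap ℤ_[p] (integralClosure ℤ_[p] K) r)) * x := by
    intro r x
    rw [hjA, Algebra.smul_def, IsScalarTower.algebraMap_apply ℤ_[p] K D]
    rfl
  have hfinA : Module.Finite ℤ_[p] (integralClosure ℤ_[p] K) :=
    IsIntegralClosure.finite ℤ_[p] ℚ_[p] K (integralClosure ℤ_[p] K)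
  obtain ⟨u, hu⟩ := he
  have hidx := relIndex_of_maximal L M hMlt hMmax
  refine mid (A := integralClosure ℤ_[p] K) (B := integralClosure ℤ_[p] F) (K := K) (F := F)
    (D := D) (R := ℤ_[p]) n hcond.1 hn ⟨π, hπ⟩ hπirr hFunram ?_ θ hθ j ϖ ?_ ?_ hRsmul
    (p : ℤ_[p]) e u ?_ ?_ ?_ ?_ L.toAddSubgroup ?_ M.toAddSubgroup hMlt.le hidx
  · intro h3
    have hp3 : p ≠ 3 := fun h => hcond.2 ⟨h, h3⟩
    have hu : IsUnit (3 : ℤ_[p]) := by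
      have h1 : IsUnit ((3 : ℕ) : ℤ_[p]) := by
        rw [PadicInt.isUnit_iff, PadicInt.norm_natCast_eq_one_iff]
        exact (Nat.coprime_primes (Fact.out) Nat.prime_three).2 hp3
      exact_mod_cast h1
    have := hu.map (algebraMap ℤ_[p] (integralClosure ℤ_[p] K))
    rwa [map_ofNat] at this
  · rw [hjA, hϖpow]
  · intro b
    rw [hj, hj, hϖcomm]
    congr 2
    exact (algebraMap_galRestrict_apply (integralClosure ℤ_[p] K) (K := K) (L := F)
      (B := integralClosure ℤ_[p] F) θ b).symm
  · rw [map_natCast, hu]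
  · rw [IsLocalRing.jacobson_eq_maximalIdeal ⊥ bot_ne_top]
    exact (IsLocalRing.mem_maximalIdeal _).2 PadicInt.p_nonunit
  · intro a x
    rw [hjA, Algebra.commutes]
  · intro a b hab
    obtain ⟨c, -, hc⟩ := hbasis (∑ i : Fin n, j (a i) * ϖ ^ (i : ℕ))
    have h1 := hc (fun i => (a i : F)) rfl
    have h2 := hc (fun i => (b i : F)) hab
    funext i
    exact Subtype.ext (congrFun (h1.trans h2.symm) i)
  · intro x
    change x ∈ (L : Set D) ↔ _
    rw [hL]
    constructor
    · rintro ⟨a, ha, ht, rfl⟩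
      exact ⟨fun i => ⟨a i, ha i⟩, ht, rfl⟩
    · rintro ⟨a, ht, rfl⟩
      exact ⟨fun i => (a i : F), fun i => (a i).2, ht, rfl⟩
end

section
/- Assume that (p,n) ≠ (2,2). Then the derived subalgebra of L = sl_1(Δ) is [L,L] = π·L_0 ⊕ (⊕_{1≤j<n} L_j), where L_0 = 𝒪_F^0 and L_j = 𝒪_F·Π^j for 0 < j < n. -/
theorem aux_mem_or_inv (p : ℕ) [Fact (Nat.Prime p)] (F : Type) [Field F]
    [Algebra ℚ_[p] F] [FiniteDimensional ℚ_[p] F]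
    [Algebra ℤ_[p] F] [IsScalarTower ℤ_[p] ℚ_[p] F] (x : F) :
    x ∈ integralClosure ℤ_[p] F ∨ x⁻¹ ∈ integralClosure ℤ_[p] F := by
  have key : ∀ y : F, spectralNorm ℚ_[p] F y ≤ 1 → y ∈ integralClosure ℤ_[p] F := by
    intro y hy
    have hm : (minpoly ℚ_[p] y).Monic := minpoly.monic (Algebra.IsIntegral.isIntegral y)
    have h2 := (spectralValue_le_one_iff hm).1 hy
    have h3 : minpoly ℚ_[p] y ∈ Polynomial.lifts (algebraMap ℤ_[p] ℚ_[p]) := by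
      rw [Polynomial.lifts_iff_coeff_lifts]
      intro k
      exact ⟨⟨_, h2 k⟩, rfl⟩
    obtain ⟨q, hq, -, hqm⟩ := Polynomial.lifts_and_natDegree_eq_and_monic h3 hm
    refine ⟨q, hqm, ?_⟩
    have h4 := minpoly.aeval ℚ_[p] y
    rw [← hq, Polynomial.aeval_map_algebraMap] at h4
    exact h4
  have hmul : spectralNorm ℚ_[p] F x * spectralNorm ℚ_[p] F x⁻¹ ≤ 1 := by
    have h := map_mul (spectralMulAlgNorm ℚ_[p] F) x x⁻¹
    simp only [spectralMulAlgNorm_def] at h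
    rw [← h]
    by_cases hx : x = 0
    · simp [hx, spectralNorm_zero]
    · rw [mul_inv_cancel₀ hx, spectralNorm_one]
  by_contra! hcon
  have h1 : 1 < spectralNorm ℚ_[p] F x := by
    by_contra! h; exact hcon.1 (key _ h)
  have h2 : 1 < spectralNorm ℚ_[p] F x⁻¹ := by
    by_contra! h; exact hcon.2 (key _ h)
  nlinarith

instance aux_padic_quot (p : ℕ) [Fact (Nat.Prime p)] : Ring.HasFiniteQuotients ℤ_[p] where
  finiteQuotient {I} hI := by
    obtain ⟨k, rfl⟩ := PadicInt.ideal_eq_span_pow_p hI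
    have : NeZero (p ^ k) := ⟨pow_ne_zero _ (Fact.out : p.Prime).ne_zero⟩
    rw [← PadicInt.ker_toZModPow]
    exact Finite.of_equiv _
      (RingHom.quotientKerEquivRange (PadicInt.toZModPow (p := p) k)).symm.toEquiv

/-- Inertia is trivial and the maximal ideal is generated by `π`. -/
theorem aux_arith (p : ℕ) [Fact (Nat.Prime p)]
    (K : Type) [Field K] [Algebra ℚ_[p] K] [FiniteDimensional ℚ_[p] K]
    [Algebra ℤ_[p] K] [IsScalarTower ℤ_[p] ℚ_[p] K]
    (π : K) (hπ : π ∈ integralClosure ℤ_[p] K)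
    (F : Type) [Field F] [Algebra K F]
    [Algebra ℚ_[p] F] [IsScalarTower ℚ_[p] K F]
    [Algebra ℤ_[p] F] [IsScalarTower ℤ_[p] ℚ_[p] F]
    [FiniteDimensional K F] [IsGalois K F]
    (hπF : algebraMap K F π ∈ integralClosure ℤ_[p] F)
    (hFunram : Irreducible (⟨algebraMap K F π, hπF⟩ : integralClosure ℤ_[p] F)) :
    ∃ P : Ideal (integralClosure ℤ_[p] F), P.IsPrime ∧
      (∀ x : integralClosure ℤ_[p] F, x ∉ P → (x : F)⁻¹ ∈ integralClosure ℤ_[p] F) ∧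
      ((p : integralClosure ℤ_[p] F) ∈ P) ∧
      (∀ σ : F ≃ₐ[K] F, (∀ x y : integralClosure ℤ_[p] F, (y : F) = σ x → y - x ∈ P) → σ = 1) := by
  have : FiniteDimensional ℚ_[p] F := FiniteDimensional.trans ℚ_[p] K F
  have tZKF : IsScalarTower ℤ_[p] K F := by
    refine IsScalarTower.of_algebraMap_eq fun x => ?_
    rw [IsScalarTower.algebraMap_apply ℤ_[p] ℚ_[p] F, IsScalarTower.algebraMap_apply ℚ_[p] K F,
      ← IsScalarTower.algebraMap_apply ℤ_[p] ℚ_[p] K]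
  have : CharZero K := charZero_of_injective_algebraMap (algebraMap ℚ_[p] K).injective
  have : CharZero F := charZero_of_injective_algebraMap (algebraMap ℚ_[p] F).injective
  let A := integralClosure ℤ_[p] K
  let B := integralClosure ℤ_[p] F
  have fA : IsFractionRing A K := integralClosure.isFractionRing_of_finite_extension ℚ_[p] K
  have fB : IsFractionRing B F := integralClosure.isFractionRing_of_finite_extension ℚ_[p] F
  have finA : Module.Finite ℤ_[p] A := IsIntegralClosure.finite ℤ_[p] ℚ_[p] K A
  have finB : Module.Finite ℤ_[p] B := IsIntegralClosure.finite ℤ_[p] ℚ_[p] F B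
  have dA : IsDedekindDomain A := IsIntegralClosure.isDedekindDomain ℤ_[p] ℚ_[p] K A
  have dB : IsDedekindDomain B := IsIntegralClosure.isDedekindDomain ℤ_[p] ℚ_[p] F B
  have vB : ValuationRing B := by
    rw [ValuationRing.iff_isInteger_or_isInteger B F]
    intro x
    rcases aux_mem_or_inv p F x with h | h
    · exact Or.inl ⟨⟨x, h⟩, rfl⟩
    · exact Or.inr ⟨⟨x⁻¹, h⟩, rfl⟩
  have hnf : ¬ IsField B := fun h => by
    letI := h.toField
    exact hFunram.not_isUnit (isUnit_iff_ne_zero.2 hFunram.ne_zero)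
  have dvr : IsDiscreteValuationRing B := ((IsDiscreteValuationRing.TFAE B hnf).out 0 1).2 vB
  let πB : B := ⟨algebraMap K F π, hπF⟩
  let P : Ideal B := IsLocalRing.maximalIdeal B
  have hP : P = Ideal.span {πB} := hFunram.maximalIdeal_eq
  let φ : A →+* B := 
    { toFun := fun a => ⟨algebraMap K F a, a.2.map (IsScalarTower.toAlgHom ℤ_[p] K F)⟩
      map_one' := Subtype.ext (by simp)
      map_mul' := fun a b => Subtype.ext (by simp)
      map_zero' := Subtype.ext (by simp)
      map_add' := fun a b => Subtype.ext (by simp) }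
  letI algAB : Algebra A B := φ.toAlgebra
  have t1 : IsScalarTower A B F := IsScalarTower.of_algebraMap_eq fun x => rfl
  have t2 : IsScalarTower ℤ_[p] A B := IsScalarTower.of_algebraMap_eq fun x => by
    apply Subtype.ext
    exact IsScalarTower.algebraMap_apply ℤ_[p] K F x
  have finAB : Module.Finite A B := Module.Finite.of_restrictScalars_finite ℤ_[p] A B
  have hinj : Function.Injective (algebraMap A B) := fun a b h =>
    Subtype.ext ((algebraMap K F).injective (congrArg Subtype.val h))
  have tfree : Module.IsTorsionFree A B := by
    have : FaithfulSMul A B := (faithfulSMul_iff_algebraMap_injective A B).2 hinj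
    infer_instance
  have flat : Module.Flat A B := inferInstance
  have gg : IsGaloisGroup (F ≃ₐ[K] F) A B := IsGaloisGroup.of_isFractionRing _ A B K F
  have qA : Ring.HasFiniteQuotients A := Ring.HasFiniteQuotients.of_module_finite ℤ_[p] A
  have : CharZero (FractionRing A) := inferInstance
  have pP : P.IsPrime := inferInstance
  let pA : Ideal A := P.under A
  have hπA : (⟨π, hπ⟩ : A) ∈ pA := by
    change algebraMap A B ⟨π, hπ⟩ ∈ P
    rw [hP]; exact Ideal.mem_span_singleton_self πB
  have hram : pA.ramificationIdx' P = 1 := by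
    by_contra hne
    rw [← ne_eq, Ideal.ramificationIdx'_ne_one_iff Ideal.map_comap_le] at hne
    have h1 : πB ∈ P ^ 2 := hne (Ideal.mem_map_of_mem _ hπA)
    rw [hP, Ideal.span_singleton_pow, Ideal.mem_span_singleton] at h1
    obtain ⟨c, hc⟩ := h1
    apply hFunram.not_isUnit
    refine IsUnit.of_mul_eq_one c (mul_left_cancel₀ hFunram.ne_zero ?_)
    change πB * (πB * c) = πB * 1
    rw [mul_one, ← mul_assoc, ← pow_two]; exact hc.symm
  have hpA : pA ≠ ⊥ := by
    intro h
    rw [h, Ideal.mem_bot] at hπA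
    apply hFunram.ne_zero
    have : π = 0 := congrArg Subtype.val hπA
    apply Subtype.ext; simp [this]
  rw [Ideal.ramificationIdx'_eq_ramificationIdx pA P hpA,
    ← Ideal.ramificationIdxIn_eq_ramificationIdx pA P (F ≃ₐ[K] F),
    ← Ideal.card_inertia_eq_ramificationIdxIn (G := F ≃ₐ[K] F) pA P] at hram
  refine ⟨P, pP, ?_, ?_, ?_⟩
  · intro x hx
    have : IsUnit x := by
      by_contra h; exact hx ((IsLocalRing.mem_maximalIdeal x).2 h)
    obtain ⟨y, hy⟩ := this.exists_right_inv
    have h2 : (x : F) * (y : F) = 1 := congrArg Subtype.val hy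
    rw [← eq_inv_of_mul_eq_one_right h2]
    exact y.2
  · have hloc : IsLocalHom (algebraMap ℤ_[p] B) := by
      have : FaithfulSMul ℤ_[p] B := by
        refine (faithfulSMul_iff_algebraMap_injective _ _).2 fun a b h => ?_
        have h1 : algebraMap ℤ_[p] F a = algebraMap ℤ_[p] F b := congrArg Subtype.val h
        rw [IsScalarTower.algebraMap_apply ℤ_[p] ℚ_[p] F, IsScalarTower.algebraMap_apply ℤ_[p] ℚ_[p] F] at h1
        exact IsFractionRing.injective ℤ_[p] ℚ_[p] ((algebraMap ℚ_[p] F).injective h1)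
      infer_instance
    rw [IsLocalRing.mem_maximalIdeal, mem_nonunits_iff]
    intro h
    rw [← map_natCast (algebraMap ℤ_[p] B)] at h
    exact PadicInt.p_nonunit (isUnit_of_map_unit _ _ h)
  · intro σ hσ
    have hb : Ideal.inertia (F ≃ₐ[K] F) P = ⊥ := Subgroup.eq_bot_of_card_eq _ hram
    have : σ ∈ Ideal.inertia (F ≃ₐ[K] F) P := fun x => hσ x (σ • x) rfl
    rw [hb] at this
    exact this

theorem aux_char (p : ℕ) [Fact (Nat.Prime p)]
    (K : Type) [Field K] 
    (F : Type) [Field F] [Algebra K F] [Algebra ℤ_[p] K]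
    [Algebra ℤ_[p] F] [IsScalarTower ℤ_[p] K F]
    [FiniteDimensional K F]
    (P : Ideal (integralClosure ℤ_[p] F)) (hP : P.IsPrime)
    (hin : ∀ σ : F ≃ₐ[K] F,
      (∀ x y : integralClosure ℤ_[p] F, (y : F) = σ x → y - x ∈ P) → σ = 1)
    (w : (F ≃ₐ[K] F) → ℤ) (g : F ≃ₐ[K] F) (hg : (w g : integralClosure ℤ_[p] F) ∉ P) :
    ∃ x z : integralClosure ℤ_[p] F, (z : F) = ∑ σ : F ≃ₐ[K] F, (w σ : F) * σ x ∧ z ∉ P := by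
  by_contra! hcon
  let B := integralClosure ℤ_[p] F
  let χ : (F ≃ₐ[K] F) → (B →* (B ⧸ P)) := fun σ =>
    ((Ideal.Quotient.mk P).comp (MulSemiringAction.toRingHom (F ≃ₐ[K] F) B σ) : B →* (B ⧸ P))
  have hχ : ∀ σ (x : B), χ σ x = Ideal.Quotient.mk P (σ • x) := fun σ x => rfl
  have hχi : Function.Injective χ := by
    intro σ τ h
    have h1 : σ * τ⁻¹ = 1 := by
      apply hin
      intro x y hy
      have h2 : σ • (τ⁻¹ • x) - τ • (τ⁻¹ • x) ∈ P := by
        rw [← Ideal.Quotient.eq, ← hχ, ← hχ, h]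
      rw [smul_inv_smul] at h2
      convert h2 using 2
      exact Subtype.ext hy
    exact mul_inv_eq_one.1 h1
  have hli := (linearIndependent_monoidHom B (B ⧸ P)).comp χ hχi
  rw [Fintype.linearIndependent_iff] at hli
  have := hli (fun σ => Ideal.Quotient.mk P (w σ : B)) (by
    ext x
    have h3 := hcon x (∑ σ : F ≃ₐ[K] F, (w σ : B) * (σ • x)) (by
      simp; rfl)
    rw [← Ideal.Quotient.eq_zero_iff_mem, map_sum] at h3
    simpa [hχ] using h3) g
  exact hg (Ideal.Quotient.eq_zero_iff_mem.1 this)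

theorem aux_order {K F : Type} [Field K] [Field F] [Algebra K F] [FiniteDimensional K F]
    [IsGalois K F] (n : ℕ) (hn : Module.finrank K F = n)
    (θ : F ≃ₐ[K] F) (hθ : ∀ σ : F ≃ₐ[K] F, σ ∈ Subgroup.zpowers θ) : orderOf θ = n := by
  rw [orderOf_eq_card_of_forall_mem_zpowers hθ, IsGalois.card_aut_eq_finrank, hn]

theorem aux_trace {K F : Type} [Field K] [Field F] [Algebra K F] [FiniteDimensional K F]
    [IsGalois K F] (n : ℕ) (hn : Module.finrank K F = n)
    (θ : F ≃ₐ[K] F) (hθ : ∀ σ : F ≃ₐ[K] F, σ ∈ Subgroup.zpowers θ) (x : F) :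
    algebraMap K F (Algebra.trace K F x) = ∑ i ∈ Finset.range n, (θ ^ i) x := by
  classical
  rw [trace_eq_sum_automorphisms, ← aux_order n hn θ hθ]
  rw [← IsCyclic.image_range_orderOf hθ, Finset.sum_image]
  intro i hi j hj h
  exact pow_injOn_Iio_orderOf (by simpa using hi) (by simpa using hj) h

theorem aux_hilbert {K F : Type} [Field K] [Field F] [Algebra K F] [FiniteDimensional K F]
    [IsGalois K F] (n : ℕ) (hn : Module.finrank K F = n)
    (θ : F ≃ₐ[K] F) (hθ : ∀ σ : F ≃ₐ[K] F, σ ∈ Subgroup.zpowers θ)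
    (B : Subring F) (hB : ∀ x ∈ B, ∀ σ : F ≃ₐ[K] F, σ x ∈ B)
    (c : F) (hc : c ∈ B) (hc1 : Algebra.trace K F c = 1)
    (b : F) (hb : b ∈ B) (hb0 : Algebra.trace K F b = 0) :
    ∃ a ∈ B, θ a - a = b := by
  let s : ℕ → F := fun i => ∑ k ∈ Finset.range i, (θ ^ k) b
  have hs : ∀ i, s i ∈ B := fun i => sum_mem fun k _ => hB _ hb _
  have hsn : s n = 0 := by
    change ∑ k ∈ Finset.range n, (θ ^ k) b = 0
    rw [← aux_trace n hn θ hθ, hb0, map_zero]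
  have hs0 : s 0 = 0 := rfl
  have hss : ∀ i, θ (s i) = s (i + 1) - b := fun i => by
    change θ (∑ k ∈ Finset.range i, (θ ^ k) b) = ∑ k ∈ Finset.range (i + 1), (θ ^ k) b - b
    rw [Finset.sum_range_succ', map_sum]
    simp [pow_succ']
  have hcs : ∑ i ∈ Finset.range n, (θ ^ (i + 1)) c = 1 := by
    have h1 := aux_trace n hn θ hθ c
    rw [hc1, map_one] at h1
    have h2 := congrArg θ h1
    rw [map_one, map_sum] at h2
    rw [h2]
    exact Finset.sum_congr rfl fun i _ => by simp [pow_succ']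
  refine ⟨- ∑ i ∈ Finset.range n, s i * (θ ^ i) c,
    neg_mem (sum_mem fun i _ => mul_mem (hs i) (hB _ hc _)), ?_⟩
  have h1 : θ (∑ i ∈ Finset.range n, s i * (θ ^ i) c)
      = ∑ i ∈ Finset.range n, s (i + 1) * (θ ^ (i + 1)) c - b := by
    have : b = b * ∑ i ∈ Finset.range n, (θ ^ (i + 1)) c := by rw [hcs, mul_one]
    rw [this, Finset.mul_sum, ← Finset.sum_sub_distrib, map_sum]
    refine Finset.sum_congr rfl fun i _ => ?_
    rw [map_mul, hss, pow_succ']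
    simp only [AlgEquiv.mul_apply]
    ring
  have h2 := Finset.sum_range_succ' (fun i => s i * (θ ^ i) c) n
  rw [Finset.sum_range_succ, hsn, hs0] at h2
  rw [map_neg, h1]
  linear_combination h2

theorem aux_main (p : ℕ) [Fact (Nat.Prime p)]
    (K : Type) [Field K] [Algebra ℚ_[p] K] [FiniteDimensional ℚ_[p] K]
    [Algebra ℤ_[p] K] [IsScalarTower ℤ_[p] ℚ_[p] K] (n : ℕ)
    (π : K) (hπ : π ∈ integralClosure ℤ_[p] K)
    (F : Type) [Field F] [Algebra K F]
    [Algebra ℚ_[p] F] [IsScalarTower ℚ_[p] K F]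
    [Algebra ℤ_[p] F] [IsScalarTower ℤ_[p] ℚ_[p] F] [IsScalarTower ℤ_[p] K F]
    [FiniteDimensional K F] [IsGalois K F]
    (hn : Module.finrank K F = n)
    (hπF : algebraMap K F π ∈ integralClosure ℤ_[p] F)
    (hFunram : Irreducible (⟨algebraMap K F π, hπF⟩ : integralClosure ℤ_[p] F))
    (θ : F ≃ₐ[K] F) (hθ : ∀ σ : F ≃ₐ[K] F, σ ∈ Subgroup.zpowers θ)
    (hcond : ¬(p = 2 ∧ n = 2)) :
    (∃ c ∈ integralClosure ℤ_[p] F, Algebra.trace K F c = 1) ∧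
    ∀ j, 0 < j → j < n → ∃ α ∈ integralClosure ℤ_[p] F, Algebra.trace K F α = 0 ∧
      α - (θ ^ j) α ≠ 0 ∧ (α - (θ ^ j) α)⁻¹ ∈ integralClosure ℤ_[p] F := by
  classical
  obtain ⟨P, hP, hinv, hpP, hin⟩ := aux_arith p K π hπ F hπF hFunram
  have key := aux_char p K F P hP hin
  have hord := aux_order n hn θ hθ
  constructor
  · obtain ⟨x, z, hz, hzP⟩ := key (fun _ => 1) 1 (by
      rw [Int.cast_one]; exact fun h => hP.ne_top ((Ideal.eq_top_iff_one _).2 h))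
    simp only [Int.cast_one, one_mul] at hz
    rw [← trace_eq_sum_automorphisms] at hz
    have hz0 : Algebra.trace K F (x : F) ≠ 0 := by
      intro h
      rw [h, map_zero] at hz
      exact hzP ((show z = 0 from Subtype.ext hz) ▸ P.zero_mem)
    refine ⟨(Algebra.trace K F (x : F))⁻¹ • (x : F), ?_, ?_⟩
    · rw [Algebra.smul_def, map_inv₀, ← hz]
      exact mul_mem (hinv z hzP) x.2
    · rw [map_smul, smul_eq_mul, inv_mul_cancel₀ hz0]
  · intro j hj0 hjn
    let w : (F ≃ₐ[K] F) → ℤ := fun σ => (if σ = θ then 1 else 0) - (if σ = 1 then 1 else 0)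
      - (if σ = θ ^ (j + 1) then 1 else 0) + (if σ = θ ^ j then 1 else 0)
    have hpow : ∀ a b : ℕ, a < n → b < n → θ ^ a = θ ^ b → a = b := fun a b ha hb h =>
      pow_injOn_Iio_orderOf (by simpa [hord] using ha) (by simpa [hord] using hb) h
    have hθn : θ ^ n = 1 := by rw [← hord, pow_orderOf_eq_one]
    have h01 : (1 : F ≃ₐ[K] F) ≠ θ := fun h => by
      have := hpow 0 1 (by omega) (by omega) (by simpa using h)
      omega
    have hj1 : θ ^ j ≠ 1 := fun h => by
      have := hpow j 0 (by omega) (by omega) (by simpa using h)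
      omega
    have hjj : θ ≠ θ ^ (j + 1) := fun h => by
      rw [pow_succ] at h
      exact hj1 (right_eq_mul.1 h)
    have h1P : (1 : integralClosure ℤ_[p] F) ∉ P := fun h => hP.ne_top ((Ideal.eq_top_iff_one _).2 h)
    have hw : ∃ g, (w g : integralClosure ℤ_[p] F) ∉ P := by
      by_cases hj : j = 1
      · subst hj
        by_cases hn2 : n = 2
        · refine ⟨θ, ?_⟩
          have hw : w θ = 2 := by
            change _ - _ - _ + _ = _
            rw [if_pos rfl, if_neg h01.symm, if_neg hjj, if_pos (pow_one θ).symm]; norm_num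
          rw [hw]
          intro h2
          have hp2 : p ≠ 2 := fun h => hcond ⟨h, hn2⟩
          have hodd : Odd p := (Fact.out : p.Prime).odd_of_ne_two hp2
          obtain ⟨k, hk⟩ := hodd
          apply h1P
          have : (1 : integralClosure ℤ_[p] F) = p - ((2 : ℤ) : integralClosure ℤ_[p] F) * k := by
            have h3 : (p : integralClosure ℤ_[p] F) = 2 * k + 1 := by exact_mod_cast congrArg _ hk
            rw [h3]; push_cast; ring
          rw [this]
          exact P.sub_mem hpP (P.mul_mem_right _ h2)
        · refine ⟨1, ?_⟩
          have h2 : (1 : F ≃ₐ[K] F) ≠ θ ^ (1 + 1) := fun h => by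
            have := hpow 0 2 (by omega) (by omega) (by simpa using h)
            omega
          have hw : w 1 = -1 := by
            change _ - _ - _ + _ = _
            rw [if_neg h01, if_pos rfl, if_neg h2, if_neg hj1.symm]; norm_num
          rw [hw]
          simpa using h1P
      · refine ⟨θ, ?_⟩
        have h2 : θ ≠ θ ^ j := fun h => by
          have := hpow 1 j (by omega) (by omega) (by simpa using h)
          omega
        have hw : w θ = 1 := by
          change _ - _ - _ + _ = _
          rw [if_pos rfl, if_neg h01.symm, if_neg hjj, if_neg h2]; norm_num
        rw [hw]
        simpa using h1P
    obtain ⟨g, hg⟩ := hw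
    obtain ⟨x, z, hz, hzP⟩ := key w g hg
    have hz' : (z : F) = (θ x - x) - (θ ^ j) (θ x - x) := by
      rw [hz]
      simp only [w, Int.cast_add, Int.cast_sub, add_mul, sub_mul, Finset.sum_add_distrib,
        Finset.sum_sub_distrib, Int.cast_ite, Int.cast_one, Int.cast_zero, ite_mul, one_mul,
        zero_mul, Finset.sum_ite_eq', Finset.mem_univ, if_true, map_sub, pow_succ,
        AlgEquiv.mul_apply, AlgEquiv.one_apply]
      ring
    have hθx : θ (x : F) ∈ integralClosure ℤ_[p] F :=
      x.2.map (θ.toAlgHom.restrictScalars ℤ_[p])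
    refine ⟨θ x - x, sub_mem hθx x.2, ?_, ?_, ?_⟩
    · rw [map_sub, Algebra.trace_eq_of_algEquiv, sub_self]
    · rw [← hz']
      intro h
      exact hzP ((show z = 0 from Subtype.ext h) ▸ P.zero_mem)
    · rw [← hz']
      exact hinv z hzP


/-- With `K, F, D, Δ` as in Statement 0 (cyclic division algebra of index `n`,
`Δ = ⊕_j 𝒪_F ϖ^j`, `L = sl₁(Δ) = 𝒪_F⁰ ⊕ (⊕_{1≤j<n} 𝒪_F ϖ^j)`), assume `(p,n) ≠ (2,2)`.
Then the derived subalgebra `[L,L]` (set of finite sums of commutator brackets of elements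
of `L`, equivalently the `ℤ_p`-span of the brackets) equals
`π·𝒪_F⁰ ⊕ (⊕_{1≤j<n} 𝒪_F ϖ^j)`. -/
theorem stmt_9 (p : ℕ) [Fact (Nat.Prime p)]
    (K : Type) [Field K] [Algebra ℚ_[p] K] [FiniteDimensional ℚ_[p] K]
    [Algebra ℤ_[p] K] [IsScalarTower ℤ_[p] ℚ_[p] K]
    (d e f n : ℕ) [NeZero n]
    (hd : Module.finrank ℚ_[p] K = d)
    (π : K) (hπ : π ∈ integralClosure ℤ_[p] K)
    (hπirr : Irreducible (⟨π, hπ⟩ : integralClosure ℤ_[p] K))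
    (he : ∃ u : (integralClosure ℤ_[p] K)ˣ,
      (p : integralClosure ℤ_[p] K) = ↑u * (⟨π, hπ⟩ : integralClosure ℤ_[p] K) ^ e)
    (hef : d = e * f)
    (F : Type) [Field F] [Algebra K F]
    [Algebra ℚ_[p] F] [IsScalarTower ℚ_[p] K F]
    [Algebra ℤ_[p] F] [IsScalarTower ℤ_[p] ℚ_[p] F]
    [FiniteDimensional K F] [IsGalois K F]
    (hn : Module.finrank K F = n)
    (hπF : algebraMap K F π ∈ integralClosure ℤ_[p] F)
    (hFunram : Irreducible (⟨algebraMap K F π, hπF⟩ : integralClosure ℤ_[p] F))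
    (θ : F ≃ₐ[K] F) (hθ : ∀ σ : F ≃ₐ[K] F, σ ∈ Subgroup.zpowers θ)
    (D : Type) [DivisionRing D] [Algebra K D]
    [Algebra ℤ_[p] D] [IsScalarTower ℤ_[p] K D]
    (ϖ : D) (ι : F →ₐ[K] D)
    (hϖpow : ϖ ^ n = algebraMap K D π)
    (hϖcomm : ∀ α : F, ϖ * ι α = ι (θ α) * ϖ)
    (hbasis : ∀ x : D, ∃! a : Fin n → F, x = ∑ j : Fin n, ι (a j) * ϖ ^ (j : ℕ))
    -- `L = sl₁(Δ)`
    (L : Submodule ℤ_[p] D)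
    (hL : (L : Set D) = {x : D | ∃ a : Fin n → F,
      (∀ j, a j ∈ integralClosure ℤ_[p] F) ∧ Algebra.trace K F (a 0) = 0 ∧
      x = ∑ j : Fin n, ι (a j) * ϖ ^ (j : ℕ)})
    (hcond : ¬(p = 2 ∧ n = 2)) :
    (Submodule.span ℤ_[p] {z : D | ∃ x ∈ L, ∃ y ∈ L, z = x * y - y * x} : Set D) =
      -- `π·L_0 ⊕ (⊕_{1 ≤ j < n} L_j)`
      {x : D | ∃ a : Fin n → F,
        (∀ j, a j ∈ integralClosure ℤ_[p] F) ∧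
        (∃ b : F, b ∈ integralClosure ℤ_[p] F ∧ Algebra.trace K F b = 0 ∧
          a 0 = algebraMap K F π * b) ∧
        x = ∑ j : Fin n, ι (a j) * ϖ ^ (j : ℕ)} := by
  have tZKF : IsScalarTower ℤ_[p] K F := by
    refine IsScalarTower.of_algebraMap_eq fun x => ?_
    rw [IsScalarTower.algebraMap_apply ℤ_[p] ℚ_[p] F, IsScalarTower.algebraMap_apply ℚ_[p] K F,
      ← IsScalarTower.algebraMap_apply ℤ_[p] ℚ_[p] K]
  obtain ⟨⟨c, hc, hc1⟩, hα⟩ := aux_main p K n π hπ F hn hπF hFunram θ hθ hcond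
  have hstab : ∀ x ∈ integralClosure ℤ_[p] F, ∀ σ : F ≃ₐ[K] F, σ x ∈ integralClosure ℤ_[p] F :=
    fun x hx σ => IsIntegral.map (σ.toAlgHom.restrictScalars ℤ_[p]) hx
  have hθn : θ ^ n = 1 := by rw [← aux_order n hn θ hθ, pow_orderOf_eq_one]
  have hsm : ∀ (r : ℤ_[p]) (a : F), ι (r • a) = r • ι a := fun r a => by
    rw [← algebraMap_smul K r a, map_smul, algebraMap_smul]
  have hιπ : ι (algebraMap K F π) = ϖ ^ n := by rw [hϖpow, AlgHom.commutes]
  have hpowc : ∀ (k : ℕ) (a : F), ϖ ^ k * ι a = ι ((θ ^ k) a) * ϖ ^ k := by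
    intro k
    induction k with
    | zero => intro a; simp
    | succ k ih =>
      intro a
      rw [pow_succ, mul_assoc, hϖcomm, ← mul_assoc, ih, mul_assoc, pow_succ, AlgEquiv.mul_apply]
  have hmul : ∀ (i j : ℕ) (a b : F), (ι a * ϖ ^ i) * (ι b * ϖ ^ j)
      = ι (a * (θ ^ i) b) * ϖ ^ (i + j) := by
    intro i j a b
    rw [mul_assoc, ← mul_assoc (ϖ ^ i), hpowc, map_mul, pow_add]
    simp only [mul_assoc]
  have hbr : ∀ (i j : ℕ) (a b : F), (ι a * ϖ ^ i) * (ι b * ϖ ^ j) - (ι b * ϖ ^ j) * (ι a * ϖ ^ i)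
      = ι (a * (θ ^ i) b - b * (θ ^ j) a) * ϖ ^ (i + j) := by
    intro i j a b
    rw [hmul, hmul, add_comm j i, map_sub, sub_mul]
  have hsingle : ∀ (k : Fin n) (a : F),
      ι a * ϖ ^ (k : ℕ) = ∑ j : Fin n, ι ((Pi.single k a : Fin n → F) j) * ϖ ^ (j : ℕ) := by
    intro k a
    rw [Finset.sum_eq_single k]
    · simp
    · intro j _ hj; simp [hj]
    · simp
  let M : Submodule ℤ_[p] D :=
    { carrier := {x : D | ∃ a : Fin n → F,
        (∀ j, a j ∈ integralClosure ℤ_[p] F) ∧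
        (∃ b : F, b ∈ integralClosure ℤ_[p] F ∧ Algebra.trace K F b = 0 ∧
          a 0 = algebraMap K F π * b) ∧
        x = ∑ j : Fin n, ι (a j) * ϖ ^ (j : ℕ)}
      zero_mem' := ⟨0, fun j => zero_mem _, ⟨0, zero_mem _, by simp, by simp⟩, by simp⟩
      add_mem' := by
        rintro x y ⟨a, ha, ⟨b, hb, hb0, hab⟩, rfl⟩ ⟨a', ha', ⟨b', hb', hb0', hab'⟩, rfl⟩
        refine ⟨a + a', fun j => add_mem (ha j) (ha' j), ⟨b + b', add_mem hb hb', ?_, ?_⟩, ?_⟩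
        · rw [map_add, hb0, hb0', add_zero]
        · rw [Pi.add_apply, hab, hab', mul_add]
        · simp [add_mul, Finset.sum_add_distrib]
      smul_mem' := by
        rintro r x ⟨a, ha, ⟨b, hb, hb0, hab⟩, rfl⟩
        refine ⟨r • a, fun j => Subalgebra.smul_mem _ (ha j) r,
          ⟨r • b, Subalgebra.smul_mem _ hb r, ?_, ?_⟩, ?_⟩
        · rw [← algebraMap_smul K r b, map_smul, hb0, smul_zero]
        · rw [Pi.smul_apply, hab, mul_smul_comm]
        · rw [Finset.smul_sum]
          refine Finset.sum_congr rfl fun j _ => ?_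
          rw [Pi.smul_apply, hsm, smul_mul_assoc] }
  have hM1 : ∀ k, 0 < k → k < n → ∀ a ∈ integralClosure ℤ_[p] F, ι a * ϖ ^ k ∈ M := by
    intro k hk0 hkn a ha
    have hne : (0 : Fin n) ≠ ⟨k, hkn⟩ := by
      intro h
      have := congrArg Fin.val h
      simp at this; omega
    refine ⟨Pi.single ⟨k, hkn⟩ a, fun j => ?_, ⟨0, zero_mem _, by simp, ?_⟩, hsingle ⟨k, hkn⟩ a⟩
    · by_cases hj : j = ⟨k, hkn⟩
      · subst hj; simpa using ha
      · simp [hj]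
    · simp [hne]
  have hM0 : ∀ b ∈ integralClosure ℤ_[p] F, Algebra.trace K F b = 0 →
      ι (algebraMap K F π * b) ∈ M := by
    intro b hb hb0
    refine ⟨Pi.single 0 (algebraMap K F π * b), fun j => ?_, ⟨b, hb, hb0, by simp⟩, ?_⟩
    · by_cases hj : j = 0
      · subst hj; simpa using mul_mem hπF hb
      · simp [hj]
    · rw [← hsingle]; simp
  have hL1 : ∀ k, 0 < k → k < n → ∀ a ∈ integralClosure ℤ_[p] F, ι a * ϖ ^ k ∈ L := by
    intro k hk0 hkn a ha
    have hne : (0 : Fin n) ≠ ⟨k, hkn⟩ := by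
      intro h
      have := congrArg Fin.val h
      simp at this; omega
    rw [← SetLike.mem_coe, hL]
    refine ⟨Pi.single ⟨k, hkn⟩ a, fun j => ?_, by simp [hne], hsingle ⟨k, hkn⟩ a⟩
    by_cases hj : j = ⟨k, hkn⟩
    · subst hj; simpa using ha
    · simp [hj]
  have hL0 : ∀ b ∈ integralClosure ℤ_[p] F, Algebra.trace K F b = 0 → ι b ∈ L := by
    intro b hb hb0
    rw [← SetLike.mem_coe, hL]
    refine ⟨Pi.single 0 b, fun j => ?_, by simpa using hb0, ?_⟩
    · by_cases hj : j = 0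
      · subst hj; simpa using hb
      · simp [hj]
    · rw [← hsingle]; simp
  change (_ : Set D) = (M : Set D)
  rw [SetLike.coe_set_eq]
  apply le_antisymm
  · rw [Submodule.span_le]
    rintro z ⟨x, hx, y, hy, rfl⟩
    rw [← SetLike.mem_coe, hL] at hx hy
    obtain ⟨a, ha, -, rfl⟩ := hx
    obtain ⟨b, hb, -, rfl⟩ := hy
    rw [SetLike.mem_coe, Finset.sum_mul_sum, Finset.sum_mul_sum, Finset.sum_comm (s := Finset.univ)
      (f := fun i j : Fin n => ι (b i) * ϖ ^ (i : ℕ) * (ι (a j) * ϖ ^ (j : ℕ))),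
      ← Finset.sum_sub_distrib]
    refine sum_mem fun i _ => ?_
    rw [← Finset.sum_sub_distrib]
    refine sum_mem fun j _ => ?_
    rw [hbr]
    have hi := i.2
    have hj := j.2
    have hint : a i * (θ ^ (i : ℕ)) (b j) - b j * (θ ^ (j : ℕ)) (a i) ∈ integralClosure ℤ_[p] F :=
      sub_mem (mul_mem (ha i) (hstab _ (hb j) _)) (mul_mem (hb j) (hstab _ (ha i) _))
    rcases Nat.lt_trichotomy ((i : ℕ) + j) n with h | h | h
    · by_cases h0 : (i : ℕ) + j = 0
      · have hi0 : (i : ℕ) = 0 := by omega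
        have hj0 : (j : ℕ) = 0 := by omega
        rw [hi0, hj0]
        simp [mul_comm]
      · exact hM1 _ (by omega) h _ hint
    · rw [h, ← hιπ, ← map_mul, mul_comm]
      refine hM0 _ hint ?_
      have : b j * (θ ^ (j : ℕ)) (a i) = (θ ^ (j : ℕ)) (a i * (θ ^ (i : ℕ)) (b j)) := by
        rw [map_mul, ← AlgEquiv.mul_apply, ← pow_add, add_comm, h, hθn, AlgEquiv.one_apply, mul_comm]
      rw [this, map_sub, Algebra.trace_eq_of_algEquiv, sub_self]
    · obtain ⟨k, hk⟩ := Nat.exists_eq_add_of_lt h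
      rw [hk, add_assoc, pow_add, ← hιπ, ← mul_assoc, ← map_mul]
      exact hM1 _ (by omega) (by omega) _ (mul_mem hint hπF)
  · rintro x ⟨a, ha, ⟨b, hb, hb0, hab⟩, rfl⟩
    refine sum_mem fun j _ => ?_
    by_cases hj : j = 0
    · subst hj
      rw [hab]
      simp only [Fin.val_zero, pow_zero, mul_one]
      obtain ⟨a', ha', ha''⟩ := aux_hilbert n hn θ hθ (integralClosure ℤ_[p] F).toSubring
        hstab c hc hc1 b hb hb0
      by_cases hn1 : n = 1
      · have hθ1 : θ = 1 := by rw [← pow_one θ, ← hn1, hθn]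
        have hb1 : b = 0 := by rw [← ha'', hθ1]; simp
        rw [hb1, mul_zero, map_zero]; exact zero_mem _
      have hn0 : n ≠ 0 := NeZero.ne n
      apply Submodule.subset_span
      refine ⟨ι (θ a') * ϖ ^ 1, hL1 1 one_pos (by omega) _ (hstab _ ha' θ), ι 1 * ϖ ^ (n - 1),
        hL1 (n - 1) (by omega) (by omega) _ (one_mem _), ?_⟩
      rw [hbr, show 1 + (n - 1) = n by omega, ← hιπ, ← map_mul, mul_comm, ← AlgEquiv.mul_apply,
        ← pow_succ, show n - 1 + 1 = n by omega, hθn, ← ha'']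
      simp
    · have hj0 : 0 < (j : ℕ) := Nat.pos_of_ne_zero fun h => hj (Fin.ext (by simpa using h))
      obtain ⟨α, hαi, hα0, hαne, hαinv⟩ := hα j hj0 j.2
      apply Submodule.subset_span
      refine ⟨ι α, hL0 α hαi hα0, ι ((α - (θ ^ (j : ℕ)) α)⁻¹ * a j) * ϖ ^ (j : ℕ),
        hL1 _ hj0 j.2 _ (mul_mem hαinv (ha j)), ?_⟩
      have h := hbr 0 j α ((α - (θ ^ (j : ℕ)) α)⁻¹ * a j)
      rw [pow_zero, mul_one, zero_add] at h
      rw [h]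
      congr 2
      simp only [pow_zero, AlgEquiv.one_apply]
      field_simp
end
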